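/- Assume GLH and fix s ∈ ℂ. Let Ω_s := {w ∈ ℂ : Re(s+w) > 1/2, Re(s+2w) > 1, Re w > 0} and P_s := {1, 3/2−s} ∪ {(3/2−s)/(2j+1) : j ∈ ℕ, j ≥ 1} ∪ {(j+1−2js)/(2j+1) : j ∈ ℕ, j ≥ 1}. Then there exists a function G : ℂ → ℂ that is meromorphic on Ω_s, holomorphic on Ω_s \ P_s, and satisfies G(w) = ζ(2w)·ζ(2s+2w−1)·Σ_{d odd squarefree ≥ 1} L(s,χ_{8d})·d^{−w} for every w ∈ ℂ with Re w > max(1, 3/2 − Re s) (the series converging absolutely there). -/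

import Mathlib

open Complex

noncomputable section

/-- The generalized Lindelöf hypothesis for Dirichlet L-functions: for every `ε > 0`,
`σ ≥ 1/2` and `t ∈ ℝ`, `|L(σ+it,χ)| ≤ C q^ε` for all primitive characters `χ` of conductor
(= level) `q`. -/
def GLH : Prop :=
  ∀ ε : ℝ, 0 < ε → ∀ σ : ℝ, 1 / 2 ≤ σ → ∀ t : ℝ, ∃ C : ℝ, 0 < C ∧
    ∀ (q : ℕ) [NeZero q] (χ : DirichletCharacter ℂ q), χ.IsPrimitive →
      ‖χ.LFunction ((σ : ℂ) + (t : ℂ) * Complex.I)‖ ≤ C * (q : ℝ) ^ ε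


section GaussSums
open Filter Topology Complex

lemma aux_tsum_gauss {c : ℕ → ℂ} {b : ℕ → ℂ} (hc : Tendsto (fun k => (c k).re) atTop atTop)
    (hbc : ∀ k, (b k * c k).re = 0) :
    Tendsto (fun k => ∑' m : ℤ, cexp (-Real.pi * c k * (m + b k) ^ 2 + Real.pi * c k * (b k) ^ 2))
      atTop (𝓝 1) := by
  have h1 : (∑' m : ℤ, if m = 0 then (1:ℂ) else 0) = 1 := by simp
  rw [← h1]
  have hexp : ∀ k (m : ℤ), ‖cexp (-Real.pi * c k * (m + b k) ^ 2 + Real.pi * c k * (b k) ^ 2)‖ =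
      Real.exp (-Real.pi * (c k).re * (m:ℝ)^2) := by
    intro k m
    rw [Complex.norm_exp]
    congr 1
    have : (-(Real.pi:ℂ) * c k * (m + b k) ^ 2 + Real.pi * c k * (b k) ^ 2)
      = ((-Real.pi * (m:ℝ)^2 : ℝ) : ℂ) * c k + ((-2 * Real.pi * (m:ℝ) : ℝ) : ℂ) * (b k * c k) := by
      push_cast; ring
    rw [this, add_re, re_ofReal_mul, re_ofReal_mul, hbc]; ring
  refine tendsto_tsum_of_dominated_convergence
    (bound := fun m : ℤ => Real.exp (-Real.pi * 1 * (m:ℝ)^2)) ?_ ?_ ?_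
  · have := (hasSum_jacobiTheta₂_term 0 (τ := Complex.I) (by simp)).summable.norm
    refine this.congr fun m => ?_
    rw [norm_jacobiTheta₂_term]; simp
  · intro m
    by_cases hm : m = 0
    · subst hm; simp
    · simp only [hm, if_false]
      rw [tendsto_zero_iff_norm_tendsto_zero]
      simp_rw [hexp]
      refine Real.tendsto_exp_atBot.comp ?_
      have hm2 : 0 < Real.pi * (m:ℝ)^2 := by positivity
      have := (hc.const_mul_atTop hm2)
      refine (tendsto_neg_atTop_atBot.comp this).congr fun k => ?_
      simp; ring
  · filter_upwards [hc.eventually_ge_atTop 1] with k hk m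
    rw [hexp]
    apply Real.exp_le_exp.2
    have : 0 ≤ Real.pi * (m:ℝ)^2 := by positivity
    nlinarith

lemma sq_half (x : ℂ) : (x ^ (1/2:ℂ))^2 = x := by
  rw [← Complex.cpow_nat_mul]; norm_num

lemma cpow_half_real_mul {α : ℂ} (x : ℝ) (hx : 0 < x) :
    ((x:ℂ) * α) ^ (1/2:ℂ) = (x:ℂ)^(1/2:ℂ) * α ^ (1/2 : ℂ) := by
  by_cases hα : α = 0
  · subst hα; simp
  have hx' : (x:ℂ) ≠ 0 := by exact_mod_cast hx.ne'
  rw [Complex.cpow_def_of_ne_zero (mul_ne_zero hx' hα), Complex.log_ofReal_mul hx hα,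
    Complex.cpow_def_of_ne_zero hα, add_mul, Complex.exp_add, Complex.cpow_def_of_ne_zero hx',
    Complex.ofReal_log hx.le]

lemma natsq_half (N : ℕ) : ((N^2 : ℝ):ℂ)^(1/2:ℂ) = N := by
  rw [show (1/2:ℂ) = ((1/2:ℝ):ℂ) by push_cast; rfl, ← Complex.ofReal_cpow (by positivity),
    ← Real.sqrt_eq_rpow, Real.sqrt_sq (by positivity)]; simp

lemma cpow_half_mul_sq {α : ℂ} (N : ℕ) (hN : N ≠ 0) :
    (α * N^2) ^ (1/2:ℂ) = α ^ (1/2 : ℂ) * N := by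
  have h : (α * N^2) = ((N^2 : ℝ):ℝ) * α := by push_cast; ring
  rw [h, cpow_half_real_mul _ (by positivity), natsq_half, mul_comm]

lemma summable_gauss {α : ℂ} (h : 0 < α.re) : Summable fun n : ℤ => cexp (-Real.pi * α * n^2) := by
  refine ((hasSum_jacobiTheta₂_term 0 (τ := Complex.I * α) (by simpa using h)).summable).congr fun n => ?_
  rw [jacobiTheta₂_term]; congr 1; ring_nf; rw [I_sq]; ring

lemma theta_asymp (N : ℕ) [NeZero N] (f : ℤ → ℂ) (hper : ∀ n m : ℤ, f (m * N + n) = f n) {α : ℕ → ℂ}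
    (hre : ∀ k, 0 < (α k).re)
    (hinv : Tendsto (fun k => ((α k)⁻¹).re) atTop atTop) :
    Tendsto (fun k => (α k)^(1/2:ℂ) * ∑' n : ℤ, f n * cexp (-Real.pi * α k * n^2)) atTop
      (𝓝 ((1/N) * ∑ r : Fin N, f (r : ℕ))) := by
  have hN : (N:ℂ) ≠ 0 := NeZero.ne _
  have hN2 : 0 < (N:ℝ)^2 := by have : N ≠ 0 := NeZero.ne _; positivity
  have hα0 : ∀ k, α k ≠ 0 := fun k h => by have := hre k; rw [h] at this; simp at this
  have hα0' : ∀ k, α k ^ (1/2:ℂ) ≠ 0 := fun k h => hα0 k (by rw [← sq_half (α k), h]; simp)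
  have key : ∀ k, (α k)^(1/2:ℂ) * ∑' n : ℤ, f n * cexp (-Real.pi * α k * n^2) =
     (1/N) * ∑ r : Fin N, f (r:ℕ) * ∑' m : ℤ, cexp (-Real.pi * (α k * N^2)⁻¹ * (m + (-I * α k * N * (r:ℕ))) ^ 2
       + Real.pi * (α k * N^2)⁻¹ * (-I * α k * N * (r:ℕ)) ^ 2) := by
    intro k
    have hs : Summable fun p : ℤ × Fin N => cexp (-Real.pi * α k * ((p.1 * N + p.2 : ℤ):ℂ)^2) := by
      refine ((summable_gauss (hre k)).comp_injective (Int.divModEquiv N).symm.injective).congr fun p => ?_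
      simp [Int.divModEquiv_symm_apply]
    have e1 : ∑' n : ℤ, f n * cexp (-Real.pi * α k * n^2) =
      ∑' p : ℤ × Fin N, f (p.2 : ℕ) * cexp (-Real.pi * α k * ((p.1 * N + p.2 : ℤ):ℂ)^2) := by
      rw [← (Int.divModEquiv N).symm.tsum_eq]
      refine tsum_congr fun p => ?_
      rw [Int.divModEquiv_symm_apply]
      have := hper (p.2:ℕ) p.1
      simp only [Int.cast_add, Int.cast_mul, Int.cast_natCast] at this ⊢
      rw [this]
    have hre' : 0 < (α k * N^2).re := by
      rw [show α k * N^2 = ((N^2 : ℝ):ℂ) * α k by push_cast; ring, re_ofReal_mul]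
      have := hre k; positivity
    have e2 : ∀ r : Fin N, ∑' m : ℤ, cexp (-Real.pi * α k * ((m * N + r : ℤ):ℂ)^2) =
        1 / (α k ^ (1/2:ℂ) * N) * ∑' m : ℤ, cexp (-Real.pi * (α k * N^2)⁻¹ * (m + (-I * α k * N * (r:ℕ))) ^ 2
       + Real.pi * (α k * N^2)⁻¹ * (-I * α k * N * (r:ℕ)) ^ 2) := by
      intro r
      have := Complex.tsum_exp_neg_quadratic hre' (-α k * N * (r:ℕ))
      rw [cpow_half_mul_sq N (NeZero.ne _)] at this
      have e3 : ∑' m : ℤ, cexp (-Real.pi * α k * ((m * N + r : ℤ):ℂ)^2) =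
        cexp (-Real.pi * α k * (r:ℕ)^2) * ∑' n : ℤ, cexp (-Real.pi * (α k * N^2) * n^2 + 2 * Real.pi * (-α k * N * (r:ℕ)) * n) := by
        rw [← tsum_mul_left]
        refine tsum_congr fun m => ?_
        rw [← Complex.exp_add]; congr 1; push_cast; ring
      rw [e3, this, mul_left_comm, ← tsum_mul_left]
      congr 1
      refine tsum_congr fun m => ?_
      rw [← Complex.exp_add]; congr 1
      have := hα0 k
      field_simp
      ring_nf; rw [I_sq]; ring
    rw [e1, Summable.tsum_prod' (f := fun p : ℤ × Fin N => f (p.2 : ℕ) * cexp (-Real.pi * α k * ((p.1 * N + p.2 : ℤ):ℂ)^2))]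
    · simp_rw [tsum_fintype]
      rw [Summable.tsum_finsetSum]
      · simp_rw [tsum_mul_left]
        rw [Finset.mul_sum, Finset.mul_sum]
        refine Finset.sum_congr rfl fun r _ => ?_
        rw [e2]
        have h9 := hα0' k
        generalize (∑' m : ℤ, cexp (-Real.pi * (α k * N^2)⁻¹ * (m + (-I * α k * N * (r:ℕ))) ^ 2
          + Real.pi * (α k * N^2)⁻¹ * (-I * α k * N * (r:ℕ)) ^ 2)) = T
        generalize α k ^ (1/2:ℂ) = A at *
        field_simp
      · intro r _
        exact (hs.comp_injective (i := fun m : ℤ => (m, r)) (fun a b h => by simpa using h)).mul_left _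
    · obtain ⟨C, hC⟩ : ∃ C, ∀ r : Fin N, ‖f (r:ℕ)‖ ≤ C := by
        obtain ⟨C, hC⟩ := (Set.finite_range fun r : Fin N => ‖f (r:ℕ)‖).bddAbove
        exact ⟨C, fun r => hC ⟨r, rfl⟩⟩
      refine Summable.of_norm_bounded (hs.norm.mul_left C) fun p => ?_
      rw [norm_mul]
      gcongr
      exact hC _
    · intro m; exact (hasSum_fintype _).summable
  simp_rw [key]
  refine Tendsto.const_mul _ (tendsto_finsetSum _ fun r _ => ?_)
  have := Tendsto.const_mul (f (r:ℕ)) (aux_tsum_gauss (c := fun k => (α k * N^2)⁻¹)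
    (b := fun k => -I * α k * N * (r:ℕ)) ?_ ?_)
  · simpa using this
  · have : ∀ k, ((α k * N^2)⁻¹).re = (N^2:ℝ)⁻¹ * ((α k)⁻¹).re := by
      intro k
      rw [← re_ofReal_mul]; congr 1; push_cast; rw [mul_inv, mul_comm]
    simp_rw [this]
    exact hinv.const_mul_atTop (by positivity)
  · intro k
    have := hα0 k
    have : -I * α k * N * (r:ℕ) * (α k * N^2)⁻¹ = ((-(r:ℕ) / N : ℝ) : ℂ) * I := by
      push_cast; field_simp
    rw [this]; simp

/-- Quadratic Gauss sum. -/
lemma quadGauss (N : ℕ) [NeZero N] :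
    ∑ r : Fin N, cexp (2 * Real.pi * I * (r:ℕ)^2 / N) =
      N * ((2 / N : ℂ)) * ((-2 * I / N) ^ (1/2:ℂ))⁻¹ * ((1 + (-I)^N) / 2) := by
  have hNN : N ≠ 0 := NeZero.ne N
  have hN : (N:ℂ) ≠ 0 := NeZero.ne _
  have hNr : (0:ℝ) < N := by positivity
  set δ : ℕ → ℝ := fun k => 1 / ((k:ℝ) + 1) with hδ
  have hδpos : ∀ k, 0 < δ k := fun k => by simp only [hδ]; positivity
  have hδ0 : Tendsto δ atTop (𝓝 0) := tendsto_one_div_add_atTop_nhds_zero_nat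
  have hδc : Tendsto (fun k => (δ k : ℂ)) atTop (𝓝 0) := by
    have := (Complex.continuous_ofReal.tendsto 0).comp hδ0
    simpa [Function.comp_def] using this
  have hδinv : Tendsto (fun k => (δ k)⁻¹) atTop atTop := by
    simp only [hδ, one_div, inv_inv]
    exact tendsto_atTop_add_const_right _ _ tendsto_natCast_atTop_atTop
  set b : ℕ → ℂ := fun k => δ k + I * N / 2 with hb
  have hbre : ∀ k, (b k).re = δ k := fun k => by simp [hb]
  have hb0 : ∀ k, b k ≠ 0 := fun k h => by
    have := hbre k; rw [h] at this; simp at this; exact (hδpos k).ne this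
  set β : ℕ → ℂ := fun k => 2 * I / N * (b k)⁻¹ with hβ
  set α : ℕ → ℂ := fun k => δ k * β k with hα
  have hδne : ∀ k, (δ k : ℂ) ≠ 0 := fun k => by exact_mod_cast (hδpos k).ne'
  have hα0 : ∀ k, α k ≠ 0 := fun k => by
    simp only [hα, hβ]
    exact mul_ne_zero (hδne k) (mul_ne_zero (div_ne_zero (by simp) hN) (inv_ne_zero (hb0 k)))
  have hab : ∀ k, (b k)⁻¹ = α k - 2 * I / N := fun k => by
    have h1 := hb0 k
    simp only [hα, hβ]
    have h2 : (δ k : ℂ) = b k - I * N / 2 := by simp only [hb]; ring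
    rw [h2]; field_simp; ring_nf; rw [I_sq]; ring
  have hαinv : ∀ k, ((α k)⁻¹).re = N^2/4 * (δ k)⁻¹ := fun k => by
    have h3 := hδne k
    have h1 := hb0 k
    have : (α k)⁻¹ = ((N^2/4 * (δ k)⁻¹ : ℝ):ℂ) + ((-N/2 : ℝ):ℂ) * I := by
      simp only [hα, hβ, mul_inv, inv_inv, hb]
      push_cast
      field_simp; ring_nf; simp only [I_sq]; ring
    rw [this, add_re, re_ofReal_mul, I_re, mul_zero, add_zero, ofReal_re]
  have hαinv' : Tendsto (fun k => ((α k)⁻¹).re) atTop atTop := by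
    simp_rw [hαinv]
    exact hδinv.const_mul_atTop (by positivity)
  have hαre : ∀ k, 0 < (α k).re := fun k => by
    have h : 0 < ((α k)⁻¹).re := by rw [hαinv]; have := hδpos k; positivity
    rw [Complex.inv_re] at h
    by_contra h'
    exact absurd h (not_lt.2 (div_nonpos_of_nonpos_of_nonneg (not_lt.1 h') (Complex.normSq_nonneg _)))
  have hare : ∀ k, 0 < ((b k)⁻¹).re := fun k => by
    rw [Complex.inv_re, hbre]
    exact div_pos (hδpos k) (Complex.normSq_pos.2 (hb0 k))
  have L1 := theta_asymp N (fun n => cexp (2 * Real.pi * I * n^2 / N)) (by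
    intro n m
    rw [Complex.exp_eq_exp_iff_exists_int]
    refine ⟨m^2 * N + 2 * m * n, ?_⟩
    push_cast; field_simp; ring) hαre hαinv'
  have L2 := theta_asymp 2 (fun n => cexp (- (Real.pi * I * N * n^2 / 2))) (by
    intro n m
    rw [Complex.exp_eq_exp_iff_exists_int]
    refine ⟨-(m^2 * N + m * n * N), ?_⟩
    push_cast; field_simp; ring) (α := fun k => (δ k : ℂ)) (fun k => by simpa using hδpos k)
      (by simpa [← ofReal_inv] using hδinv)
  have hbl : Tendsto (fun k => (b k)⁻¹) atTop (𝓝 (-2 * I / N)) := by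
    have : Tendsto b atTop (𝓝 (I * N / 2)) := by simpa using hδc.add_const (I * N / 2)
    have h := this.inv₀ (by simp [hN])
    convert h using 2
    field_simp; rw [I_sq]; norm_num
  have hne : ((-2 * I / N) ^ (1/2:ℂ)) ≠ 0 := fun h => by
    have := sq_half (-2 * I / N); rw [h] at this
    exact (div_ne_zero (by simp) hN : (-2 * I / N : ℂ) ≠ 0) (by rw [← this]; simp)
  have hsl : Tendsto (fun k => ((b k)⁻¹) ^ (1/2:ℂ)) atTop (𝓝 ((-2 * I / N) ^ (1/2:ℂ))) := by
    refine hbl.cpow tendsto_const_nhds ?_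
    right
    have : (-2 * I / N : ℂ) = ((-2 / N : ℝ):ℂ) * I := by push_cast; ring
    rw [this]; simp [hNN]
  have hβl : Tendsto (fun k => (β k) ^ (1/2:ℂ)) atTop (𝓝 (2 / N)) := by
    have h1 : Tendsto β atTop (𝓝 (((2/N)^2 : ℝ):ℂ)) := by
      convert hbl.const_mul (2 * I / N) using 2
      push_cast; field_simp; ring_nf; rw [I_sq]; ring
    have h2 := h1.cpow (tendsto_const_nhds (x := (1/2:ℂ))) (by left; rw [ofReal_re]; positivity)
    convert h2 using 2
    rw [show (1/2:ℂ) = ((1/2:ℝ):ℂ) by push_cast; rfl, ← Complex.ofReal_cpow (by positivity),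
      ← Real.sqrt_eq_rpow, Real.sqrt_sq (by positivity)]; simp
  have key : ∀ k, (α k)^(1/2:ℂ) * ∑' n : ℤ, cexp (2 * Real.pi * I * n^2 / N) * cexp (-Real.pi * α k * n^2)
      = (β k) ^ (1/2:ℂ) * (((b k)⁻¹) ^ (1/2:ℂ))⁻¹ * ((δ k : ℂ) ^ (1/2:ℂ) * ∑' n : ℤ, 
        cexp (- (Real.pi * I * N * n^2 / 2)) * cexp (-Real.pi * δ k * n^2)) := by
    intro k
    have h := Complex.tsum_exp_neg_mul_int_sq (hare k)
    have e1 : ∑' n : ℤ, cexp (2 * Real.pi * I * n^2 / N) * cexp (-Real.pi * α k * n^2)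
      = ∑' n : ℤ, cexp (-Real.pi * (b k)⁻¹ * n^2) := by
      refine tsum_congr fun n => ?_
      rw [← Complex.exp_add, hab]; congr 1; ring
    have e2 : ∑' n : ℤ, cexp (- (Real.pi * I * N * n^2 / 2)) * cexp (-Real.pi * δ k * n^2)
      = ∑' n : ℤ, cexp (-Real.pi / (b k)⁻¹ * n^2) := by
      refine tsum_congr fun n => ?_
      rw [← Complex.exp_add, div_inv_eq_mul]; congr 1; simp only [hb]; ring
    rw [e1, e2, h, hα, cpow_half_real_mul _ (hδpos k)]
    ring
  have L3 := (hβl.mul (hsl.inv₀ hne)).mul L2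
  have := tendsto_nhds_unique (L1.congr key) L3
  rw [Fin.sum_univ_two] at this
  have e : cexp (-(Real.pi * I * N / 2)) = (-I)^N := by
    rw [show -(Real.pi * I * N / 2) = (N:ℂ) * (-(Real.pi / 2 * I)) by ring, Complex.exp_nat_mul,
      Complex.exp_neg, Complex.exp_pi_div_two_mul_I, Complex.inv_I]
  simp only [Int.cast_natCast, Fin.val_zero, Fin.val_one, Nat.cast_zero, Nat.cast_one, Nat.cast_ofNat] at this
  norm_num at this
  rw [e] at this
  have h4 : ∑ r : Fin N, cexp (2 * Real.pi * I * (r:ℕ)^2 / N) = N * ((N:ℂ)⁻¹ * ∑ r : Fin N, cexp (2 * Real.pi * I * (r:ℕ)^2 / N)) := by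
    field_simp
  rw [h4, this]
  norm_num
  ring

end GaussSums

section Chars
open Complex

lemma quadGauss_odd (N : ℕ) [NeZero N] (hN : Odd N) :
    ∑ r : Fin N, cexp (2 * Real.pi * I * (r:ℕ)^2 / N) = (Real.sqrt N : ℂ) * (if N % 4 = 1 then 1 else I) := by
  have hNp : 0 < N := Nat.pos_of_ne_zero (NeZero.ne N)
  have hs : (Real.sqrt N : ℂ)^2 = N := by
    rw [← ofReal_pow, Real.sq_sqrt (by positivity)]; simp
  have hs0 : (Real.sqrt N : ℂ) ≠ 0 := by
    have : Real.sqrt N ≠ 0 := by positivity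
    exact_mod_cast this
  rw [quadGauss]
  have h : (-2 * I / N : ℂ) ^ (1/2:ℂ) = (1 - I) * ((Real.sqrt N)⁻¹ : ℝ) := by
    have h1 : (-2 * I / N : ℂ) = ((1 - I) * ((Real.sqrt N)⁻¹ : ℝ))^2 := by
      rw [mul_pow, ← ofReal_pow, inv_pow, Real.sq_sqrt (by positivity)]
      push_cast; ring_nf; rw [I_sq]; ring
    rw [h1, one_div, Complex.sq_cpow_two_inv]
    rw [mul_comm, re_ofReal_mul]; simp; exact hNp
  rw [h]
  have h1I : (1 - I) ≠ 0 := fun h => by have := congrArg re h; simp at this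
  have hNc : (N:ℂ) ≠ 0 := NeZero.ne _
  have h4 : N % 4 = 1 ∨ N % 4 = 3 := by rcases hN with ⟨k, rfl⟩; omega
  have hpow : (-I)^N = (-I)^(N % 4) := by
    conv_lhs => rw [← Nat.div_add_mod N 4]
    rw [pow_add, pow_mul]; simp [Even.neg_pow (show Even 4 by decide)]
  rw [hpow, mul_inv]
  push_cast
  rw [inv_inv]
  rcases h4 with h4 | h4
  · rw [h4]; simp; field_simp; ring
  · rw [h4]; simp; field_simp; simp [pow_succ]; ring_nf; simp; ring

lemma gaussSum_mul_coprime {m n : ℕ} [NeZero m] [NeZero n] [NeZero (m * n)] (h : m.Coprime n)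
    (χ : DirichletCharacter ℂ (m * n)) (χ₁ : DirichletCharacter ℂ m) (χ₂ : DirichletCharacter ℂ n)
    (hχ : ∀ k : ℕ, χ k = χ₁ k * χ₂ k) :
    gaussSum χ ZMod.stdAddChar = χ₁ n * χ₂ m * gaussSum χ₁ ZMod.stdAddChar * gaussSum χ₂ ZMod.stdAddChar := by
  let φ : ZMod m × ZMod n → ZMod (m * n) := fun p => ((n * p.1.val + m * p.2.val : ℕ) : ZMod (m * n))
  have hinj : Function.Injective φ := by
    rintro ⟨a, b⟩ ⟨a', b'⟩ hab
    simp only [φ] at hab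
    rw [ZMod.natCast_eq_natCast_iff] at hab
    have h1 := hab.of_dvd (Dvd.intro _ rfl : m ∣ m * n)
    have h2 := hab.of_dvd (Dvd.intro_left _ rfl : n ∣ m * n)
    rw [← ZMod.natCast_eq_natCast_iff] at h1 h2
    push_cast at h1 h2
    have hu : IsUnit (n : ZMod m) := (ZMod.isUnit_iff_coprime n m).2 h.symm
    have hu2 : IsUnit (m : ZMod n) := (ZMod.isUnit_iff_coprime m n).2 h
    simp at h1 h2
    refine Prod.ext ?_ ?_
    · exact  (hu.mul_left_cancel h1)
    · exact (hu2.mul_left_cancel h2)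
  have hbij : Function.Bijective φ := by
    rw [Fintype.bijective_iff_injective_and_card]
    exact ⟨hinj, by simp [ZMod.card]⟩
  rw [gaussSum, ← Function.Bijective.sum_comp hbij, Fintype.sum_prod_type, gaussSum, gaussSum,
    mul_assoc, Finset.sum_mul_sum, Finset.mul_sum]
  refine Finset.sum_congr rfl fun a _ => ?_
  rw [Finset.mul_sum]
  refine Finset.sum_congr rfl fun b _ => ?_
  have e1 : χ (φ (a, b)) = χ₁ n * χ₂ m * (χ₁ a * χ₂ b) := by
    simp only [φ]
    rw [hχ]; push_cast
    simp [map_mul]; ring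
  have e2 : ZMod.stdAddChar (φ (a, b)) = ZMod.stdAddChar a * ZMod.stdAddChar b := by
    have ha : a = ((a.val : ℤ) : ZMod m) := by simp
    have hb : b = ((b.val : ℤ) : ZMod n) := by simp
    conv_rhs => rw [ha, hb]
    simp only [φ]
    rw [← Int.cast_natCast, ZMod.stdAddChar_coe, ZMod.stdAddChar_coe, ZMod.stdAddChar_coe, ← Complex.exp_add]
    congr 1
    have : (m:ℂ) ≠ 0 := NeZero.ne _
    have : (n:ℂ) ≠ 0 := NeZero.ne _
    push_cast; field_simp
  rw [e1, e2]; ring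

/-- Jacobi symbol character `(·/n)`. -/
def jac (n : ℕ) [NeZero n] : DirichletCharacter ℂ n where
  toFun x := ((jacobiSym (x.val : ℤ) n : ℤ) : ℂ)
  map_one' := by
    have : jacobiSym ((1 : ZMod n).val : ℤ) n = 1 := by
      rw [← jacobiSym.one_left n]
      exact jacobiSym.mod_left' (by rw [ZMod.val_one_eq_one_mod]; simp)
    rw [this]; simp
  map_mul' x y := by
    have : jacobiSym ((x * y).val : ℤ) n = jacobiSym (x.val : ℤ) n * jacobiSym (y.val : ℤ) n := by
      rw [← jacobiSym.mul_left]
      exact jacobiSym.mod_left' (by rw [ZMod.val_mul]; simp)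
    rw [this]; push_cast; rfl
  map_nonunit' x hx := by
    have : jacobiSym (x.val : ℤ) n = 0 := by
      rw [jacobiSym.eq_zero_iff_not_coprime]
      intro h
      apply hx
      rw [← ZMod.natCast_zmod_val x, ZMod.isUnit_iff_coprime]
      simpa [Nat.Coprime, -ZMod.natCast_val] using h
    rw [this]; simp

lemma jac_natCast (n : ℕ) [NeZero n] (k : ℕ) : jac n k = ((jacobiSym k n : ℤ) : ℂ) := by
  change ((jacobiSym ((k : ZMod n).val : ℤ) n : ℤ) : ℂ) = _
  congr 1
  exact jacobiSym.mod_left' (by simp)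

lemma jac_sq_real (n : ℕ) [NeZero n] : (jac n)⁻¹ = jac n := by
  apply MulChar.IsQuadratic.inv
  intro a
  rcases jacobiSym.trichotomy (a.val : ℤ) n with h | h | h
  · left; change ((jacobiSym (a.val : ℤ) n : ℤ) : ℂ) = _; rw [h]; simp
  · right; left; change ((jacobiSym (a.val : ℤ) n : ℤ) : ℂ) = _; rw [h]; simp
  · right; right; change ((jacobiSym (a.val : ℤ) n : ℤ) : ℂ) = _; rw [h]; simp

lemma gauss_jac_prime (p : ℕ) [Fact p.Prime] (hp : Odd p) :
    gaussSum (jac p) ZMod.stdAddChar = (Real.sqrt p : ℂ) * (if p % 4 = 1 then 1 else I) := by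
  classical
  rw [← quadGauss_odd p hp]
  have hchar : ringChar (ZMod p) ≠ 2 := by
    rw [ZMod.ringChar_zmod_n]; rintro rfl; revert hp; decide
  have hq : ∀ a : ZMod p, jac p a = ((quadraticChar (ZMod p) a : ℤ) : ℂ) := by
    intro a
    change ((jacobiSym (a.val : ℤ) p : ℤ) : ℂ) = _
    rw [← jacobiSym.legendreSym.to_jacobiSym, legendreSym]; simp
  have e1 : ∑ r : Fin p, cexp (2 * Real.pi * I * (r:ℕ)^2 / p) = ∑ x : ZMod p, ZMod.stdAddChar (x^2) := by
    have hb : Function.Bijective (fun r : Fin p => ((r:ℕ) : ZMod p)) := by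
      rw [Fintype.bijective_iff_injective_and_card]
      refine ⟨fun a b h => ?_, by simp⟩
      simp only at h
      rw [ZMod.natCast_eq_natCast_iff, Nat.ModEq, Nat.mod_eq_of_lt a.2, Nat.mod_eq_of_lt b.2] at h
      exact Fin.ext h
    rw [← Function.Bijective.sum_comp hb]
    refine Finset.sum_congr rfl fun r _ => ?_
    have : (((r:ℕ) : ZMod p))^2 = (((r:ℕ)^2 : ℤ) : ZMod p) := by push_cast; rfl
    rw [this, ZMod.stdAddChar_coe]; push_cast; rfl
  rw [e1]
  have e2 : ∑ x : ZMod p, ZMod.stdAddChar (x^2) = ∑ a : ZMod p, ∑ x ∈ Finset.univ.filter (fun x : ZMod p => x^2 = a), ZMod.stdAddChar (N := p) a := by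
    rw [← Finset.sum_fiberwise Finset.univ (fun x : ZMod p => x^2)]
    refine Finset.sum_congr rfl fun a _ => Finset.sum_congr rfl fun x hx => ?_
    rw [(Finset.mem_filter.1 hx).2]
  rw [e2]
  have hcard : ∀ a : ZMod p, ((Finset.univ.filter (fun x : ZMod p => x^2 = a)).card : ℂ) = ((quadraticChar (ZMod p) a : ℤ) : ℂ) + 1 := by
    intro a
    have := quadraticChar_card_sqrts hchar a
    rw [← Int.cast_one, ← Int.cast_add, ← this]
    simp
  simp_rw [Finset.sum_const, nsmul_eq_mul, hcard, add_mul, one_mul, Finset.sum_add_distrib]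
  have h0 : ∑ a : ZMod p, ZMod.stdAddChar (N := p) a = 0 := by
    apply AddChar.sum_eq_zero_of_ne_one
    intro h
    have h1 := (ZMod.isPrimitive_stdAddChar p) one_ne_zero
    apply h1
    rw [h]; ext; simp
  rw [h0, add_zero, gaussSum]
  exact Finset.sum_congr rfl fun a _ => by rw [hq]

end Chars

section RootNumbers
open Complex

lemma jac_coprime_mul {a b : ℕ} [NeZero a] [NeZero b] (h : a.Coprime b) (ha : Odd a) (hb : Odd b) :
    jac a b * jac b a = if a % 4 = 3 ∧ b % 4 = 3 then -1 else 1 := by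
  rw [jac_natCast, jac_natCast, ← jacobiSym.quadratic_reciprocity_if (Nat.odd_iff.1 ha) (Nat.odd_iff.1 hb)]
  have h2 : jacobiSym b a ^ 2 = 1 := jacobiSym.sq_one (by simpa using h.symm)
  have h3 : ((jacobiSym b a : ℤ):ℂ)^2 = 1 := by exact_mod_cast h2
  split_ifs
  · push_cast; linear_combination -h3
  · linear_combination h3

lemma jac_mul (a b : ℕ) [NeZero a] [NeZero b] [NeZero (a * b)] (k : ℕ) :
    jac (a * b) k = jac a k * jac b k := by
  simp only [jac_natCast]
  rw [jacobiSym.mul_right]; push_cast; rfl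

lemma gauss_jac (n : ℕ) (hn : Odd n) (hs : Squarefree n) [NeZero n] :
    gaussSum (jac n) ZMod.stdAddChar = (Real.sqrt n : ℂ) * (if n % 4 = 1 then 1 else I) := by
  revert hn hs
  rename_i inst
  revert inst
  refine induction_on_primes (motive := fun n => ∀ [NeZero n], Odd n → Squarefree n → 
    gaussSum (jac n) ZMod.stdAddChar = (Real.sqrt n : ℂ) * (if n % 4 = 1 then 1 else I)) ?_ ?_ ?_ n
  · intro inst; exact absurd rfl inst.out
  · intro _ _ _
    rw [gaussSum, Fintype.sum_eq_single (0 : ZMod 1) (fun x hx => absurd (Subsingleton.elim x 0) hx)]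
    have : (0 : ZMod 1) = ((0:ℕ) : ZMod 1) := rfl
    rw [this, jac_natCast]; simp
  · intro p a hp ih inst hodd hsq
    haveI : Fact p.Prime := ⟨hp⟩
    haveI : NeZero a := ⟨fun h => inst.out (by simp [h])⟩
    rw [Nat.odd_mul] at hodd
    have hcop : p.Coprime a := Nat.coprime_of_squarefree_mul hsq
    rw [gaussSum_mul_coprime hcop (jac (p * a)) (jac p) (jac a) (jac_mul p a),
      jac_coprime_mul hcop hodd.1 hodd.2, gauss_jac_prime p hodd.1, ih hodd.2 (hsq.of_mul_right)]
    have hsqrt : (Real.sqrt ((p * a : ℕ):ℝ) : ℂ) = Real.sqrt p * Real.sqrt a := by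
      rw [Nat.cast_mul, Real.sqrt_mul (by positivity)]; push_cast; rfl
    rw [hsqrt]
    have h1 : p % 4 = 1 ∨ p % 4 = 3 := by rcases hodd.1 with ⟨k, rfl⟩; omega
    have h2 : a % 4 = 1 ∨ a % 4 = 3 := by rcases hodd.2 with ⟨k, rfl⟩; omega
    rw [Nat.mul_mod]
    rcases h1 with h1 | h1 <;> rcases h2 with h2 | h2 <;> simp [h1, h2] <;> ring_nf
    rw [I_sq]; ring

lemma prim_of {N : ℕ} [NeZero N] (χ : DirichletCharacter ℂ N)
    (h : ∀ p : ℕ, p.Prime → p ∣ N → ∃ x : ℕ, x.Coprime N ∧ x ≡ 1 [MOD N / p] ∧ χ x ≠ 1) :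
    χ.IsPrimitive := by
  rw [DirichletCharacter.isPrimitive_def]
  by_contra hne
  have hdvd := χ.conductor_dvd_level
  obtain ⟨c, hc⟩ := hdvd
  have hc1 : c ≠ 1 := fun h => hne (by rw [h, mul_one] at hc; exact hc.symm)
  obtain ⟨p, hp, hpc⟩ := Nat.exists_prime_and_dvd hc1
  obtain ⟨x, hx, hx1, hx2⟩ := h p hp (hc ▸ hpc.mul_left _)
  have hft := χ.factorsThrough_conductor
  have hdvd := χ.conductor_dvd_level
  rw [DirichletCharacter.factorsThrough_iff_ker_unitsMap hdvd] at hft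
  have hmem : ZMod.unitOfCoprime x hx ∈ (ZMod.unitsMap hdvd).ker := by
    rw [MonoidHom.mem_ker]
    ext
    rw [ZMod.unitsMap_def]
    simp only [Units.coe_map, ZMod.coe_unitOfCoprime, Units.val_one]
    have h3 : χ.conductor ∣ N / p := by
      obtain ⟨e, rfl⟩ := hpc
      refine ⟨e, ?_⟩
      apply Nat.div_eq_of_eq_mul_right hp.pos
      exact hc.trans (by ring)
    have := (ZMod.natCast_eq_natCast_iff x 1 _).2 (hx1.of_dvd h3)
    simpa using this
  have := hft hmem
  rw [MonoidHom.mem_ker] at this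
  apply hx2
  have h5 := congrArg Units.val this
  simpa using h5

lemma exists_nonres (p : ℕ) (hp : p.Prime) (h2 : Odd p) (M : ℕ) (hM : p.Coprime M) :
    ∃ x : ℕ, x ≡ 1 [MOD M] ∧ jacobiSym x p = -1 ∧ x.Coprime p := by
  haveI : Fact p.Prime := ⟨hp⟩
  obtain ⟨a, ha⟩ := quadraticChar_exists_neg_one (F := ZMod p) (by
    rw [ZMod.ringChar_zmod_n]; rintro rfl; revert h2; decide)
  obtain ⟨x, hx1, hx2⟩ := Nat.chineseRemainder hM a.val 1
  have hj : jacobiSym x p = -1 := by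
    rw [← ha, ← jacobiSym.legendreSym.to_jacobiSym, legendreSym]
    congr 1
    have := (ZMod.natCast_eq_natCast_iff _ _ _).2 hx1
    simpa using this
  refine ⟨x, hx2, hj, ?_⟩
  by_contra hc
  have := (jacobiSym.eq_zero_iff_not_coprime (a := (x:ℤ)) (b := p)).2 (by simpa using hc)
  omega

lemma jac_isPrimitive (n : ℕ) [NeZero n] (hn : Odd n) (hs : Squarefree n) : (jac n).IsPrimitive := by
  apply prim_of
  intro p hp hpn
  obtain ⟨m, rfl⟩ := hpn
  have hcop : p.Coprime m := Nat.coprime_of_squarefree_mul hs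
  rw [Nat.odd_mul] at hn
  haveI : NeZero m := ⟨by rintro rfl; simpa using hn.2⟩
  haveI : NeZero p := ⟨hp.ne_zero⟩
  obtain ⟨x, h1, h2, h3⟩ := exists_nonres p hp hn.1 m hcop
  have hxm : x.Coprime m := by
    rw [Nat.Coprime, h1.gcd_eq]; simp
  refine ⟨x, Nat.Coprime.mul_right h3 hxm, by rwa [Nat.mul_div_cancel_left _ hp.pos], ?_⟩
  rw [jac_mul, jac_natCast, jac_natCast, h2]
  have : jacobiSym x m = 1 := by
    rw [← jacobiSym.one_left m]
    exact jacobiSym.mod_left' (by exact_mod_cast h1)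
  rw [this]; norm_num

lemma neg_one_cast (n : ℕ) (hn : n ≠ 0) : (-1 : ZMod n) = ((n - 1 : ℕ) : ZMod n) := by
  rw [Nat.cast_sub (Nat.one_le_iff_ne_zero.2 hn)]; simp

lemma jac_neg_one (n : ℕ) [NeZero n] (hn : Odd n) : jac n (-1) = if n % 4 = 1 then 1 else -1 := by
  have h : jac n (-1) = ((jacobiSym (-1) n : ℤ):ℂ) := by
    rw [neg_one_cast n (NeZero.ne n), jac_natCast]
    congr 1
    apply jacobiSym.mod_left'
    rw [Nat.cast_sub (Nat.one_le_iff_ne_zero.2 (NeZero.ne n))]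
    exact Int.emod_emod_of_dvd _ (dvd_refl _) ▸ by simp [Int.sub_emod]
  rw [h, jacobiSym.at_neg_one hn]
  have h1 : n % 4 = 1 ∨ n % 4 = 3 := by rcases hn with ⟨k, rfl⟩; omega
  rcases h1 with h1 | h1
  · rw [ZMod.χ₄_nat_one_mod_four h1]; simp [h1]
  · rw [ZMod.χ₄_nat_three_mod_four h1]; simp [h1]

lemma sqrt_cpow (n : ℕ) : (n:ℂ)^(1/2:ℂ) = Real.sqrt n := by
  rw [show (1/2:ℂ) = ((1/2:ℝ):ℂ) by push_cast; rfl, ← ofReal_natCast, ← Complex.ofReal_cpow (by positivity),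
    ← Real.sqrt_eq_rpow]

lemma jac_even (n : ℕ) [NeZero n] (hn : n % 4 = 1) : (jac n).Even := by
  rw [DirichletCharacter.Even, jac_neg_one n (Nat.odd_iff.2 (by omega))]; simp [hn]
lemma jac_odd (n : ℕ) [NeZero n] (hn : n % 4 = 3) : (jac n).Odd := by
  rw [DirichletCharacter.Odd, jac_neg_one n (Nat.odd_iff.2 (by omega))]; simp [hn]

lemma rootNumber_jac (n : ℕ) [NeZero n] (hn : Odd n) (hs : Squarefree n) :
    DirichletCharacter.rootNumber (jac n) = 1 := by
  have h1 : n % 4 = 1 ∨ n % 4 = 3 := by rcases hn with ⟨k, rfl⟩; omega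
  have h0 : (Real.sqrt n : ℂ) ≠ 0 := by
    have : n ≠ 0 := NeZero.ne n
    have : Real.sqrt n ≠ 0 := by positivity
    exact_mod_cast this
  rw [DirichletCharacter.rootNumber, gauss_jac n hn hs, sqrt_cpow]
  rcases h1 with h1 | h1
  · simp [h1, jac_even n h1, h0]
  · have : ¬ (jac n).Even := (jac_odd n h1).not_even
    simp [h1, this, h0]

end RootNumbers

section Chi8
open Complex

def c8 : DirichletCharacter ℂ 8 := ZMod.χ₈.ringHomComp (Int.castRingHom ℂ)
def c8' : DirichletCharacter ℂ 8 := ZMod.χ₈'.ringHomComp (Int.castRingHom ℂ)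

lemma c8_apply (x : ZMod 8) : c8 x = ((ZMod.χ₈ x : ℤ):ℂ) := rfl
lemma c8'_apply (x : ZMod 8) : c8' x = ((ZMod.χ₈' x : ℤ):ℂ) := rfl

lemma omega8 : cexp (2 * Real.pi * I / 8) = (Real.sqrt 2 / 2) * (1 + I) := by
  rw [show 2 * Real.pi * I / 8 = ((Real.pi / 4 : ℝ):ℂ) * I by push_cast; ring, Complex.exp_mul_I,
    ← ofReal_cos, ← ofReal_sin, Real.cos_pi_div_four, Real.sin_pi_div_four]
  push_cast; ring

lemma std8 (k : ℕ) : ZMod.stdAddChar (k : ZMod 8) = (cexp (2 * Real.pi * I / 8))^k := by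
  rw [← Int.cast_natCast, ZMod.stdAddChar_coe, ← Complex.exp_nat_mul]
  congr 1; push_cast; ring

lemma sum8 (f : ZMod 8 → ℂ) : ∑ x, f x = f (0:ℕ) + f (1:ℕ) + f (2:ℕ) + f (3:ℕ) + f (4:ℕ) + f (5:ℕ) + f (6:ℕ) + f (7:ℕ) := by
  have := Fin.sum_univ_eight (M := ℂ) f
  exact this

lemma sq2 : (Real.sqrt 2 : ℂ)^2 = 2 := by
  rw [← ofReal_pow, Real.sq_sqrt (by positivity)]; simp

lemma sqrt8 : (Real.sqrt 8 : ℂ) = 2 * Real.sqrt 2 := by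
  rw [show (8:ℝ) = 2^2 * 2 by norm_num, Real.sqrt_mul (by positivity), Real.sqrt_sq (by positivity)]
  push_cast; rfl

lemma om2 : ((Real.sqrt 2 / 2 : ℂ) * (1 + I))^2 = I := by
  ring_nf; rw [sq2, I_sq]; ring

lemma gauss_c8 : gaussSum c8 ZMod.stdAddChar = Real.sqrt 8 := by
  rw [gaussSum, sum8, sqrt8]
  simp only [c8_apply, std8]
  have e0 : ZMod.χ₈ ((0:ℕ) : ZMod 8) = 0 := by decide
  have e1 : ZMod.χ₈ ((1:ℕ) : ZMod 8) = 1 := by decide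
  have e2 : ZMod.χ₈ ((2:ℕ) : ZMod 8) = 0 := by decide
  have e3 : ZMod.χ₈ ((3:ℕ) : ZMod 8) = -1 := by decide
  have e4 : ZMod.χ₈ ((4:ℕ) : ZMod 8) = 0 := by decide
  have e5 : ZMod.χ₈ ((5:ℕ) : ZMod 8) = -1 := by decide
  have e6 : ZMod.χ₈ ((6:ℕ) : ZMod 8) = 0 := by decide
  have e7 : ZMod.χ₈ ((7:ℕ) : ZMod 8) = 1 := by decide
  rw [e0, e1, e2, e3, e4, e5, e6, e7, omega8]
  have h := om2
  set w := (Real.sqrt 2 / 2 : ℂ) * (1 + I) with hw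
  have h3 : w^3 = I * w := by rw [pow_succ, h]
  have h5 : w^5 = - w := by rw [show w^5 = (w^2)^2 * w by ring, h, I_sq]; ring
  have h7 : w^7 = - I * w := by rw [show w^7 = (w^2)^3 * w by ring, h, show I^3 = I^2 * I by ring, I_sq]; ring
  rw [h3, h5, h7]; push_cast
  rw [hw]; ring_nf; rw [I_sq]; ring

lemma gauss_c8' : gaussSum c8' ZMod.stdAddChar = I * Real.sqrt 8 := by
  rw [gaussSum, sum8, sqrt8]
  simp only [c8'_apply, std8]
  have e0 : ZMod.χ₈' ((0:ℕ) : ZMod 8) = 0 := by decide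
  have e1 : ZMod.χ₈' ((1:ℕ) : ZMod 8) = 1 := by decide
  have e2 : ZMod.χ₈' ((2:ℕ) : ZMod 8) = 0 := by decide
  have e3 : ZMod.χ₈' ((3:ℕ) : ZMod 8) = 1 := by decide
  have e4 : ZMod.χ₈' ((4:ℕ) : ZMod 8) = 0 := by decide
  have e5 : ZMod.χ₈' ((5:ℕ) : ZMod 8) = -1 := by decide
  have e6 : ZMod.χ₈' ((6:ℕ) : ZMod 8) = 0 := by decide
  have e7 : ZMod.χ₈' ((7:ℕ) : ZMod 8) = -1 := by decide
  rw [e0, e1, e2, e3, e4, e5, e6, e7, omega8]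
  have h := om2
  set w := (Real.sqrt 2 / 2 : ℂ) * (1 + I) with hw
  have h3 : w^3 = I * w := by rw [pow_succ, h]
  have h5 : w^5 = - w := by rw [show w^5 = (w^2)^2 * w by ring, h, I_sq]; ring
  have h7 : w^7 = - I * w := by rw [show w^7 = (w^2)^3 * w by ring, h, show I^3 = I^2 * I by ring, I_sq]; ring
  rw [h3, h5, h7]; push_cast
  rw [hw]; ring_nf; rw [I_sq]; ring

/-- defining property of `χ_{8d}` -/
def IsChi8 (d : ℕ) (χ : DirichletCharacter ℂ (8 * d)) : Prop :=
  (∀ n : ℕ, Odd n → χ (n : ZMod (8 * d)) = ((jacobiSym (8 * d) n : ℤ) : ℂ)) ∧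
      (∀ n : ℕ, Even n → χ (n : ZMod (8 * d)) = 0)

lemma jacobi8 (d n : ℕ) (hn : Odd n) : jacobiSym (8 * d) n = jacobiSym (2 * d) n := by
  rw [show (8 * d : ℤ) = 4 * (2 * d) by ring, jacobiSym.mul_left, jacobiSym.at_four hn, one_mul]

lemma chi8_factor {d : ℕ} (hd : Odd d) [NeZero d] {χ : DirichletCharacter ℂ (8 * d)} (h : IsChi8 d χ) (k : ℕ) :
    χ k = (if d % 4 = 1 then c8 else c8') k * jac d k := by
  have hd4 : d % 4 = 1 ∨ d % 4 = 3 := by rcases hd with ⟨k, rfl⟩; omega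
  rcases Nat.even_or_odd k with hk | hk
  · rw [h.2 k hk]
    have hu : ¬ IsUnit ((k : ℕ) : ZMod 8) := by
      rw [ZMod.isUnit_iff_coprime]
      intro h8
      have : k.Coprime 2 := Nat.Coprime.coprime_dvd_right (by norm_num) h8
      rw [Nat.coprime_two_right] at this
      exact (Nat.not_even_iff_odd.2 this) hk
    rw [MulChar.map_nonunit _ hu, zero_mul]
  · rw [h.1 k hk, jacobi8 _ _ hk, jacobiSym.mul_left, jacobiSym.at_two hk, jac_natCast]
    rcases hd4 with h4 | h4
    · rw [jacobiSym.quadratic_reciprocity_one_mod_four h4 hk]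
      simp [h4, c8_apply]
    · have hk4 : k % 4 = 1 ∨ k % 4 = 3 := by rcases hk with ⟨k, rfl⟩; omega
      have e : c8' k = ((ZMod.χ₄ k : ℤ):ℂ) * ((ZMod.χ₈ k : ℤ):ℂ) := by
        rw [c8'_apply]
        have := ZMod.χ₈'_int_eq_χ₄_mul_χ₈ k
        push_cast at this
        rw [this]; push_cast; rfl
      simp only [h4, show ¬ (3 = 1) by norm_num, if_false]
      rw [e]
      rcases hk4 with hk4 | hk4
      · rw [jacobiSym.quadratic_reciprocity_one_mod_four' hd hk4, ZMod.χ₄_nat_one_mod_four hk4]; simp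
      · rw [jacobiSym.quadratic_reciprocity_three_mod_four h4 hk4, ZMod.χ₄_nat_three_mod_four hk4]; simp

lemma c8_neg_one : c8 (-1) = 1 := by
  rw [c8_apply, show ZMod.χ₈ (-1) = 1 by decide]; simp
lemma c8'_neg_one : c8' (-1) = -1 := by
  rw [c8'_apply, show ZMod.χ₈' (-1) = -1 by decide]; simp

lemma chi8_even {d : ℕ} (hd : Odd d) {χ : DirichletCharacter ℂ (8 * d)} (h : IsChi8 d χ) : χ.Even := by
  have hd0 : d ≠ 0 := by rintro rfl; simp at hd
  haveI : NeZero d := ⟨hd0⟩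
  have hd4 : d % 4 = 1 ∨ d % 4 = 3 := by rcases hd with ⟨k, rfl⟩; omega
  rw [DirichletCharacter.Even, neg_one_cast _ (by positivity), chi8_factor hd h]
  have e1 : ((8 * d - 1 : ℕ) : ZMod d) = -1 := by
    rw [Nat.cast_sub (by omega)]; simp
  have e2 : ((8 * d - 1 : ℕ) : ZMod 8) = -1 := by
    rw [Nat.cast_sub (by omega)]; push_cast; rw [show (8 : ZMod 8) = 0 from rfl]; simp
  rw [e1, e2, jac_neg_one d hd]
  rcases hd4 with h4 | h4 <;> simp [h4, c8_neg_one, c8'_neg_one]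

lemma gauss_chi8 {d : ℕ} (hd : Odd d) (hs : Squarefree d) [NeZero (8 * d)] {χ : DirichletCharacter ℂ (8 * d)} (h : IsChi8 d χ) :
    gaussSum χ ZMod.stdAddChar = Real.sqrt ((8 * d : ℕ) : ℝ) := by
  have hd0 : d ≠ 0 := by rintro rfl; simp at hd
  haveI : NeZero d := ⟨hd0⟩
  have hd4 : d % 4 = 1 ∨ d % 4 = 3 := by rcases hd with ⟨k, rfl⟩; omega
  have hcop : (8:ℕ).Coprime d := by
    rw [show 8 = 2^3 by norm_num]; exact Nat.Coprime.pow_left _ (Nat.coprime_two_left.2 hd)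
  rw [gaussSum_mul_coprime hcop χ _ (jac d) (chi8_factor hd h), gauss_jac d hd hs, jac_natCast]
  have e8 : jacobiSym ((8:ℕ):ℤ) d = ZMod.χ₈ d := by
    rw [← jacobiSym.at_two hd, show ((8:ℕ):ℤ) = 4 * 2 by norm_num, jacobiSym.mul_left, jacobiSym.at_four hd, one_mul]
  rw [e8]
  have hsq : ZMod.χ₈ d * ZMod.χ₈ d = 1 := by
    rw [← jacobiSym.at_two hd, ← sq]
    exact jacobiSym.sq_one (by
      have := Nat.coprime_two_left.2 hd
      simpa [Int.gcd] using this)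
  have hsq' : ((ZMod.χ₈ d : ℤ):ℂ) * ((ZMod.χ₈ d : ℤ):ℂ) = 1 := by exact_mod_cast hsq
  rw [Nat.cast_mul, Real.sqrt_mul (by positivity)]
  rcases hd4 with h4 | h4
  · simp only [h4, if_true]
    rw [gauss_c8, c8_apply, hsq']; push_cast; ring
  · simp only [h4, show ¬ (3 = 1) by norm_num, if_false]
    have := ZMod.χ₈'_int_eq_χ₄_mul_χ₈ d
    push_cast at this
    rw [gauss_c8', c8'_apply, this, ZMod.χ₄_nat_three_mod_four h4]; push_cast
    linear_combination (-I^2 * Real.sqrt 8 * Real.sqrt d) * hsq' + (-(Real.sqrt 8 : ℂ) * Real.sqrt d) * I_sq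

lemma rootNumber_chi8 {d : ℕ} (hd : Odd d) (hs : Squarefree d) [NeZero (8 * d)] {χ : DirichletCharacter ℂ (8 * d)} (h : IsChi8 d χ) :
    DirichletCharacter.rootNumber χ = 1 := by
  have hd0 : d ≠ 0 := by rintro rfl; simp at hd
  have h0 : (Real.sqrt ((8 * d : ℕ) : ℝ) : ℂ) ≠ 0 := by
    have : Real.sqrt ((8 * d : ℕ) : ℝ) ≠ 0 := by positivity
    exact_mod_cast this
  rw [DirichletCharacter.rootNumber, gauss_chi8 hd hs h, sqrt_cpow, if_pos (chi8_even hd h)]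
  simp only [pow_zero, div_one]
  exact div_self h0

lemma chi8_inv {d : ℕ} [NeZero (8 * d)] {χ : DirichletCharacter ℂ (8 * d)} (h : IsChi8 d χ) : χ⁻¹ = χ := by
  apply MulChar.IsQuadratic.inv
  intro a
  rw [← ZMod.natCast_zmod_val a]
  rcases Nat.even_or_odd a.val with hk | hk
  · left; exact h.2 _ hk
  · rw [h.1 _ hk]
    rcases jacobiSym.trichotomy (8 * d) a.val with h | h | h <;> rw [h] <;> simp

lemma chi8_isPrimitive {d : ℕ} (hd : Odd d) (hs : Squarefree d) [NeZero (8 * d)] {χ : DirichletCharacter ℂ (8 * d)} (h : IsChi8 d χ) :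
    χ.IsPrimitive := by
  have hd0 : d ≠ 0 := by rintro rfl; simp at hd
  apply prim_of
  intro p hp hpn
  by_cases hp2 : p = 2
  · subst hp2
    refine ⟨1 + 4 * d, ?_, ?_, ?_⟩
    · apply Nat.Coprime.mul_right
      · rw [show 8 = 2^3 by norm_num]
        exact Nat.Coprime.pow_right _ (Nat.coprime_two_right.2 ⟨2 * d, by ring⟩)
      · simp
    · rw [show 8 * d / 2 = 4 * d by omega]
      simp [Nat.ModEq]
    · have ho : Odd (1 + 4 * d) := ⟨2 * d, by ring⟩
      rw [h.1 _ ho, jacobi8 _ _ ho, jacobiSym.mul_left, jacobiSym.at_two ho,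
        jacobiSym.quadratic_reciprocity_one_mod_four' hd (by omega)]
      have e1 : jacobiSym ((1 + 4 * d : ℕ) : ℤ) d = 1 := by
        rw [← jacobiSym.one_left d]
        exact jacobiSym.mod_left' (by push_cast; simp)
      rw [e1, ZMod.χ₈_nat_mod_eight, show (1 + 4 * d) % 8 = 5 by rcases hd with ⟨k, rfl⟩; omega,
        show ZMod.χ₈ ((5:ℕ) : ZMod 8) = -1 by decide]
      norm_num
  · have hpd : p ∣ d := by
      rcases (Nat.Prime.dvd_mul hp).1 hpn with h8 | h8
      · rw [show 8 = 2^3 by norm_num] at h8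
        exact absurd ((Nat.prime_dvd_prime_iff_eq hp Nat.prime_two).1 (hp.dvd_of_dvd_pow h8)) hp2
      · exact h8
    obtain ⟨m, rfl⟩ := hpd
    have hpo : Odd p := hp.odd_of_ne_two hp2
    rw [Nat.odd_mul] at hd
    have hcop : p.Coprime m := Nat.coprime_of_squarefree_mul hs
    have hcop8 : p.Coprime (8 * m) := by
      refine Nat.Coprime.mul_right ?_ hcop
      rw [show 8 = 2^3 by norm_num]
      exact Nat.Coprime.pow_right _ (Nat.coprime_two_right.2 hpo)
    obtain ⟨x, h1, h2, h3⟩ := exists_nonres p hp hpo (8 * m) hcop8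
    have hxm : x.Coprime (8 * m) := by rw [Nat.Coprime, h1.gcd_eq]; simp
    have hx8 : x % 8 = 1 := h1.of_dvd (Dvd.intro _ rfl)
    have hxo : Odd x := Nat.odd_iff.2 (by omega)
    refine ⟨x, ?_, ?_, ?_⟩
    · rw [show 8 * (p * m) = p * (8 * m) by ring]; exact Nat.Coprime.mul_right h3 hxm
    · rw [show 8 * (p * m) = p * (8 * m) by ring]; rwa [Nat.mul_div_cancel_left _ hp.pos]
    · rw [h.1 _ hxo, jacobi8 _ _ hxo, show (2 * ((p * m : ℕ):ℤ)) = p * ((2 * m : ℕ):ℤ) by push_cast; ring,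
        jacobiSym.mul_left, jacobiSym.quadratic_reciprocity_one_mod_four' hpo (by omega), h2,
        jacobiSym.mod_right _ hxo]
      have : x % (4 * ((2 * m : ℕ):ℤ).natAbs) = 1 % (8 * m) := by
        rw [Int.natAbs_natCast, show 4 * (2 * m) = 8 * m by ring]; exact h1
      have hm0 : m ≠ 0 := by rintro rfl; simp at hd0
      rw [this, Nat.mod_eq_of_lt (by omega), jacobiSym.one_right]
      norm_num

end Chi8

section FE
open Complex Filter Topology

/-- the character `(c/·)` modulo `8|c|`. -/
noncomputable def chc (c : ℤ) [NeZero (8 * c.natAbs)] : DirichletCharacter ℂ (8 * c.natAbs) where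
  toFun x := if Odd x.val then ((jacobiSym c x.val : ℤ) : ℂ) else 0
  map_one' := by
    have h0 : c.natAbs ≠ 0 := fun h => NeZero.ne (8 * c.natAbs) (by simp [h])
    haveI : Fact (1 < 8 * c.natAbs) := ⟨by omega⟩
    rw [ZMod.val_one]; simp
  map_mul' x y := by
    have h0 : c.natAbs ≠ 0 := fun h => NeZero.ne (8 * c.natAbs) (by simp [h])
    have hodd : Odd (x * y).val ↔ Odd x.val ∧ Odd y.val := by
      rw [ZMod.val_mul, ← Nat.odd_mul, Nat.odd_iff, Nat.odd_iff,
        Nat.mod_mod_of_dvd _ ⟨4 * c.natAbs, by ring⟩]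
    by_cases hx : Odd x.val
    · by_cases hy : Odd y.val
      · have hxy := hodd.2 ⟨hx, hy⟩
        simp only [hx, hy, hxy, if_true]
        have : jacobiSym c (x * y).val = jacobiSym c x.val * jacobiSym c y.val := by
          rw [jacobiSym.mod_right c hxy, ZMod.val_mul, Nat.mod_mod_of_dvd _ ⟨2, by ring⟩,
            ← jacobiSym.mod_right c (hx.mul hy), jacobiSym.mul_right' c (by rintro h; simp [h] at hx)
            (by rintro h; simp [h] at hy)]
        rw [this]; push_cast; rfl
      · have hxy : ¬ Odd (x * y).val := fun h => hy (hodd.1 h).2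
        simp only [hy, hxy, if_false, mul_zero]
    · have hxy : ¬ Odd (x * y).val := fun h => hx (hodd.1 h).1
      simp only [hx, hxy, if_false, zero_mul]
  map_nonunit' x hx := by
    split_ifs with ho
    · have : jacobiSym c x.val = 0 := by
        haveI : NeZero x.val := ⟨by rintro h; simp [h] at ho⟩
        rw [jacobiSym.eq_zero_iff_not_coprime]
        intro h
        apply hx
        rw [← ZMod.natCast_zmod_val x, ZMod.isUnit_iff_coprime]
        refine Nat.Coprime.mul_right ?_ ?_
        · exact Nat.Coprime.pow_right 3 (Nat.coprime_two_right.2 ho)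
        · rw [Nat.coprime_comm]; simpa [Nat.Coprime, Int.gcd, -ZMod.natCast_val] using h
      rw [this]; simp
    · rfl

lemma chc_natCast (c : ℤ) [NeZero (8 * c.natAbs)] (k : ℕ) :
    chc c k = if Odd k then ((jacobiSym c k : ℤ) : ℂ) else 0 := by
  change (if Odd ((k : ZMod (8 * c.natAbs))).val then _ else _) = _
  have h : Odd ((k : ZMod (8 * c.natAbs))).val ↔ Odd k := by
    rw [ZMod.val_natCast, Nat.odd_iff, Nat.odd_iff, Nat.mod_mod_of_dvd _ ⟨4 * c.natAbs, by ring⟩]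
  by_cases hk : Odd k
  · rw [if_pos (h.2 hk), if_pos hk, jacobiSym.mod_right c (h.2 hk), ZMod.val_natCast, Nat.mod_mod_of_dvd _ ⟨2, by ring⟩,
            ← jacobiSym.mod_right c hk]
  · rw [if_neg (fun h' => hk (h.1 h')), if_neg hk]

noncomputable def Xp (s : ℂ) : ℂ := Gammaℝ (1 - s) * (Gammaℝ s)⁻¹
noncomputable def Xm (s : ℂ) : ℂ := Gammaℝ (2 - s) * (Gammaℝ (s + 1))⁻¹

lemma diffAt_Gammaℝ {s : ℂ} (hs : 0 < s.re) : DifferentiableAt ℂ Gammaℝ s := by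
  have h1 := (differentiable_Gammaℝ_inv s).inv (inv_ne_zero (Gammaℝ_ne_zero_of_re_pos hs))
  have h2 : (fun s => (Gammaℝ s)⁻¹)⁻¹ = Gammaℝ := by ext; simp
  exact h2 ▸ h1

lemma diffAt_Xp {s : ℂ} (hs : s.re < 1) : DifferentiableAt ℂ Xp s := by
  unfold Xp
  refine DifferentiableAt.mul ?_ (differentiable_Gammaℝ_inv s)
  exact (diffAt_Gammaℝ (s := 1 - s) (by simp; exact hs)).comp s (by fun_prop)

lemma diffAt_Xm {s : ℂ} (hs : s.re < 1) : DifferentiableAt ℂ Xm s := by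
  unfold Xm
  refine DifferentiableAt.mul ?_ (DifferentiableAt.comp (g := fun s => (Gammaℝ s)⁻¹) (f := fun s => s + 1) s (differentiable_Gammaℝ_inv (s+1)) (by fun_prop))
  exact (diffAt_Gammaℝ (s := 2 - s) (by simp; linarith)).comp s (by fun_prop)

lemma FE_even {N : ℕ} [NeZero N] {χ : DirichletCharacter ℂ N} (hp : χ.IsPrimitive) (hi : χ⁻¹ = χ)
    (hr : χ.rootNumber = 1) (he : χ.Even) {s : ℂ} (hs : s.re < 1) (h0 : s ≠ 0 ∨ N ≠ 1) :
    χ.LFunction s = (N:ℂ)^(1/2 - s) * Xp s * χ.LFunction (1 - s) := by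
  have hs1 : (1 - s) ≠ 0 := fun h => by
    have := congrArg re h; simp at this; linarith
  have h1 := hp.completedLFunction_one_sub (1 - s)
  rw [hr, hi, sub_sub_cancel] at h1
  rw [χ.LFunction_eq_completed_div_gammaFactor s h0, χ.LFunction_eq_completed_div_gammaFactor (1-s) (Or.inl hs1),
    h1, he.gammaFactor_def, he.gammaFactor_def, Xp]
  have hg : Gammaℝ (1 - s) ≠ 0 := Gammaℝ_ne_zero_of_re_pos (by simp; exact hs)
  rw [show 1 - s - 1/2 = 1/2 - s by ring]
  field_simp

lemma FE_odd {N : ℕ} [NeZero N] {χ : DirichletCharacter ℂ N} (hp : χ.IsPrimitive) (hi : χ⁻¹ = χ)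
    (hr : χ.rootNumber = 1) (he : χ.Odd) {s : ℂ} (hs : s.re < 1) (h0 : s ≠ 0 ∨ N ≠ 1) :
    χ.LFunction s = (N:ℂ)^(1/2 - s) * Xm s * χ.LFunction (1 - s) := by
  have hs1 : (1 - s) ≠ 0 := fun h => by
    have := congrArg re h; simp at this; linarith
  have h1 := hp.completedLFunction_one_sub (1 - s)
  rw [hr, hi, sub_sub_cancel] at h1
  rw [χ.LFunction_eq_completed_div_gammaFactor s h0, χ.LFunction_eq_completed_div_gammaFactor (1-s) (Or.inl hs1),
    h1, he.gammaFactor_def, he.gammaFactor_def, Xm]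
  have hg : Gammaℝ (2 - s) ≠ 0 := Gammaℝ_ne_zero_of_re_pos (by simp; linarith)
  rw [show 1 - s - 1/2 = 1/2 - s by ring, show 1 - s + 1 = 2 - s by ring]
  field_simp

lemma FE_jac (n : ℕ) [NeZero n] (hn : Odd n) (hq : Squarefree n) {s : ℂ} (hs : s.re < 1) (h0 : s ≠ 0 ∨ n ≠ 1) :
    (jac n).LFunction s = (n:ℂ)^(1/2 - s) * (if n % 4 = 1 then Xp s else Xm s) * (jac n).LFunction (1 - s) := by
  have h1 : n % 4 = 1 ∨ n % 4 = 3 := by rcases hn with ⟨k, rfl⟩; omega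
  rcases h1 with h1 | h1
  · rw [if_pos h1]
    exact FE_even (jac_isPrimitive n hn hq) (jac_sq_real n) (rootNumber_jac n hn hq) (jac_even n h1) hs h0
  · rw [if_neg (by omega)]
    exact FE_odd (jac_isPrimitive n hn hq) (jac_sq_real n) (rootNumber_jac n hn hq) (jac_odd n h1) hs h0

lemma FE_chi8 {d : ℕ} (hd : Odd d) (hs : Squarefree d) [NeZero (8 * d)] {χ : DirichletCharacter ℂ (8 * d)} (h : IsChi8 d χ)
    {s : ℂ} (hs1 : s.re < 1) :
    χ.LFunction s = ((8 * d : ℕ):ℂ)^(1/2 - s) * Xp s * χ.LFunction (1 - s) :=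
  FE_even (chi8_isPrimitive hd hs h) (chi8_inv h) (rootNumber_chi8 hd hs h) (chi8_even hd h) hs1 (Or.inr (by omega))

lemma ne_one_of_prim {N : ℕ} (hN : N ≠ 1) {χ : DirichletCharacter ℂ N} (hp : χ.IsPrimitive) [NeZero N] : χ ≠ 1 := by
  rintro rfl
  rw [DirichletCharacter.isPrimitive_def, DirichletCharacter.conductor_one] at hp
  exact hN hp.symm

end FE

section Crude
open Complex Filter Topology

lemma sum_range_zmod {N : ℕ} [NeZero N] (f : ZMod N → ℂ) : ∑ k ∈ Finset.range N, f k = ∑ x, f x := by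
  have hb : Function.Bijective (fun r : Fin N => ((r:ℕ) : ZMod N)) := by
    rw [Fintype.bijective_iff_injective_and_card]
    refine ⟨fun a b h => ?_, by simp⟩
    simp only at h
    rw [ZMod.natCast_eq_natCast_iff, Nat.ModEq, Nat.mod_eq_of_lt a.2, Nat.mod_eq_of_lt b.2] at h
    exact Fin.ext h
  rw [← Function.Bijective.sum_comp hb, Finset.sum_range]

lemma char_sum_bound {N : ℕ} [NeZero N] {χ : DirichletCharacter ℂ N} (hχ : χ ≠ 1) (n : ℕ) :
    ‖∑ k ∈ Finset.range n, χ (k : ZMod N)‖ ≤ N := by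
  have h0 : ∑ k ∈ Finset.range N, χ (k : ZMod N) = 0 := by
    rw [sum_range_zmod (fun x => χ x)]; exact MulChar.sum_eq_zero_of_ne_one hχ
  have hper : ∀ n, ∑ k ∈ Finset.range (N + n), χ (k : ZMod N) = ∑ k ∈ Finset.range n, χ (k : ZMod N) := by
    intro n
    rw [Finset.sum_range_add, h0, zero_add]
    simp
  induction n using Nat.strong_induction_on with
  | _ n ih =>
    by_cases hn : n < N
    · calc _ ≤ ∑ k ∈ Finset.range n, ‖χ (k : ZMod N)‖ := norm_sum_le _ _
        _ ≤ ∑ k ∈ Finset.range n, (1:ℝ) := Finset.sum_le_sum fun k _ => χ.norm_le_one _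
        _ ≤ N := by simp; omega
    · obtain ⟨m, rfl⟩ := Nat.exists_eq_add_of_le (not_lt.1 hn)
      rw [hper]
      exact ih m (by have := NeZero.pos N; omega)

lemma cpow_diff_bound {z : ℂ} (hz : 0 < z.re) (n : ℕ) (hn : 0 < n) :
    ‖(n:ℂ)^(-z) - ((n+1:ℕ):ℂ)^(-z)‖ ≤ ‖z‖ * (n:ℝ)^(-z.re - 1) := by
  have hn0 : (0:ℝ) < n := by exact_mod_cast hn
  have hz0 : -z ≠ 0 := fun h => by rw [neg_eq_zero] at h; rw [h] at hz; simp at hz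
  have hd : ∀ t ∈ Set.Icc (n:ℝ) (n+1), HasDerivWithinAt (fun t : ℝ => (t:ℂ)^(-z)) (-z * (t:ℂ)^(-z-1)) (Set.Icc (n:ℝ) (n+1)) t := by
    intro t ht
    exact (hasDerivAt_ofReal_cpow_const (lt_of_lt_of_le hn0 ht.1).ne' hz0).hasDerivWithinAt
  have h1 := norm_image_sub_le_of_norm_deriv_le_segment' hd (C := ‖z‖ * (n:ℝ)^(-z.re - 1)) (fun t ht => by
    have ht0 : 0 < t := lt_of_lt_of_le hn0 ht.1
    rw [norm_mul, norm_neg, norm_cpow_eq_rpow_re_of_pos ht0]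
    gcongr
    simp only [sub_re, neg_re, one_re]
    exact Real.rpow_le_rpow_of_nonpos hn0 ht.1 (by linarith)) (n+1) (by simp)
  rw [norm_sub_rev]
  push_cast at h1 ⊢
  simpa using h1

noncomputable def Lab {N : ℕ} (χ : DirichletCharacter ℂ N) (n : ℕ) (z : ℂ) : ℂ :=
  (∑ k ∈ Finset.range (n+2), χ (k : ZMod N)) * (((n+1:ℕ):ℂ)^(-z) - ((n+1+1:ℕ):ℂ)^(-z))

lemma Lab_bound {N : ℕ} [NeZero N] {χ : DirichletCharacter ℂ N} (hχ : χ ≠ 1) {σ R : ℝ} (hσ : 0 < σ) {z : ℂ} (hz : σ ≤ z.re)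
    (hR : ‖z‖ ≤ R) (n : ℕ) : ‖Lab χ n z‖ ≤ N * (R * ((n+1:ℕ):ℝ)^(-σ-1)) := by
  rw [Lab, norm_mul]
  have h1 := cpow_diff_bound (lt_of_lt_of_le hσ hz) (n+1) (by omega)
  have h2 : ((n+1:ℕ):ℝ)^(-z.re-1) ≤ ((n+1:ℕ):ℝ)^(-σ-1) :=
    Real.rpow_le_rpow_of_exponent_le (by push_cast; linarith [Nat.cast_nonneg (α := ℝ) n]) (by linarith)
  refine mul_le_mul (char_sum_bound hχ _) (h1.trans ?_) (norm_nonneg _) (by positivity)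
  have := (norm_nonneg z).trans hR
  gcongr

lemma summable_shift {σ : ℝ} (hσ : 0 < σ) : Summable (fun n : ℕ => ((n+1:ℕ):ℝ)^(-σ-1)) :=
  (summable_nat_add_iff 1).2 (Real.summable_nat_rpow.2 (by linarith))

lemma Lab_tsum {N : ℕ} [NeZero N] {χ : DirichletCharacter ℂ N} (hχ : χ ≠ 1) {z : ℂ} (hz : 0 < z.re) :
    χ.LFunction z = ∑' n, Lab χ n z := by
  have hN : N ≠ 1 := by
    rintro rfl; exact hχ (by ext a; simp [Subsingleton.elim a 1])
  have hopen : IsOpen {z : ℂ | 0 < z.re} := isOpen_lt continuous_const continuous_re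
  have hconv : IsPreconnected {z : ℂ | 0 < z.re} := (convex_halfSpace_re_gt 0).isPreconnected
  have hsum : ∀ z : ℂ, 0 < z.re → Summable (fun n => Lab χ n z) := fun z hz =>
    Summable.of_norm_bounded (((summable_shift hz).mul_left _).mul_left _) (fun n => Lab_bound hχ hz le_rfl le_rfl n)
  have hdiff : DifferentiableOn ℂ (fun z => ∑' n, Lab χ n z) {z : ℂ | 0 < z.re} := by
    intro z0 hz0
    have hz0' : 0 < z0.re := hz0
    have ho2 : IsOpen ({z : ℂ | z0.re / 2 < z.re} ∩ Metric.ball 0 (‖z0‖ + 1)) :=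
      (isOpen_lt continuous_const continuous_re).inter Metric.isOpen_ball
    have hm : z0 ∈ ({z : ℂ | z0.re / 2 < z.re} ∩ Metric.ball 0 (‖z0‖ + 1)) := by
      refine ⟨by simp only [Set.mem_setOf_eq]; linarith, by simp⟩
    refine ((differentiableOn_tsum_of_summable_norm (((summable_shift (half_pos hz0')).mul_left (‖z0‖+1)).mul_left (N:ℝ)) ?_ ho2 ?_) z0 hm |>.differentiableAt
      (ho2.mem_nhds hm)).differentiableWithinAt
    · intro n z _
      refine DifferentiableAt.differentiableWithinAt ?_
      unfold Lab
      refine DifferentiableAt.const_mul (DifferentiableAt.sub ?_ ?_) _ <;>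
      exact (differentiableAt_neg_iff.2 differentiableAt_id).const_cpow (Or.inl (Nat.cast_ne_zero.2 (by omega)))
    · intro n z hz
      exact Lab_bound hχ (half_pos hz0') hz.1.le (mem_ball_zero_iff.1 hz.2).le n
  have heq := AnalyticOnNhd.eqOn_of_preconnected_of_eventuallyEq
    ((DirichletCharacter.differentiable_LFunction hχ).differentiableOn.analyticOnNhd hopen)
    (hdiff.analyticOnNhd hopen) hconv (z₀ := 2) (by simp) ?_
  · exact heq hz
  · have : ∀ᶠ z : ℂ in 𝓝 2, 1 < z.re := (isOpen_lt continuous_const continuous_re).mem_nhds (by simp)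
    filter_upwards [this] with z hz
    rw [DirichletCharacter.LFunction_eq_LSeries χ hz]
    have h1 : Summable (LSeries.term (fun n => χ n) z) := DirichletCharacter.LSeriesSummable_of_one_lt_re χ hz
    have h2 := ((summable_nat_add_iff 1).2 h1).hasSum.tendsto_sum_nat
    have h3 := (hsum z (by linarith)).hasSum.tendsto_sum_nat
    have hz0 : z ≠ 0 := fun h => by rw [h] at hz; simp at hz; linarith
    have h4 : LSeries (fun n => χ n) z = ∑' n, LSeries.term (fun n => χ n) z (n + 1) := by
      rw [LSeries, h1.tsum_eq_zero_add]; simp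
    have hχ0 : χ 0 = 0 := by
      have : Nontrivial (ZMod N) := ZMod.nontrivial_iff.2 hN
      exact χ.map_zero
    have key : ∀ M : ℕ, ∑ n ∈ Finset.range M, Lab χ n z = ∑ n ∈ Finset.range M, LSeries.term (fun n => χ n) z (n + 1)
       - (∑ k ∈ Finset.range (M+1), χ (k : ZMod N)) * ((M+1:ℕ):ℂ)^(-z) := by
      intro M
      induction M with
      | zero => simp [hχ0]
      | succ M ih =>
        rw [Finset.sum_range_succ, ih, Finset.sum_range_succ (fun n => LSeries.term _ _ (n+1)) M, Lab, Finset.sum_range_succ _ (M+1),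
          LSeries.term_of_ne_zero (Nat.succ_ne_zero M), div_eq_mul_inv, ← cpow_neg]
        ring
    have h5 : Tendsto (fun M : ℕ => (∑ k ∈ Finset.range (M+1), χ (k : ZMod N)) * ((M+1:ℕ):ℂ)^(-z)) atTop (𝓝 0) := by
      refine squeeze_zero_norm (a := fun M : ℕ => N * ((M+1:ℕ):ℝ)^(-z.re)) (fun M => ?_) ?_
      · rw [norm_mul, norm_natCast_cpow_of_pos (by omega), neg_re]
        gcongr
        exact char_sum_bound hχ _
      · rw [← mul_zero (N:ℝ)]
        exact ((tendsto_rpow_neg_atTop (by linarith : 0 < z.re)).comp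
          (tendsto_natCast_atTop_atTop.comp (tendsto_add_atTop_nat 1))).const_mul _
    rw [h4]
    have h6 := h2.sub h5
    rw [sub_zero] at h6
    simp_rw [← key] at h6
    exact tendsto_nhds_unique h6 h3

lemma crude {σ R : ℝ} (hσ : 0 < σ) : ∃ C : ℝ, 0 < C ∧ ∀ (N : ℕ) [NeZero N] (χ : DirichletCharacter ℂ N), χ ≠ 1 → ∀ z : ℂ,
    σ ≤ z.re → ‖z‖ ≤ R → ‖χ.LFunction z‖ ≤ C * N := by
  refine ⟨max 1 (R * ∑' n : ℕ, ((n+1:ℕ):ℝ)^(-σ-1)), by positivity, fun N _ χ hχ z hz hR => ?_⟩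
  rw [Lab_tsum hχ (hσ.trans_le hz)]
  have hs := (((summable_shift hσ).mul_left R).mul_left (N:ℝ))
  have := tsum_of_norm_bounded hs.hasSum (fun n => Lab_bound hχ hσ hz hR n)
  refine this.trans ?_
  rw [tsum_mul_left, tsum_mul_left, mul_comm]
  gcongr
  exact le_max_right _ _

/-- crude bounds through the functional equation -/
lemma crude_FE {R : ℝ} (X : ℂ → ℂ) (hX : ∀ s : ℂ, s.re < 1 → DifferentiableAt ℂ X s) :
    ∃ C : ℝ, 0 < C ∧ ∀ (N : ℕ) [NeZero N] (χ : DirichletCharacter ℂ N), χ ≠ 1 →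
      (∀ s : ℂ, s.re < 1 → χ.LFunction s = (N:ℂ)^(1/2 - s) * X s * χ.LFunction (1 - s)) → ∀ z : ℂ,
    -1/2 ≤ z.re → ‖z‖ ≤ R → ‖χ.LFunction z‖ ≤ C * (N:ℝ)^2 := by
  obtain ⟨C1, hC1, h1⟩ := crude (σ := 1/4) (R := R + 1) (by norm_num)
  have hcomp : IsCompact ({z : ℂ | z.re ≤ 1/4} ∩ Metric.closedBall 0 R) :=
    (isCompact_closedBall 0 R).inter_left (isClosed_le continuous_re continuous_const)
  obtain ⟨C2, hC2⟩ := hcomp.exists_bound_of_continuousOn (f := X)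
    (fun z hz => (hX z (by have := hz.1; simp only [Set.mem_setOf_eq] at this; linarith)).continuousAt.continuousWithinAt)
  refine ⟨C1 + |C2| * C1, by positivity, fun N _ χ hχ hFE z hz hR => ?_⟩
  have hN : (1:ℝ) ≤ N := by exact_mod_cast NeZero.pos N
  have hR' : ‖1 - z‖ ≤ R + 1 := by
    calc ‖1 - z‖ ≤ ‖(1:ℂ)‖ + ‖z‖ := norm_sub_le _ _
      _ ≤ R + 1 := by simp; linarith
  by_cases hz4 : 1/4 ≤ z.re
  · refine (h1 N χ hχ z hz4 (by linarith)).trans ?_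
    have : C1 * N ≤ C1 * (N:ℝ)^2 := by gcongr; nlinarith
    nlinarith [mul_nonneg (mul_nonneg (abs_nonneg C2) hC1.le) (sq_nonneg (N:ℝ))]
  · push Not at hz4
    rw [hFE z (by linarith), norm_mul, norm_mul, norm_natCast_cpow_of_pos (NeZero.pos N)]
    have a1 := h1 N χ hχ (1 - z) (by simp; linarith) hR'
    have a2 : ‖X z‖ ≤ |C2| := (hC2 z ⟨hz4.le, by simpa using hR⟩).trans (le_abs_self _)
    have a3 : (N:ℝ)^((1/2 - z).re) ≤ N := by
      nth_rw 2 [← Real.rpow_one (N:ℝ)]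
      exact Real.rpow_le_rpow_of_exponent_le hN (by simp; linarith)
    calc _ ≤ (N:ℝ) * |C2| * (C1 * N) := by gcongr
      _ ≤ _ := by nlinarith [mul_nonneg hC1.le (sq_nonneg (N:ℝ))]

end Crude

section Subharm
open Complex Filter Topology MeasureTheory Metric

lemma jensen_le {f : ℂ → ℂ} (hf : Differentiable ℂ f) {z : ℂ} (hz : f z ≠ 0) {ρ : ℝ} (hρ : 0 < ρ) :
    Real.log ‖f z‖ ≤ Real.circleAverage (fun x => Real.log ‖f x‖) z ρ := by
  have han : AnalyticOnNhd ℂ f (closedBall z |ρ|) := fun x _ => hf.analyticAt x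
  rw [han.circleAverage_log_norm hρ.ne' hz]
  have : 0 ≤ ∑ᶠ u, MeromorphicOn.divisor f (closedBall z |ρ|) u * Real.log (ρ * ‖z - u‖⁻¹) := by
    refine finsum_nonneg fun u => ?_
    by_cases hu : u ∈ closedBall z |ρ|
    · refine mul_nonneg (by exact_mod_cast (MeromorphicOn.AnalyticOnNhd.divisor_nonneg han) u) ?_
      by_cases h0 : z - u = 0
      · simp [h0]
      · apply Real.log_nonneg
        have h1 : 0 < ‖z - u‖ := norm_pos_iff.2 h0
        rw [← div_eq_mul_inv, one_le_div h1]
        rw [mem_closedBall', dist_eq, abs_of_pos hρ] at hu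
        exact hu
    · rw [Function.locallyFinsuppWithin.apply_eq_zero_of_notMem _ hu]; simp
  linarith

lemma exists_radius {S : Set ℂ} (hS : MeasurableSet S) (z : ℂ) {r η : ℝ} (hr : 0 < r) (hη : 0 < η)
    (hv : volume S < ENNReal.ofReal (r ^ 2 * η / 4)) :
    ∃ ρ ∈ Set.Ioo (r/2) r, volume {θ : ℝ | θ ∈ Set.Ioo (-Real.pi) Real.pi ∧ circleMap z ρ θ ∈ S} ≤ ENNReal.ofReal η := by
  by_contra! hcon
  have hS2 : MeasurableSet {x : ℂ | z + x ∈ S} := hS.preimage (measurable_const_add z)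
  have h1 := Complex.lintegral_comp_polarCoord_symm (Set.indicator {x : ℂ | z + x ∈ S} 1)
  rw [lintegral_indicator_one hS2] at h1
  have h2 : volume {x : ℂ | z + x ∈ S} = volume S := measure_preimage_add volume z S
  have hm : Measurable (fun p : ℝ × ℝ => ENNReal.ofReal p.1 • Set.indicator {x : ℂ | z + x ∈ S} (1 : ℂ → ENNReal) (Complex.polarCoord.symm p)) := by
    refine Measurable.smul (ENNReal.measurable_ofReal.comp measurable_fst) (Measurable.comp (measurable_one.indicator hS2) ?_)
    rw [show (Complex.polarCoord.symm : ℝ × ℝ → ℂ) = fun p => p.1 * (Real.cos p.2 + Real.sin p.2 * I) from funext Complex.polarCoord_symm_apply]; fun_prop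
  rw [h2, polarCoord_target, Measure.volume_eq_prod, setLIntegral_prod _ hm.aemeasurable] at h1
  have h3 : ∀ ρ ∈ Set.Ioo (r/2) r, ENNReal.ofReal (r/2 * η) ≤ ∫⁻ θ in Set.Ioo (-Real.pi) Real.pi, ENNReal.ofReal ρ • Set.indicator {x : ℂ | z + x ∈ S} (1 : ℂ → ENNReal) (Complex.polarCoord.symm (ρ, θ)) := by
    intro ρ hρ
    have e1 : ∀ θ, Set.indicator {x : ℂ | z + x ∈ S} (1 : ℂ → ENNReal) (Complex.polarCoord.symm (ρ, θ)) =
        Set.indicator {θ : ℝ | circleMap z ρ θ ∈ S} 1 θ := by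
      intro θ
      have : z + Complex.polarCoord.symm (ρ, θ) = circleMap z ρ θ := by
        rw [Complex.polarCoord_symm_apply, circleMap, Complex.exp_mul_I]; push_cast; rfl
      by_cases hh : circleMap z ρ θ ∈ S <;> simp only [Set.indicator, Set.mem_setOf_eq, this, hh, if_true, if_false] <;> rfl
    have hm2 : MeasurableSet {θ : ℝ | circleMap z ρ θ ∈ S} := hS.preimage (by fun_prop)
    simp_rw [e1, smul_eq_mul]
    rw [lintegral_const_mul _ (measurable_one.indicator hm2), lintegral_indicator_one hm2, Measure.restrict_apply hm2,
      ENNReal.ofReal_mul (by positivity)]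
    refine mul_le_mul' (ENNReal.ofReal_le_ofReal hρ.1.le) ((hcon ρ hρ).le.trans (measure_mono ?_))
    rintro θ ⟨a, b⟩; exact ⟨b, a⟩
  have h4 : ∫⁻ ρ in Set.Ioo (r/2) r, ENNReal.ofReal (r/2 * η) ≤ volume S := by
    rw [← h1]
    calc _ ≤ ∫⁻ ρ in Set.Ioo (r/2) r, ∫⁻ θ in Set.Ioo (-Real.pi) Real.pi, ENNReal.ofReal ρ • Set.indicator {x : ℂ | z + x ∈ S} (1 : ℂ → ENNReal) (Complex.polarCoord.symm (ρ, θ)) :=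
          setLIntegral_mono' measurableSet_Ioo h3
      _ ≤ _ := lintegral_mono_set (fun x hx => lt_trans (by positivity) hx.1)
  rw [setLIntegral_const, Real.volume_Ioo, ← ENNReal.ofReal_mul (by positivity)] at h4
  have : r / 2 * η * (r - r / 2) = r ^ 2 * η / 4 := by ring
  rw [this] at h4
  exact absurd h4 (not_le.2 hv)

lemma subharm {f : ℂ → ℂ} (hf : Differentiable ℂ f) {S : Set ℂ} (hS : MeasurableSet S) (z : ℂ) {r η B K : ℝ} (hr : 0 < r) (hη : 0 < η)
    (hv : volume S < ENNReal.ofReal (r ^ 2 * η / 4)) (hB : 1 ≤ B) (hK : 1 ≤ K)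
    (h1 : ∀ x ∈ closedBall z r, ‖f x‖ ≤ K) (h2 : ∀ x ∈ closedBall z r, x ∉ S → ‖f x‖ ≤ B) : ‖f z‖ ≤ B * K ^ η := by
  by_cases h0 : f z = 0
  · rw [h0, norm_zero]; positivity
  obtain ⟨ρ, hρ, hm⟩ := exists_radius hS z hr hη hv
  have hρ0 : 0 < ρ := lt_trans (by positivity) hρ.1
  have hm2 : MeasurableSet {θ : ℝ | circleMap z ρ θ ∈ S} := hS.preimage (by fun_prop)
  have hj := jensen_le hf h0 hρ0
  have hint : CircleIntegrable (fun x => Real.log ‖f x‖) z ρ :=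
    MeromorphicOn.circleIntegrable_log_norm (fun x _ => (hf.analyticAt x).meromorphicAt)
  have hlK := Real.log_nonneg hK
  have hlB := Real.log_nonneg hB
  have hper : ∫ θ in (0:ℝ)..2 * Real.pi, Real.log ‖f (circleMap z ρ θ)‖ = ∫ θ in (-Real.pi)..Real.pi, Real.log ‖f (circleMap z ρ θ)‖ := by
    have hp : Function.Periodic (fun θ => Real.log ‖f (circleMap z ρ θ)‖) (2 * Real.pi) := fun x => by
      simp [periodic_circleMap z ρ x]
    have := hp.intervalIntegral_add_eq 0 (-Real.pi)
    rw [zero_add] at this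
    rw [this]; congr 1; ring
  have hint2 : IntervalIntegrable (fun θ => Real.log ‖f (circleMap z ρ θ)‖) volume (-Real.pi) Real.pi := by
    have hp : Function.Periodic (fun θ => Real.log ‖f (circleMap z ρ θ)‖) (2 * Real.pi) := fun x => by
      simp [periodic_circleMap z ρ x]
    exact hp.intervalIntegrable₀ (by positivity) hint _ _
  have hbd : ∫ θ in (-Real.pi)..Real.pi, Real.log ‖f (circleMap z ρ θ)‖ ≤
      2 * Real.pi * Real.log B + Real.log K * η := by
    have hpi : -Real.pi ≤ Real.pi := by linarith [Real.pi_pos]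
    rw [intervalIntegral.integral_of_le hpi, integral_Ioc_eq_integral_Ioo]
    have hind : IntegrableOn (Set.indicator {θ : ℝ | circleMap z ρ θ ∈ S} (fun _ => (1:ℝ))) (Set.Ioo (-Real.pi) Real.pi) :=
      Integrable.indicator (integrable_const _) hm2
    calc _ ≤ ∫ θ in Set.Ioo (-Real.pi) Real.pi, (Real.log B + Real.log K * Set.indicator {θ : ℝ | circleMap z ρ θ ∈ S} (fun _ => (1:ℝ)) θ) := by
          refine setIntegral_mono_on ?_ ((integrable_const _).add (hind.const_mul _)) measurableSet_Ioo (fun θ _ => ?_)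
          · rw [← integrableOn_Ioc_iff_integrableOn_Ioo]
            exact (intervalIntegrable_iff_integrableOn_Ioc_of_le hpi).1 hint2
          · have hin : circleMap z ρ θ ∈ closedBall z r := by
              have := circleMap_mem_closedBall z hρ0.le θ
              exact closedBall_subset_closedBall hρ.2.le this
            by_cases hθ : circleMap z ρ θ ∈ S
            · rw [Set.indicator_of_mem (show θ ∈ {θ : ℝ | circleMap z ρ θ ∈ S} from hθ)]
              by_cases hf0 : f (circleMap z ρ θ) = 0
              · rw [hf0]; simp; positivity
              · have := Real.log_le_log (norm_pos_iff.2 hf0) (h1 _ hin); linarith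
            · rw [Set.indicator_of_notMem (show θ ∉ {θ : ℝ | circleMap z ρ θ ∈ S} from hθ)]
              by_cases hf0 : f (circleMap z ρ θ) = 0
              · rw [hf0]; simp; positivity
              · have := Real.log_le_log (norm_pos_iff.2 hf0) (h2 _ hin hθ); linarith
      _ = 2 * Real.pi * Real.log B + Real.log K * (volume.restrict (Set.Ioo (-Real.pi) Real.pi)).real {θ : ℝ | circleMap z ρ θ ∈ S} := by
          rw [integral_add (integrable_const _) (hind.const_mul _), integral_const_mul, integral_indicator_const _ hm2]
          simp [Measure.real, Real.pi_pos.le]; left; ring_nf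
      _ ≤ _ := by
          gcongr
          rw [Measure.real, Measure.restrict_apply hm2]
          refine ENNReal.toReal_le_of_le_ofReal hη.le (le_trans (measure_mono ?_) hm)
          rintro θ ⟨a, b⟩; exact ⟨b, a⟩
  rw [Real.circleAverage_def, hper, smul_eq_mul] at hj
  have hfin : Real.log ‖f z‖ ≤ Real.log B + η * Real.log K := by
    refine hj.trans ?_
    rw [inv_mul_le_iff₀ Real.two_pi_pos]
    refine hbd.trans ?_
    have : 1 ≤ 2 * Real.pi := by linarith [Real.pi_gt_three]
    nlinarith [mul_nonneg hη.le hlK]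
  rw [← Real.log_rpow (by linarith), ← Real.log_mul (by positivity) (by positivity)] at hfin
  exact (Real.log_le_log_iff (norm_pos_iff.2 h0) (by positivity)).1 hfin

lemma glh_unif (hG : GLH) (z0 : ℂ) (hz0 : 1/2 < z0.re) (ε : ℝ) (hε : 0 < ε) : ∃ r : ℝ, 0 < r ∧ ∃ C : ℝ, 0 < C ∧
    ∀ (q : ℕ) [NeZero q] (χ : DirichletCharacter ℂ q), χ.IsPrimitive → q ≠ 1 → ∀ z ∈ ball z0 r, ‖χ.LFunction z‖ ≤ C * (q:ℝ)^ε := by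
  obtain ⟨r, hr⟩ : ∃ r, r = (z0.re - 1/2)/2 := ⟨_, rfl⟩
  have hr0 : 0 < r := by rw [hr]; linarith
  have hre : ∀ z ∈ closedBall z0 (2*r), 1/2 ≤ z.re := fun z hz => by
    rw [mem_closedBall, dist_eq] at hz
    have := (abs_le.1 (abs_re_le_norm (z - z0))).1
    simp at this; linarith
  let A : ℕ → Set ℂ := fun N => {z | ∀ (q : ℕ) (_ : NeZero q) (χ : DirichletCharacter ℂ q), χ.IsPrimitive → q ≠ 1 → ‖χ.LFunction z‖ ≤ (N+1) * (q:ℝ)^(ε/2)}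
  have hA : ∀ N, IsClosed (A N) := fun N => by
    simp only [A, Set.setOf_forall]
    refine isClosed_iInter fun q => isClosed_iInter fun _ => isClosed_iInter fun χ => isClosed_iInter fun hp => isClosed_iInter fun h1 => ?_
    exact isClosed_le (DirichletCharacter.differentiable_LFunction (ne_one_of_prim h1 hp)).continuous.norm continuous_const
  let S : ℕ → Set ℂ := fun N => closedBall z0 (2*r) \ A N
  have hS : ∀ N, MeasurableSet (S N) := fun N => measurableSet_closedBall.diff (hA N).measurableSet
  have hanti : Antitone S := by
    intro N M h
    refine Set.diff_subset_diff_right ?_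
    intro z hz q hq χ hp h1
    refine (hz q hq χ hp h1).trans ?_
    gcongr
  have hempty : ⋂ N, S N = ∅ := by
    rw [Set.eq_empty_iff_forall_notMem]
    intro z hz
    rw [Set.mem_iInter] at hz
    obtain ⟨C, hC, h⟩ := hG (ε/2) (half_pos hε) z.re (hre z (hz 0).1) z.im
    obtain ⟨N, hN⟩ := exists_nat_ge C
    refine (hz N).2 fun q hq χ hp h1 => ?_
    have := h q χ hp
    rw [re_add_im] at this
    refine this.trans ?_
    gcongr
    linarith
  have htend := tendsto_measure_iInter_atTop (μ := volume) (fun N => (hS N).nullMeasurableSet) hanti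
    ⟨0, ((measure_mono Set.diff_subset).trans_lt measure_closedBall_lt_top).ne⟩
  rw [hempty, measure_empty] at htend
  obtain ⟨N, hN⟩ := (htend.eventually (gt_mem_nhds (ENNReal.ofReal_pos.2 (by positivity : 0 < r^2 * (ε/2) / 4)))).exists
  obtain ⟨C, hC, hcr⟩ := crude (σ := 1/2) (R := ‖z0‖ + 2*r) (by norm_num)
  refine ⟨r, hr0, (N+1) * (C+1)^(ε/2), by positivity, fun q _ χ hp h1 z hz => ?_⟩
  have hq1 : (1:ℝ) ≤ q := by exact_mod_cast NeZero.pos q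
  have hsub : closedBall z r ⊆ closedBall z0 (2*r) := closedBall_subset_closedBall' (by
    have := mem_ball.1 hz; linarith)
  have key := subharm (DirichletCharacter.differentiable_LFunction (ne_one_of_prim h1 hp)) (hS N) z hr0 (half_pos hε) hN
    (B := (N+1) * (q:ℝ)^(ε/2)) (K := (C+1)*q) ?_ ?_ ?_ ?_
  · refine key.trans (le_of_eq ?_)
    rw [Real.mul_rpow (by positivity) (by positivity)]
    have : (q:ℝ)^ε = (q:ℝ)^(ε/2) * (q:ℝ)^(ε/2) := by rw [← Real.rpow_add (by linarith)]; congr 1; ring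
    rw [this]; ring
  · have := Real.one_le_rpow hq1 (half_pos hε).le
    nlinarith [Nat.cast_nonneg (α := ℝ) N]
  · nlinarith
  · intro x hx
    refine (hcr q χ (ne_one_of_prim h1 hp) x (hre x (hsub hx)) ?_).trans (by gcongr; linarith)
    have := mem_closedBall.1 (hsub hx)
    rw [dist_eq] at this
    calc ‖x‖ = ‖z0 + (x - z0)‖ := by ring_nf
      _ ≤ _ := (norm_add_le _ _).trans (by linarith)
  · intro x hx hxS
    by_contra hcon
    exact hxS ⟨hsub hx, fun hA => hcon (hA q _ χ hp h1)⟩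

end Subharm

section GLHall
open Complex Filter Topology Metric

lemma omega_bound (K ε : ℝ) (hK : 1 ≤ K) (hε : 0 < ε) : ∃ C : ℝ, 1 ≤ C ∧ ∀ N : ℕ, N ≠ 0 →
    ∏ _p ∈ N.primeFactors, K ≤ C * (N:ℝ)^ε := by
  obtain ⟨P, hP⟩ := exists_nat_ge (K^(1/ε))
  refine ⟨K^(P+1), one_le_pow₀ hK, fun N hN => ?_⟩
  have h1 : ∀ p ∈ N.primeFactors, K ≤ (if p < P + 1 then K else 1) * (p:ℝ)^ε := by
    intro p hp
    have hp1 : (1:ℝ) ≤ p := by exact_mod_cast (Nat.prime_of_mem_primeFactors hp).one_le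
    split_ifs with h
    · have := Real.one_le_rpow hp1 hε.le
      nlinarith
    · have : K^(1/ε) ≤ p := hP.trans (by exact_mod_cast (by omega))
      have h2 := Real.rpow_le_rpow (by positivity) this hε.le
      rwa [← Real.rpow_mul (by linarith), one_div, inv_mul_cancel₀ hε.ne', Real.rpow_one, ← one_mul ((p:ℝ)^ε)] at h2
  refine (Finset.prod_le_prod (fun _ _ => by linarith) h1).trans ?_
  rw [Finset.prod_mul_distrib]
  refine mul_le_mul ?_ ?_ (Finset.prod_nonneg fun _ _ => by positivity) (by positivity)
  · rw [← Finset.prod_filter, Finset.prod_const]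
    refine pow_le_pow_right₀ hK ?_
    refine (Finset.card_le_card (t := Finset.range (P+1)) ?_).trans (by simp)
    intro p hp; simp at hp ⊢; exact hp.2
  · rw [Real.finsetProd_rpow _ _ (fun _ _ => by positivity)]
    refine Real.rpow_le_rpow (by positivity) ?_ hε.le
    rw [← Nat.cast_prod]
    exact_mod_cast Nat.le_of_dvd (Nat.pos_of_ne_zero hN) (Nat.prod_primeFactors_dvd N)

/-- `(z-1) L(z,χ)` as an entire function. -/
noncomputable def Lk {N : ℕ} [NeZero N] (χ : DirichletCharacter ℂ N) : ℂ → ℂ := by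
  classical
  exact Function.update (fun z => (z - 1) * χ.LFunction z) 1 (if χ = 1 then ∏ p ∈ N.primeFactors, (1 - (p : ℂ)⁻¹) else 0)

lemma Lk_ne {N : ℕ} [NeZero N] (χ : DirichletCharacter ℂ N) {z : ℂ} (hz : z ≠ 1) : Lk χ z = (z - 1) * χ.LFunction z := by
  simp [Lk, hz]

lemma Lk_ne_one {N : ℕ} [NeZero N] {χ : DirichletCharacter ℂ N} (hχ : χ ≠ 1) (z : ℂ) : Lk χ z = (z - 1) * χ.LFunction z := by
  by_cases hz : z = 1
  · simp [Lk, hz, hχ]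
  · exact Lk_ne χ hz

lemma differentiable_Lk {N : ℕ} [NeZero N] (χ : DirichletCharacter ℂ N) : Differentiable ℂ (Lk χ) := by
  by_cases h : χ = 1
  · subst h
    have : Lk (1 : DirichletCharacter ℂ N) = DirichletCharacter.LFunctionTrivChar₁ N := by
      simp [Lk, DirichletCharacter.LFunctionTrivChar₁, DirichletCharacter.LFunctionTrivChar]
    rw [this]; exact DirichletCharacter.differentiable_LFunctionTrivChar₁ N
  · have : Lk χ = fun z => (z - 1) * χ.LFunction z := funext (Lk_ne_one h)
    rw [this]; exact (differentiable_id.sub_const 1).mul (DirichletCharacter.differentiable_LFunction h)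

lemma two_pow_local {N : ℕ} {M : ℕ} (χ : DirichletCharacter ℂ M) {z : ℂ} (hz : 0 < z.re) :
    ‖∏ p ∈ N.primeFactors, (1 - χ p * (p:ℂ) ^ (-z))‖ ≤ ∏ _p ∈ N.primeFactors, (2:ℝ) := by
  rw [norm_prod]
  refine Finset.prod_le_prod (fun _ _ => norm_nonneg _) fun p hp => ?_
  have hp0 := (Nat.prime_of_mem_primeFactors hp).pos
  have h1 : ‖χ p * (p:ℂ)^(-z)‖ ≤ 1 := by
    rw [norm_mul, norm_natCast_cpow_of_pos hp0]
    refine mul_le_one₀ (χ.norm_le_one _) (by positivity) (Real.rpow_le_one_of_one_le_of_nonpos (by exact_mod_cast hp0) (by simp; linarith))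
  calc _ ≤ ‖(1:ℂ)‖ + ‖χ p * (p:ℂ)^(-z)‖ := norm_sub_le _ _
    _ ≤ 2 := by rw [norm_one]; linarith

lemma zeta_loc (z0 : ℂ) : ∃ r > 0, ∃ C : ℝ, 0 < C ∧ ∀ z ∈ ball z0 r, ‖(z-1) * riemannZeta z‖ ≤ C := by
  have hc := (differentiable_Lk (1 : DirichletCharacter ℂ 1)).continuous.norm.continuousAt (x := z0)
  obtain ⟨r, hr, h⟩ := Metric.eventually_nhds_iff_ball.1 (hc.eventually (gt_mem_nhds (lt_add_one _)))
  refine ⟨r, hr, ‖Lk (1 : DirichletCharacter ℂ 1) z0‖ + 1, by positivity, fun z hz => ?_⟩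
  by_cases h1 : z = 1
  · rw [h1]; simp; positivity
  · have := h z hz
    rw [Lk_ne _ h1, DirichletCharacter.LFunction_modOne_eq] at this
    exact this.le

lemma glh_all_loc (hG : GLH) (z0 : ℂ) (hz0 : 1/2 < z0.re) (ε : ℝ) (hε : 0 < ε) : ∃ r : ℝ, 0 < r ∧ ∃ C : ℝ, 0 < C ∧
    ∀ (N : ℕ) [NeZero N] (χ : DirichletCharacter ℂ N), ∀ z ∈ ball z0 r, ‖Lk χ z‖ ≤ C * (N:ℝ)^ε := by
  obtain ⟨r1, hr1, C1, hC1, h1⟩ := glh_unif hG z0 hz0 (ε/2) (half_pos hε)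
  obtain ⟨r2, hr2, C2, hC2, h2⟩ := zeta_loc z0
  obtain ⟨C3, hC3, h3⟩ := omega_bound 2 (ε/2) (by norm_num) (half_pos hε)
  obtain ⟨C4, hC4⟩ : ∃ C4, C4 = (‖z0‖ + r1 + 1) * C1 + C2 + 1 := ⟨_, rfl⟩
  have hC40 : 1 ≤ C4 := by rw [hC4]; have : 0 ≤ (‖z0‖ + r1 + 1) * C1 := by positivity
                           linarith
  refine ⟨min (min r1 r2) (z0.re/2), by simp [hr1, hr2]; linarith, C4 * C3, by positivity, fun N _ χ z hz => ?_⟩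
  have hN1 : (1:ℝ) ≤ N := by exact_mod_cast NeZero.pos N
  have hzr1 : z ∈ ball z0 r1 := ball_subset_ball ((min_le_left _ _).trans (min_le_left _ _)) hz
  have hzr2 : z ∈ ball z0 r2 := ball_subset_ball ((min_le_left _ _).trans (min_le_right _ _)) hz
  have hzre : 0 < z.re := by
    have h := (mem_ball.1 hz).trans_le (min_le_right _ _)
    rw [dist_eq] at h
    have := (abs_le.1 (abs_re_le_norm (z - z0))).1
    simp at this; linarith
  have hp : (N:ℝ)^ε = (N:ℝ)^(ε/2) * (N:ℝ)^(ε/2) := by rw [← Real.rpow_add (by linarith)]; congr 1; ring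
  by_cases hz1 : z = 1
  · have hN2 := Real.one_le_rpow hN1 hε.le
    have : ‖Lk χ z‖ ≤ 1 := by
      rw [hz1]
      simp only [Lk, Function.update_self]
      split_ifs
      · rw [norm_prod]
        refine Finset.prod_le_one (fun _ _ => norm_nonneg _) fun p hp => ?_
        have hp0 : (1:ℝ) ≤ p := by exact_mod_cast (Nat.prime_of_mem_primeFactors hp).one_le
        have : (1 - (p:ℂ)⁻¹) = ((1 - (p:ℝ)⁻¹ : ℝ) : ℂ) := by push_cast; rfl
        rw [this, norm_real, Real.norm_eq_abs, abs_le]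
        have := inv_le_one_of_one_le₀ hp0
        have h0 : 0 ≤ (p:ℝ)⁻¹ := by positivity
        constructor <;> linarith
      · simp
    calc ‖Lk χ z‖ ≤ 1 * 1 * 1 := by simpa using this
      _ ≤ _ := by gcongr
  rw [Lk_ne χ hz1]
  haveI : NeZero χ.conductor := ⟨fun h => NeZero.ne N (Nat.eq_zero_of_zero_dvd (h ▸ χ.conductor_dvd_level))⟩
  have hcl := DirichletCharacter.LFunction_changeLevel χ.conductor_dvd_level χ.primitiveCharacter (s := z) (Or.inr hz1)
  rw [DirichletCharacter.changeLevel_primitiveCharacter] at hcl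
  rw [hcl, ← mul_assoc, norm_mul]
  have hcond : (χ.conductor:ℝ)^(ε/2) ≤ (N:ℝ)^(ε/2) := by
    refine Real.rpow_le_rpow (by positivity) ?_ (half_pos hε).le
    exact_mod_cast Nat.le_of_dvd (NeZero.pos N) χ.conductor_dvd_level
  have hN2 := Real.one_le_rpow hN1 (half_pos hε).le
  have hA : ‖(z - 1) * χ.primitiveCharacter.LFunction z‖ ≤ C4 * (N:ℝ)^(ε/2) := by
    by_cases hc : χ.conductor = 1
    · have : ∀ (M : ℕ) [NeZero M] (ψ : DirichletCharacter ℂ M), M = 1 → ψ.LFunction = riemannZeta := by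
        rintro M _ ψ rfl; exact DirichletCharacter.LFunction_modOne_eq
      rw [this _ _ hc]
      refine (h2 z hzr2).trans ?_
      have : C2 ≤ C4 := by rw [hC4]; have : 0 ≤ (‖z0‖ + r1 + 1) * C1 := by positivity
                           linarith
      nlinarith
    · have h := h1 _ _ χ.primitiveCharacter_isPrimitive hc z hzr1
      rw [norm_mul]
      have hz2 : ‖z - 1‖ ≤ ‖z0‖ + r1 + 1 := by
        have := mem_ball.1 hzr1
        rw [dist_eq] at this
        calc ‖z - 1‖ = ‖(z - z0) + z0 - 1‖ := by ring_nf
          _ ≤ ‖z - z0‖ + ‖z0‖ + ‖(1:ℂ)‖ := (norm_sub_le _ _).trans (by gcongr; exact norm_add_le _ _)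
          _ ≤ _ := by rw [norm_one]; linarith
      calc _ ≤ (‖z0‖ + r1 + 1) * (C1 * (N:ℝ)^(ε/2)) := by
            refine mul_le_mul hz2 (h.trans ?_) (norm_nonneg _) (by positivity)
            gcongr
        _ ≤ _ := by rw [hC4, ← mul_assoc]; gcongr; linarith
  calc _ ≤ (C4 * (N:ℝ)^(ε/2)) * (C3 * (N:ℝ)^(ε/2)) := by
        refine mul_le_mul hA ((two_pow_local _ hzre).trans (h3 N (NeZero.ne N))) (norm_nonneg _) (by positivity)
    _ = _ := by rw [hp]; ring

lemma glh_all (hG : GLH) {K : Set ℂ} (hK : IsCompact K) (hK2 : ∀ z ∈ K, 1/2 < z.re) (ε : ℝ) (hε : 0 < ε) : ∃ C : ℝ, 0 < C ∧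
    ∀ (N : ℕ) [NeZero N] (χ : DirichletCharacter ℂ N), ∀ z ∈ K, ‖Lk χ z‖ ≤ C * (N:ℝ)^ε := by
  refine hK.induction_on (p := fun K => ∃ C : ℝ, 0 < C ∧
    ∀ (N : ℕ) [NeZero N] (χ : DirichletCharacter ℂ N), ∀ z ∈ K, ‖Lk χ z‖ ≤ C * (N:ℝ)^ε) ⟨1, one_pos, by simp⟩ ?_ ?_ ?_
  · rintro s t hst ⟨C, hC, h⟩
    exact ⟨C, hC, fun N _ χ z hz => h N χ z (hst hz)⟩
  · rintro s t ⟨C, hC, h⟩ ⟨C', hC', h'⟩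
    refine ⟨C + C', by positivity, fun N _ χ z hz => ?_⟩
    have : 0 ≤ (N:ℝ)^ε := by positivity
    rcases hz with hz | hz
    · nlinarith [h N χ z hz]
    · nlinarith [h' N χ z hz]
  · intro z hz
    obtain ⟨r, hr, C, hC, h⟩ := glh_all_loc hG z (hK2 z hz) ε hε
    exact ⟨ball z r, mem_nhdsWithin_of_mem_nhds (ball_mem_nhds z hr), C, hC, h⟩

end GLHall

section GoodSec
open Complex Filter Topology Metric MeasureTheory

variable {E : Type*} [NormedAddCommGroup E] [NormedSpace ℂ E]
  {E' : Type*} [NormedAddCommGroup E'] [NormedSpace ℂ E']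

/-- continuous and holomorphic along entire curves -/
def Good (U : Set E) (f : E → ℂ) : Prop :=
  ContinuousOn f U ∧ ∀ φ : ℂ → E, Differentiable ℂ φ → DifferentiableOn ℂ (fun t => f (φ t)) (φ ⁻¹' U)

lemma Good.of_diff {U : Set E} {f : E → ℂ} (h : DifferentiableOn ℂ f U) : Good U f :=
  ⟨h.continuousOn, fun φ hφ => h.comp hφ.differentiableOn (fun _ h => h)⟩

lemma Good.diff {U : Set ℂ} {f : ℂ → ℂ} (h : Good U f) : DifferentiableOn ℂ f U :=
  h.2 id differentiable_id

lemma Good.mono {U V : Set E} {f : E → ℂ} (h : Good U f) (hV : V ⊆ U) : Good V f :=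
  ⟨h.1.mono hV, fun φ hφ => (h.2 φ hφ).mono (Set.preimage_mono hV)⟩

lemma Good.congr {U : Set E} {f g : E → ℂ} (h : Good U f) (hg : ∀ x ∈ U, g x = f x) : Good U g :=
  ⟨h.1.congr hg, fun φ hφ => (h.2 φ hφ).congr fun t ht => hg _ ht⟩

lemma Good.mul {U : Set E} {f g : E → ℂ} (h : Good U f) (hg : Good U g) : Good U (fun x => f x * g x) :=
  ⟨h.1.mul hg.1, fun φ hφ => (h.2 φ hφ).mul (hg.2 φ hφ)⟩

lemma Good.add {U : Set E} {f g : E → ℂ} (h : Good U f) (hg : Good U g) : Good U (fun x => f x + g x) :=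
  ⟨h.1.add hg.1, fun φ hφ => (h.2 φ hφ).add (hg.2 φ hφ)⟩

lemma Good.sub {U : Set E} {f g : E → ℂ} (h : Good U f) (hg : Good U g) : Good U (fun x => f x - g x) :=
  ⟨h.1.sub hg.1, fun φ hφ => (h.2 φ hφ).sub (hg.2 φ hφ)⟩

lemma Good.div {U : Set E} {f g : E → ℂ} (h : Good U f) (hg : Good U g) (h0 : ∀ x ∈ U, g x ≠ 0) :
    Good U (fun x => f x / g x) :=
  ⟨h.1.div hg.1 h0, fun φ hφ => (h.2 φ hφ).div (hg.2 φ hφ) fun t ht => h0 _ ht⟩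

lemma good_const (U : Set E) (c : ℂ) : Good U (fun _ => c) := Good.of_diff (differentiableOn_const c)

lemma Good.prod {ι : Type*} {U : Set E} {f : ι → E → ℂ} (s : Finset ι) (h : ∀ i ∈ s, Good U (f i)) :
    Good U (fun x => ∏ i ∈ s, f i x) := by
  classical
  induction s using Finset.induction_on with
  | empty => simpa using good_const U 1
  | insert a s ha ih =>
    simp only [Finset.prod_insert ha]
    exact (h a (by simp)).mul (ih fun i hi => h i (by simp [hi]))

lemma Good.sum {ι : Type*} {U : Set E} {f : ι → E → ℂ} (s : Finset ι) (h : ∀ i ∈ s, Good U (f i)) :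
    Good U (fun x => ∑ i ∈ s, f i x) := by
  classical
  induction s using Finset.induction_on with
  | empty => simpa using good_const U 0
  | insert a s ha ih =>
    simp only [Finset.sum_insert ha]
    exact (h a (by simp)).add (ih fun i hi => h i (by simp [hi]))

lemma Good.comp {U : Set E} {f : E → ℂ} (h : Good U f) {ψ : E' → E} (hψ : Differentiable ℂ ψ)
    {V : Set E'} (hV : Set.MapsTo ψ V U) : Good V (fun x => f (ψ x)) :=
  ⟨h.1.comp hψ.continuous.continuousOn hV,
    fun φ hφ => (h.2 _ (hψ.comp hφ)).mono fun _ ht => hV ht⟩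

lemma Good.local {U : Set E} {f : E → ℂ} (h : ∀ x ∈ U, ∃ V, IsOpen V ∧ x ∈ V ∧ Good (V ∩ U) f) : Good U f := by
  constructor
  · intro x hx
    obtain ⟨V, hV, hxV, hg⟩ := h x hx
    exact ((hg.1 x ⟨hxV, hx⟩).mono_of_mem_nhdsWithin
      (by rw [Set.inter_comm]; exact inter_mem_nhdsWithin _ (hV.mem_nhds hxV)))
  · intro φ hφ t ht
    obtain ⟨V, hV, hxV, hg⟩ := h _ ht
    refine ((hg.2 φ hφ) t ⟨hxV, ht⟩).mono_of_mem_nhdsWithin ?_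
    rw [Set.preimage_inter, Set.inter_comm]
    exact inter_mem_nhdsWithin _ ((hV.preimage hφ.continuous).mem_nhds hxV)

/-- gluing -/
lemma Good.union {U V : Set E} {f g : E → ℂ} [DecidablePred (· ∈ U)] (hU : IsOpen U) (hV : IsOpen V) (hf : Good U f) (hg : Good V g)
    (h : ∀ x ∈ U ∩ V, f x = g x) : Good (U ∪ V) (fun x => if x ∈ U then f x else g x) := by
  refine Good.local fun x hx => ?_
  by_cases hxU : x ∈ U
  · refine ⟨U, hU, hxU, (hf.mono Set.inter_subset_left).congr ?_⟩
    rintro y ⟨hy, -⟩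
    simp [hy]
  · refine ⟨V, hV, hx.resolve_left hxU, (hg.mono Set.inter_subset_left).congr ?_⟩
    rintro y ⟨hy, -⟩
    split_ifs with h1
    · exact h y ⟨h1, hy⟩
    · rfl

lemma Good.lim {ι : Type*} {l : Filter ι} [l.NeBot] {U : Set E} (hU : IsOpen U) {F : ι → E → ℂ} {f : E → ℂ}
    (h : TendstoLocallyUniformlyOn F f l U) (hF : ∀ i, Good U (F i)) : Good U f := by
  refine ⟨h.continuousOn (Eventually.frequently (Eventually.of_forall fun i => (hF i).1)), fun φ hφ => ?_⟩
  have := h.comp (t := φ ⁻¹' U) φ (fun _ h => h) hφ.continuous.continuousOn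
  exact this.differentiableOn (Eventually.of_forall fun i => (hF i).2 φ hφ) (hU.preimage hφ.continuous)

lemma Good.tsum {ι : Type*} {U : Set E} (hU : IsOpen U) {f : ι → E → ℂ} (hf : ∀ i, Good U (f i))
    (hb : ∀ x ∈ U, ∃ V, IsOpen V ∧ x ∈ V ∧ ∃ b : ι → ℝ, Summable b ∧ ∀ i, ∀ y ∈ V ∩ U, ‖f i y‖ ≤ b i) :
    Good U (fun x => ∑' i, f i x) := by
  refine Good.local fun x hx => ?_
  obtain ⟨V, hV, hxV, b, hbs, hb⟩ := hb x hx
  refine ⟨V, hV, hxV, Good.lim (hV.inter hU)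
    (tendstoUniformlyOn_tsum hbs hb).tendstoLocallyUniformlyOn fun i => ?_⟩
  exact Good.sum _ fun j _ => (hf j).mono Set.inter_subset_right

lemma Good.tprod [ProperSpace E] {ι : Type*} {U : Set E} (hU : IsOpen U) {f : ι → E → ℂ} (hf : ∀ i, Good U (f i))
    (hb : ∀ x ∈ U, ∃ V, IsOpen V ∧ x ∈ V ∧ ∃ b : ι → ℝ, Summable b ∧ ∀ i, ∀ y ∈ V ∩ U, ‖f i y‖ ≤ b i) :
    Good U (fun x => ∏' i, (1 + f i x)) := by
  refine Good.local fun x hx => ?_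
  obtain ⟨V, hV, hxV, b, hbs, hb⟩ := hb x hx
  obtain ⟨r, hr, hball⟩ := Metric.nhds_basis_closedBall.mem_iff.1 ((hV.inter hU).mem_nhds ⟨hxV, hx⟩)
  refine ⟨ball x r, isOpen_ball, mem_ball_self hr, Good.mono ?_ Set.inter_subset_left⟩
  have := Summable.hasProdUniformlyOn_one_add (isCompact_closedBall x r) hbs
    (Eventually.of_forall fun i y hy => hb i y (hball hy))
    (fun i => (hf i).1.mono fun y hy => (hball hy).2)
  have h2 := (hasProdUniformlyOn_iff_tendstoUniformlyOn.1 this).mono ball_subset_closedBall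
  refine Good.lim isOpen_ball h2.tendstoLocallyUniformlyOn fun i => Good.prod _ fun j _ => ?_
  exact (good_const _ 1).add ((hf j).mono fun y hy => (hball (ball_subset_closedBall hy)).2)

lemma diff_param_integral {a b : ℝ} (hab : a ≤ b) {V : Set ℂ} (hV : IsOpen V) {g : ℝ → ℂ → ℂ}
    (hc : ContinuousOn (fun p : ℝ × ℂ => g p.1 p.2) (Set.Icc a b ×ˢ V))
    (hd : ∀ t ∈ Set.Icc a b, DifferentiableOn ℂ (g t) V) :
    DifferentiableOn ℂ (fun x => ∫ t in a..b, g t x) V := by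
  intro x hx
  obtain ⟨r, hr, hball⟩ := Metric.nhds_basis_closedBall.mem_iff.1 (hV.mem_nhds hx)
  have hK : IsCompact (Set.Icc a b ×ˢ closedBall x r) := isCompact_Icc.prod (isCompact_closedBall x r)
  obtain ⟨C, hC⟩ := hK.exists_bound_of_continuousOn (hc.mono (Set.prod_mono le_rfl hball))
  have hct : ∀ y ∈ V, ContinuousOn (fun t => g t y) (Set.Icc a b) := fun y hy =>
    hc.comp (f := fun t => (t, y)) (by fun_prop) fun t ht => ⟨ht, hy⟩
  have hm : ∀ y ∈ V, AEStronglyMeasurable (fun t => g t y) (volume.restrict (Set.uIoc a b)) := fun y hy => by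
    rw [Set.uIoc_of_le hab]
    exact ((hct y hy).mono Set.Ioc_subset_Icc_self).aestronglyMeasurable measurableSet_Ioc
  have hi : ∀ y ∈ V, IntervalIntegrable (fun t => g t y) volume a b := fun y hy =>
    ContinuousOn.intervalIntegrable (by rw [Set.uIcc_of_le hab]; exact hct y hy)
  have hda : ∀ t ∈ Set.uIoc a b, ∀ y ∈ V, HasDerivAt (g t) (deriv (g t) y) y := fun t ht y hy =>
    ((hd t (Set.Ioc_subset_Icc_self (by rwa [Set.uIoc_of_le hab] at ht))).differentiableAt (hV.mem_nhds hy)).hasDerivAt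
  have hsub : ball x (r/2) ⊆ V := fun y hy => hball (by
    simp only [mem_ball, mem_closedBall] at hy ⊢; linarith)
  refine (intervalIntegral.hasDerivAt_integral_of_dominated_loc_of_deriv_le (F := fun y t => g t y)
    (F' := fun y t => deriv (g t) y) (bound := fun _ => C / (r/2)) (ball_mem_nhds x (half_pos hr))
    ?_ (hi x hx) ?_ ?_ (by simp) ?_).2.differentiableAt.differentiableWithinAt
  · filter_upwards [hV.mem_nhds hx] with y hy using hm y hy
  · have hlim : Tendsto (fun n : ℕ => x + ((r / (n + 1) : ℝ) : ℂ)) atTop (𝓝[≠] x) := by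
      refine tendsto_nhdsWithin_iff.2 ⟨?_, Eventually.of_forall fun n => ?_⟩
      · have : Tendsto (fun n : ℕ => r * (1 / ((n:ℝ) + 1))) atTop (𝓝 (r * 0)) :=
          tendsto_one_div_add_atTop_nhds_zero_nat.const_mul r
        have h2 := (continuous_ofReal.tendsto _).comp this
        simpa [Function.comp_def, div_eq_mul_inv] using h2.const_add x
      · have : (r / (n + 1) : ℝ) ≠ 0 := by positivity
        simp only [Set.mem_compl_iff, Set.mem_singleton_iff, add_eq_left, ofReal_eq_zero]
        exact this
    refine aestronglyMeasurable_of_tendsto_ae atTop (f := fun n : ℕ => fun t => slope (g t) x (x + ((r / (n + 1) : ℝ) : ℂ))) ?_ ?_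
    · intro n
      simp only [slope_def_module]
      refine AEStronglyMeasurable.const_smul (𝕜 := ℂ) ((hm _ (hball ?_)).sub (hm _ hx)) _
      have hn : (1:ℝ) ≤ (n:ℝ) + 1 := by linarith [Nat.cast_nonneg (α := ℝ) n]
      simp only [mem_closedBall, dist_self_add_left, norm_real, Real.norm_eq_abs]
      rw [abs_of_pos (by positivity)]
      exact div_le_self hr.le hn
    · refine (ae_restrict_iff' measurableSet_uIoc).2 (Eventually.of_forall fun t ht => ?_)
      exact (hasDerivAt_iff_tendsto_slope.1 (hda t ht x hx)).comp hlim
  · refine Eventually.of_forall fun t ht y hy => ?_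
    have ht' : t ∈ Set.Icc a b := (Set.Ioc_subset_Icc_self (by rwa [Set.uIoc_of_le hab] at ht))
    have hyb : closedBall y (r/2) ⊆ closedBall x r := closedBall_subset_closedBall' (by
      have := mem_ball.1 hy; linarith)
    refine Complex.norm_deriv_le_of_forall_mem_sphere_norm_le (half_pos hr) ?_ fun z hz => ?_
    · exact ((hd t ht').mono (hyb.trans hball)).diffContOnCl_ball subset_rfl
    · exact hC (t, z) ⟨ht', hyb (sphere_subset_closedBall hz)⟩
  · exact Eventually.of_forall fun t ht y hy => hda t ht y (hsub hy)

lemma Good.integral [ProperSpace E] {a b : ℝ} (hab : a ≤ b) {U : Set E} (hU : IsOpen U) {g : ℝ → E → ℂ}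
    (hc : ContinuousOn (fun p : ℝ × E => g p.1 p.2) (Set.Icc a b ×ˢ U))
    (hd : ∀ t ∈ Set.Icc a b, Good U (g t)) :
    Good U (fun x => ∫ t in a..b, g t x) := by
  constructor
  · intro x hx
    obtain ⟨r, hr, hball⟩ := Metric.nhds_basis_closedBall.mem_iff.1 (hU.mem_nhds hx)
    have hK : IsCompact (Set.Icc a b ×ˢ closedBall x r) := isCompact_Icc.prod (isCompact_closedBall x r)
    obtain ⟨C, hC⟩ := hK.exists_bound_of_continuousOn (hc.mono (Set.prod_mono le_rfl hball))
    refine ContinuousAt.continuousWithinAt ?_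
    refine intervalIntegral.continuousAt_of_dominated_interval (bound := fun _ => C) ?_ ?_ (by simp) ?_
    · filter_upwards [hU.mem_nhds hx] with y hy
      rw [Set.uIoc_of_le hab]
      refine ContinuousOn.aestronglyMeasurable ?_ measurableSet_Ioc
      exact hc.comp (f := fun t => (t, y)) (by fun_prop) fun t ht => ⟨Set.Ioc_subset_Icc_self ht, hy⟩
    · filter_upwards [closedBall_mem_nhds x hr] with y hy
      refine Eventually.of_forall fun t ht => hC (t, y) ⟨Set.Ioc_subset_Icc_self (by rwa [Set.uIoc_of_le hab] at ht), hy⟩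
    · refine Eventually.of_forall fun t ht => ?_
      exact (hd t (Set.Ioc_subset_Icc_self (by rwa [Set.uIoc_of_le hab] at ht))).1.continuousAt (hU.mem_nhds hx)
  · intro φ hφ
    refine diff_param_integral hab (hU.preimage hφ.continuous) (g := fun t x => g t (φ x)) ?_ fun t ht => (hd t ht).2 φ hφ
    exact hc.comp (f := fun p : ℝ × ℂ => (p.1, φ p.2))
      (continuous_fst.prodMk (hφ.continuous.comp continuous_snd)).continuousOn fun p hp => ⟨hp.1, hp.2⟩

/-- boundary integral over a rectangle -/
noncomputable def rectI (a b Y : ℝ) (g : ℂ → ℂ) : ℂ :=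
  (∫ x in a..b, g (x + (-Y : ℝ) * I)) - (∫ x in a..b, g (x + (Y : ℝ) * I))
    + I * (∫ y in (-Y)..Y, g ((b:ℝ) + y * I)) - I * ∫ y in (-Y)..Y, g ((a:ℝ) + y * I)

lemma edge_good {P : Type*} [NormedAddCommGroup P] [NormedSpace ℂ P] [ProperSpace P]
    {a b : ℝ} (hab : a ≤ b) {D : Set P} (hD : IsOpen D) {ψ : ℂ × P → E} (hψ : Differentiable ℂ ψ)
    {w : P → ℂ} (hw : Differentiable ℂ w) {U : Set E} {f : E → ℂ} (hf : Good U f) {e : ℝ → ℂ} (he : Continuous e)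
    (hU : ∀ x ∈ D, ∀ t ∈ Set.Icc a b, ψ (e t, x) ∈ U ∧ e t ≠ w x) :
    Good D (fun x => ∫ t in a..b, f (ψ (e t, x)) / (e t - w x)) := by
  refine Good.integral hab hD ?_ fun t ht => ?_
  · refine ContinuousOn.div (hf.1.comp (f := fun p : ℝ × P => ψ (e p.1, p.2)) ?_ ?_) ?_ ?_
    · exact (hψ.continuous.comp ((he.comp continuous_fst).prodMk continuous_snd)).continuousOn
    · exact fun p hp => (hU p.2 hp.2 p.1 hp.1).1
    · exact ((he.comp continuous_fst).sub (hw.continuous.comp continuous_snd)).continuousOn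
    · exact fun p hp => sub_ne_zero.2 (hU p.2 hp.2 p.1 hp.1).2
  · refine Good.div (hf.comp (ψ := fun x => ψ (e t, x)) ?_ fun x hx => (hU x hx t ht).1) ?_
      fun x hx => sub_ne_zero.2 (hU x hx t ht).2
    · exact hψ.comp ((differentiable_const _).prodMk differentiable_id)
    · exact Good.of_diff ((differentiable_const _).sub hw).differentiableOn

lemma rectI_good {P : Type*} [NormedAddCommGroup P] [NormedSpace ℂ P] [ProperSpace P]
    {a b Y : ℝ} (hab : a < b) (hY : 0 < Y) {D : Set P} (hD : IsOpen D) {ψ : ℂ × P → E} (hψ : Differentiable ℂ ψ)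
    {w : P → ℂ} (hw : Differentiable ℂ w) {U : Set E} {f : E → ℂ} (hf : Good U f)
    (hwD : ∀ x ∈ D, a < (w x).re ∧ (w x).re < b ∧ |(w x).im| < Y)
    (hU : ∀ x ∈ D, ∀ z : ℂ, a ≤ z.re → z.re ≤ b → |z.im| ≤ Y → (z.re = a ∨ z.re = b ∨ |z.im| = Y) → ψ (z, x) ∈ U) :
    Good D (fun x => rectI a b Y (fun z => f (ψ (z, x)) / (z - w x))) := by
  have hY' : -Y ≤ Y := by linarith
  have hu : ∀ x ∈ D, ∀ z : ℂ, a ≤ z.re → z.re ≤ b → |z.im| ≤ Y → (z.re = a ∨ z.re = b ∨ |z.im| = Y) →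
      ψ (z, x) ∈ U ∧ z ≠ w x := by
    intro x hx z h1 h2 h3 h4
    refine ⟨hU x hx z h1 h2 h3 h4, ?_⟩
    rintro rfl
    obtain ⟨h5, h6, h7⟩ := hwD x hx
    rcases h4 with h | h | h <;> linarith
  unfold rectI
  refine Good.sub (Good.add (Good.sub ?_ ?_) ((good_const _ I).mul ?_)) ((good_const _ I).mul ?_)
  · exact edge_good hab.le hD hψ hw hf (e := fun t => t + (-Y : ℝ) * I) (by fun_prop) fun x hx t ht =>
      hu x hx _ (by simpa using ht.1) (by simpa using ht.2) (by simp [abs_of_pos hY]) (by simp [abs_of_pos hY])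
  · exact edge_good hab.le hD hψ hw hf (e := fun t => t + (Y : ℝ) * I) (by fun_prop) fun x hx t ht =>
      hu x hx _ (by simpa using ht.1) (by simpa using ht.2) (by simp [abs_of_pos hY]) (by simp [abs_of_pos hY])
  · exact edge_good hY' hD hψ hw hf (e := fun t => (b:ℝ) + t * I) (by fun_prop) fun x hx t ht =>
      hu x hx _ (by simpa using hab.le) (by simp) (by simpa [abs_le] using ht) (by simp)
  · exact edge_good hY' hD hψ hw hf (e := fun t => (a:ℝ) + t * I) (by fun_prop) fun x hx t ht =>
      hu x hx _ (by simp) (by simpa using hab.le) (by simpa [abs_le] using ht) (by simp)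

lemma rectI_inv_ne {a b Y : ℝ} {w : ℂ} (h1 : a < w.re) (h2 : w.re < b) (h3 : |w.im| < Y) :
    rectI a b Y (fun z => 1 / (z - w)) ≠ 0 := by
  obtain ⟨h4, h5⟩ := abs_lt.1 h3
  have hY : -Y < Y := by linarith
  have hab : a < b := by linarith
  have key : ∀ (c d : ℝ), c < d → ∀ (e : ℝ → ℂ) (k : ℂ), Continuous e → (∀ t, e t ≠ w) →
      (∀ t, 0 < (k * (1 / (e t - w))).im) → 0 < (k * ∫ t in c..d, 1 / (e t - w)).im := by
    intro c d hcd e k he hne hp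
    have hcont : Continuous fun t => k * (1 / (e t - w)) :=
      continuous_const.mul (continuous_const.div (he.sub continuous_const) fun t => sub_ne_zero.2 (hne t))
    rw [← intervalIntegral.integral_const_mul]
    have := imCLM.intervalIntegral_comp_comm (hcont.intervalIntegrable (μ := volume) c d)
    simp only [imCLM_apply] at this
    rw [← this]
    exact intervalIntegral.intervalIntegral_pos_of_pos_on
      ((continuous_im.comp hcont).intervalIntegrable c d) (fun t _ => hp t) hcd
  have k1 := key a b hab (fun t => t + (-Y : ℝ) * I) 1 (by fun_prop)
    (fun t h => by have := congrArg Complex.im h; simp at this; linarith) (fun t => by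
      have hne : ((t:ℂ) + (-Y : ℝ) * I - w) ≠ 0 := fun h => by have := congrArg Complex.im h; simp at this; linarith
      rw [one_mul, one_div, inv_im]
      refine div_pos ?_ (normSq_pos.2 hne)
      simp; linarith)
  have k2 := key a b hab (fun t => t + (Y : ℝ) * I) (-1) (by fun_prop)
    (fun t h => by have := congrArg Complex.im h; simp at this; linarith) (fun t => by
      have hne : ((t:ℂ) + (Y : ℝ) * I - w) ≠ 0 := fun h => by have := congrArg Complex.im h; simp at this; linarith
      rw [neg_one_mul, neg_im, one_div, inv_im, neg_div, neg_neg]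
      refine div_pos ?_ (normSq_pos.2 hne)
      simp; linarith)
  have k3 := key (-Y) Y hY (fun t => (b:ℝ) + t * I) I (by fun_prop)
    (fun t h => by have := congrArg Complex.re h; simp at this; linarith) (fun t => by
      have hne : ((b:ℂ) + t * I - w) ≠ 0 := fun h => by have := congrArg Complex.re h; simp at this; linarith
      rw [I_mul_im, one_div, inv_re]
      refine div_pos ?_ (normSq_pos.2 hne)
      simp; linarith)
  have k4 := key (-Y) Y hY (fun t => (a:ℝ) + t * I) (-I) (by fun_prop)
    (fun t h => by have := congrArg Complex.re h; simp at this; linarith) (fun t => by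
      have hne : ((a:ℂ) + t * I - w) ≠ 0 := fun h => by have := congrArg Complex.re h; simp at this; linarith
      rw [neg_mul, neg_im, I_mul_im, one_div, inv_re, ← neg_div]
      refine div_pos ?_ (normSq_pos.2 hne)
      simp; linarith)
  intro h0
  have := congrArg Complex.im h0
  unfold rectI at this
  simp only [one_mul, neg_one_mul, neg_mul, neg_im] at k1 k2 k3 k4
  simp only [sub_im, add_im, zero_im] at this
  linarith

/-- normalised Cauchy integral over a rectangle -/
noncomputable def rectF {P : Type*} (a b Y : ℝ) (f : E → ℂ) (ψ : ℂ × P → E) (w : P → ℂ) (x : P) : ℂ :=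
  rectI a b Y (fun z => f (ψ (z, x)) / (z - w x)) / rectI a b Y (fun z => 1 / (z - w x))

lemma rectF_good {P : Type*} [NormedAddCommGroup P] [NormedSpace ℂ P] [ProperSpace P]
    {a b Y : ℝ} (hab : a < b) (hY : 0 < Y) {D : Set P} (hD : IsOpen D) {ψ : ℂ × P → E} (hψ : Differentiable ℂ ψ)
    {w : P → ℂ} (hw : Differentiable ℂ w) {U : Set E} {f : E → ℂ} (hf : Good U f)
    (hwD : ∀ x ∈ D, a < (w x).re ∧ (w x).re < b ∧ |(w x).im| < Y)
    (hU : ∀ x ∈ D, ∀ z : ℂ, a ≤ z.re → z.re ≤ b → |z.im| ≤ Y → (z.re = a ∨ z.re = b ∨ |z.im| = Y) → ψ (z, x) ∈ U) :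
    Good D (rectF a b Y f ψ w) := by
  refine Good.div (rectI_good hab hY hD hψ hw hf hwD hU) ?_ fun x hx => ?_
  · have := rectI_good hab hY hD hψ hw (f := fun _ => (1:ℂ)) (good_const (Set.univ : Set E) 1) hwD (fun _ _ _ _ _ _ _ => Set.mem_univ _)
    exact this
  · obtain ⟨h1, h2, h3⟩ := hwD x hx
    exact rectI_inv_ne h1 h2 h3

lemma rectI_cauchy {a b Y : ℝ} {w : ℂ} (h1 : a < w.re) (h2 : w.re < b) (h3 : |w.im| < Y) {V : Set ℂ} (hV : IsOpen V)
    {g : ℂ → ℂ} (hg : DifferentiableOn ℂ g V) (hr : ∀ z : ℂ, a ≤ z.re → z.re ≤ b → |z.im| ≤ Y → z ∈ V) :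
    rectI a b Y (fun z => g z / (z - w)) = g w * rectI a b Y (fun z => 1 / (z - w)) := by
  obtain ⟨h4, h5⟩ := abs_lt.1 h3
  have hY : -Y ≤ Y := by linarith
  have hab : a ≤ b := by linarith
  have hY0 : 0 < Y := by linarith
  have hwV : w ∈ V := hr w h1.le h2.le h3.le
  have hd : DifferentiableOn ℂ (dslope g w) V := (Complex.differentiableOn_dslope (hV.mem_nhds hwV)).2 hg
  have h0 := Complex.integral_boundary_rect_eq_zero_of_differentiableOn (dslope g w) (⟨a, -Y⟩ : ℂ) ⟨b, Y⟩ (hd.mono (by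
    rw [Set.uIcc_of_le hab, Set.uIcc_of_le hY]
    intro z hz
    rw [mem_reProdIm] at hz
    exact hr z hz.1.1 hz.1.2 (abs_le.2 hz.2)))
  simp only [smul_eq_mul] at h0
  have edge : ∀ (c d : ℝ), c ≤ d → ∀ (e : ℝ → ℂ), Continuous e → (∀ t, e t ≠ w) → (∀ t ∈ Set.Icc c d, e t ∈ V) →
      ∫ t in c..d, g (e t) / (e t - w) = (∫ t in c..d, dslope g w (e t)) + g w * ∫ t in c..d, 1 / (e t - w) := by
    intro c d hcd e he hne hm
    rw [← intervalIntegral.integral_const_mul, ← intervalIntegral.integral_add]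
    · refine intervalIntegral.integral_congr fun t _ => ?_
      rw [dslope_of_ne _ (hne t), slope_def_field]
      ring
    · exact ContinuousOn.intervalIntegrable (hd.continuousOn.comp he.continuousOn (by rw [Set.uIcc_of_le hcd]; exact hm))
    · exact (continuous_const.mul (continuous_const.div (he.sub continuous_const) fun t => sub_ne_zero.2 (hne t))).intervalIntegrable c d
  have e1 := edge a b hab (fun t => t + (-Y : ℝ) * I) (by fun_prop)
    (fun t h => by have := congrArg Complex.im h; simp at this; linarith)
    (fun t ht => hr _ (by simpa using ht.1) (by simpa using ht.2) (by simp [abs_of_pos hY0]))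
  have e2 := edge a b hab (fun t => t + (Y : ℝ) * I) (by fun_prop)
    (fun t h => by have := congrArg Complex.im h; simp at this; linarith)
    (fun t ht => hr _ (by simpa using ht.1) (by simpa using ht.2) (by simp [abs_of_pos hY0]))
  have e3 := edge (-Y) Y hY (fun t => (b:ℝ) + t * I) (by fun_prop)
    (fun t h => by have := congrArg Complex.re h; simp at this; linarith)
    (fun t ht => hr _ (by simpa using hab) (by simp) (by simpa [abs_le] using ht))
  have e4 := edge (-Y) Y hY (fun t => (a:ℝ) + t * I) (by fun_prop)
    (fun t h => by have := congrArg Complex.re h; simp at this; linarith)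
    (fun t ht => hr _ (by simp) (by simpa using hab) (by simpa [abs_le] using ht))
  unfold rectI
  rw [e1, e2, e3, e4]
  linear_combination h0

lemma rectF_eq {P : Type*} {a b Y : ℝ} {f : E → ℂ} {ψ : ℂ × P → E} {w : P → ℂ} {x : P} {U : Set E} (hUo : IsOpen U)
    (hf : Good U f) (hψ : Differentiable ℂ fun z => ψ (z, x))
    (h1 : a < (w x).re) (h2 : (w x).re < b) (h3 : |(w x).im| < Y)
    (hU : ∀ z : ℂ, a ≤ z.re → z.re ≤ b → |z.im| ≤ Y → ψ (z, x) ∈ U) :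
    rectF a b Y f ψ w x = f (ψ (w x, x)) := by
  unfold rectF
  rw [rectI_cauchy h1 h2 h3 (hUo.preimage hψ.continuous) (hf.2 _ hψ) hU,
    mul_div_assoc, div_self (rectI_inv_ne h1 h2 h3), mul_one]
end GoodSec

section EPsec
open Complex Filter Topology Metric MeasureTheory

/-- Euler product data on squarefree numbers -/
noncomputable def sqf (h : ℕ → ℂ) (n : ℕ) : ℂ := by
  classical exact if Squarefree n then ∏ p ∈ n.primeFactors, h p else 0

lemma sqf_of {h : ℕ → ℂ} {n : ℕ} (hn : Squarefree n) : sqf h n = ∏ p ∈ n.primeFactors, h p := by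
  simp [sqf, hn]

lemma sqf_not {h : ℕ → ℂ} {n : ℕ} (hn : ¬ Squarefree n) : sqf h n = 0 := by
  simp [sqf, hn]

lemma sqf_EP (h : ℕ → ℂ) (hs : Summable fun n => ‖sqf h n‖) :
    HasProd (fun p : Nat.Primes => 1 + h p) (∑' n, sqf h n) := by
  have := EulerProduct.eulerProduct_hasProd (f := sqf h) (by rw [sqf_of squarefree_one]; simp) ?_ hs (sqf_not not_squarefree_zero)
  · convert this using 2 with p
    rw [tsum_eq_sum (s := Finset.range 2)]
    · rw [Finset.sum_range_succ, Finset.sum_range_one, pow_zero, pow_one, sqf_of squarefree_one,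
        sqf_of p.2.squarefree, p.2.primeFactors]
      simp
    · intro e he
      refine sqf_not fun h => ?_
      have he2 : 2 ≤ e := by simp at he; omega
      exact p.2.one_lt.ne' (Nat.isUnit_iff.1 (h p (by rw [← sq]; exact pow_dvd_pow _ he2)))
  · intro m n hmn
    by_cases h1 : Squarefree m
    · by_cases h2 : Squarefree n
      · rw [sqf_of h1, sqf_of h2, sqf_of ((Nat.squarefree_mul hmn).2 ⟨h1, h2⟩), hmn.primeFactors_mul,
          Finset.prod_union hmn.disjoint_primeFactors]
      · rw [sqf_not h2, sqf_not (fun h => h2 (h.of_mul_right)), mul_zero]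
    · rw [sqf_not h1, sqf_not (fun h => h1 (h.of_mul_left)), zero_mul]

lemma prod_pf_mul (φ : ℕ → ℂ) (h1 : φ 1 = 1) (hm : ∀ a b, φ (a * b) = φ a * φ b) {n : ℕ} (hn : Squarefree n) :
    ∏ p ∈ n.primeFactors, φ p = φ n := by
  let f : ℕ →* ℂ := ⟨⟨φ, h1⟩, hm⟩
  have := map_prod f (fun p => p) n.primeFactors
  rw [Nat.prod_primeFactors_of_squarefree hn] at this
  exact this.symm

lemma prod_pf_cpow (z : ℂ) {n : ℕ} (hn : Squarefree n) :
    ∏ p ∈ n.primeFactors, (p:ℂ)^z = (n:ℂ)^z := by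
  refine prod_pf_mul (fun n => (n:ℂ)^z) (by simp) (fun a b => ?_) hn
  push_cast
  exact Complex.natCast_mul_natCast_cpow a b z

lemma prod_pf_char {N : ℕ} (χ : DirichletCharacter ℂ N) {n : ℕ} (hn : Squarefree n) :
    ∏ p ∈ n.primeFactors, χ p = χ n :=
  prod_pf_mul (fun n => χ n) (by simp) (fun a b => by push_cast; exact map_mul _ _ _) hn

noncomputable def gu (u : ℂ) (n : ℕ) : ℂ := ∏ p ∈ n.primeFactors, (1 - (p:ℂ)^(-2*u))⁻¹

lemma py_norm {p : ℕ} (hp : 0 < p) (u : ℂ) : ‖(p:ℂ)^(-2*u)‖ = (p:ℝ)^(-2*u.re) := by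
  rw [norm_natCast_cpow_of_pos hp]; simp

lemma py_le {p : ℕ} (hp : 2 ≤ p) {η : ℝ} (hη : 0 < η) {u : ℂ} (hu : η ≤ u.re) :
    ‖(p:ℂ)^(-2*u)‖ ≤ (2:ℝ)^(-2*η) := by
  rw [py_norm (by omega)]
  have h1 : (p:ℝ)^(-2*u.re) ≤ (2:ℝ)^(-2*u.re) :=
    Real.rpow_le_rpow_of_nonpos (by norm_num) (by exact_mod_cast hp) (by linarith)
  exact h1.trans (Real.rpow_le_rpow_of_exponent_le (by norm_num) (by linarith))

lemma two_rho {η : ℝ} (hη : 0 < η) : (2:ℝ)^(-2*η) < 1 :=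
  Real.rpow_lt_one_of_one_lt_of_neg (by norm_num) (by linarith)

lemma inv_bd {ρ : ℝ} (hρ : ρ < 1) {y : ℂ} (hy : ‖y‖ ≤ ρ) : ‖(1 - y)⁻¹‖ ≤ (1 - ρ)⁻¹ := by
  rw [norm_inv]
  refine inv_anti₀ (by linarith) ?_
  have := norm_sub_norm_le (1:ℂ) y
  rw [norm_one] at this
  linarith

lemma gu_bound (η ε : ℝ) (hη : 0 < η) (hε : 0 < ε) : ∃ C : ℝ, 1 ≤ C ∧ ∀ u : ℂ, η ≤ u.re → ∀ n : ℕ, n ≠ 0 →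
    ‖gu u n‖ ≤ C * (n:ℝ)^ε := by
  have h1 := two_rho hη
  have h0 : (0:ℝ) < (2:ℝ)^(-2*η) := by positivity
  obtain ⟨C, hC, h⟩ := omega_bound (1 - (2:ℝ)^(-2*η))⁻¹ ε ((one_le_inv₀ (by linarith)).2 (by linarith)) hε
  refine ⟨C, hC, fun u hu n hn => le_trans ?_ (h n hn)⟩
  rw [gu, norm_prod]
  exact Finset.prod_le_prod (fun _ _ => norm_nonneg _) fun p hp =>
    inv_bd h1 (py_le (Nat.prime_of_mem_primeFactors hp).two_le hη hu)

lemma prod_one_sub_bd (t : ℕ → ℂ) (X : ℝ) (hX0 : 0 ≤ X) (hX : X ≤ 1) (m : ℕ) (ht : ∀ j < m, ‖t j‖ ≤ X) :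
    ‖∏ j ∈ Finset.range m, (1 - t j) - 1 + ∑ j ∈ Finset.range m, t j‖ ≤ 3^m * X^2 ∧
    ‖∑ j ∈ Finset.range m, t j‖ ≤ m * X := by
  induction m with
  | zero => simp; positivity
  | succ m ih =>
    obtain ⟨h1, h2⟩ := ih fun j hj => ht j (by omega)
    have h3 := ht m (by omega)
    rw [Finset.prod_range_succ, Finset.sum_range_succ]
    set S := ∑ j ∈ Finset.range m, t j
    set Q := ∏ j ∈ Finset.range m, (1 - t j)
    have hm : (m:ℝ) ≤ 3^m := by exact_mod_cast (Nat.lt_pow_self (by norm_num : 1 < 3)).le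
    constructor
    · have : Q * (1 - t m) - 1 + (S + t m) = (Q - 1 + S) - (Q - 1 + S) * t m + S * t m := by ring
      rw [this]
      refine (norm_add_le _ _).trans ((add_le_add (norm_sub_le _ _) le_rfl).trans ?_)
      rw [norm_mul, norm_mul]
      have e1 : ‖Q - 1 + S‖ * ‖t m‖ ≤ 3^m * X^2 * 1 := mul_le_mul h1 (h3.trans hX) (norm_nonneg _) (by positivity)
      have e2 : ‖S‖ * ‖t m‖ ≤ m * X * X := mul_le_mul h2 h3 (norm_nonneg _) (by positivity)
      have e3 : (m:ℝ) * X * X ≤ 3^m * X^2 := by nlinarith [sq_nonneg X]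
      rw [pow_succ]
      linarith
    · push_cast
      have := norm_add_le S (t m)
      linarith

noncomputable def RA (J : ℕ) (t x y : ℂ) : ℂ :=
  (1 + t * x / (1 - y)) * ∏ j ∈ Finset.range (J+1), (1 - t * x * y^j) - 1

lemma RA_bound (J : ℕ) (ρ : ℝ) (hρ0 : 0 ≤ ρ) (hρ : ρ < 1) : ∃ C : ℝ, 0 < C ∧ ∀ t x y : ℂ, ‖t‖ ≤ 1 → ‖x‖ ≤ 1 → ‖y‖ ≤ ρ →
    ‖RA J t x y‖ ≤ C * (‖x‖^2 + ‖x‖ * ‖y‖^(J+1)) := by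
  set K := (1 - ρ)⁻¹ with hK
  have hKp : 0 < K := inv_pos.2 (by linarith)
  set m : ℕ := J + 1 with hm
  refine ⟨(m:ℝ)^2 + 3^m * (1 + m + K) + K * (1 + m), by positivity, fun t x y ht hx hy => ?_⟩
  set X := ‖x‖
  have hX0 : 0 ≤ X := norm_nonneg _
  have hy1 : y ≠ 1 := fun h => by rw [h, norm_one] at hy; linarith
  obtain ⟨h1, h2⟩ := prod_one_sub_bd (fun j => t * x * y^j) X hX0 hx m (fun j _ => by
    rw [norm_mul, norm_mul, norm_pow]
    have : ‖y‖^j ≤ 1 := pow_le_one₀ (norm_nonneg _) (hy.trans hρ.le)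
    have h3 : ‖t‖ * ‖x‖ ≤ 1 * X := by gcongr
    have : ‖t‖ * ‖x‖ * ‖y‖^j ≤ (1 * X) * 1 := mul_le_mul h3 this (by positivity) (by positivity)
    linarith)
  unfold RA
  set S := ∑ j ∈ Finset.range m, t * x * y^j with hS
  set Q := ∏ j ∈ Finset.range m, (1 - t * x * y^j)
  set r := t * x * y^m * (1 - y)⁻¹ with hr
  have hyy : (1 - y) ≠ 0 := sub_ne_zero.2 hy1.symm
  have hsum : t * x / (1 - y) = S + r := by
    rw [hS, ← Finset.mul_sum, hr]
    have := geom_sum_mul y m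
    have h5 : ∑ i ∈ Finset.range m, y^i = (1 - y^m) * (1-y)⁻¹ := by
      field_simp; linear_combination -this
    rw [h5]; field_simp; ring
  have hrb : ‖r‖ ≤ X * ‖y‖^m * K := by
    rw [hr, norm_mul, norm_mul, norm_mul, norm_pow]
    have h3 : ‖t‖ * ‖x‖ ≤ X := by nlinarith [norm_nonneg t]
    have := inv_bd hρ hy
    gcongr
  have hrb2 : ‖r‖ ≤ K := by
    refine hrb.trans ?_
    have : ‖y‖^m ≤ 1 := pow_le_one₀ (norm_nonneg _) (hy.trans hρ.le)
    have : X * ‖y‖^m ≤ 1 := mul_le_one₀ hx (by positivity) this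
    nlinarith
  have hS1 : ‖S‖ ≤ m := h2.trans (by nlinarith [Nat.cast_nonneg (α := ℝ) m])
  have e : (1 + t * x / (1 - y)) * Q - 1 = -(S*S) + (Q - 1 + S) * (1 + S + r) + r * (1 - S) := by
    rw [hsum]; ring
  rw [e]
  have t1 : ‖-(S*S)‖ ≤ (m:ℝ)^2 * X^2 := by
    rw [norm_neg, norm_mul]
    calc _ ≤ (m * X) * (m * X) := mul_le_mul h2 h2 (norm_nonneg _) (by positivity)
      _ = _ := by ring
  have t2 : ‖(Q - 1 + S) * (1 + S + r)‖ ≤ 3^m * X^2 * (1 + m + K) := by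
    rw [norm_mul]
    refine mul_le_mul h1 ?_ (norm_nonneg _) (by positivity)
    have := norm_add₃_le (a := (1:ℂ)) (b := S) (c := r)
    rw [norm_one] at this
    linarith
  have t3 : ‖r * (1 - S)‖ ≤ X * ‖y‖^m * K * (1 + m) := by
    rw [norm_mul]
    refine mul_le_mul hrb ?_ (norm_nonneg _) (by positivity)
    have := norm_sub_le (1:ℂ) S
    rw [norm_one] at this
    linarith
  have t4 := norm_add₃_le (a := -(S*S)) (b := (Q - 1 + S) * (1 + S + r)) (c := r * (1 - S))
  refine t4.trans ((add_le_add (add_le_add t1 t2) t3).trans ?_)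
  have p1 : 0 ≤ X^2 := by positivity
  have p2 : 0 ≤ X * ‖y‖^m := by positivity
  have q1 : 0 ≤ (m:ℝ)^2 * (X * ‖y‖^m) := by positivity
  have q2 : 0 ≤ 3^m * (1 + m + K) * (X * ‖y‖^m) := by positivity
  have q3 : 0 ≤ K * (1 + m) * X^2 := by positivity
  nlinarith

/-- region with margin -/
def Wr (J : ℕ) (η : ℝ) : Set (ℂ × ℂ) :=
  {q | 1 + η < q.1.re ∧ η < q.2.re ∧ 3/2 + η < (q.1 + 2 * (J + 1) * q.2).re}

lemma isOpen_Wr (J : ℕ) (η : ℝ) : IsOpen (Wr J η) := by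
  refine IsOpen.and ?_ (IsOpen.and ?_ ?_) <;> exact isOpen_lt (by fun_prop) (by fun_prop)

noncomputable def RAp (J : ℕ) {N : ℕ} (χ : DirichletCharacter ℂ N) (q : ℂ × ℂ) (p : ℕ) : ℂ :=
  RA J (χ p) ((p:ℂ)^(1/2 - q.1)) ((p:ℂ)^(-2*q.2))

lemma RAp_bound (J : ℕ) (η : ℝ) (hη : 0 < η) : ∃ C : ℝ, 0 < C ∧ ∀ (N : ℕ) (χ : DirichletCharacter ℂ N),
    ∀ q ∈ Wr J η, ∀ p : ℕ, 2 ≤ p → ‖RAp J χ q p‖ ≤ C * (p:ℝ)^(-1-η) := by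
  obtain ⟨C, hC, h⟩ := RA_bound J ((2:ℝ)^(-2*η)) (by positivity) (two_rho hη)
  refine ⟨C * 2, by positivity, fun N χ q hq p hp => ?_⟩
  obtain ⟨q1, q2, q3⟩ := hq
  have hp0 : 0 < p := by omega
  have hp1 : (1:ℝ) ≤ p := by exact_mod_cast hp0
  have hx : ‖(p:ℂ)^(1/2 - q.1)‖ = (p:ℝ)^(1/2 - q.1.re) := by
    rw [norm_natCast_cpow_of_pos hp0]; congr 1; simp
  refine (h (χ p) _ _ (DirichletCharacter.norm_le_one _ _) ?_ (py_le hp hη q2.le)).trans ?_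
  · rw [hx]; exact Real.rpow_le_one_of_one_le_of_nonpos hp1 (by linarith)
  · rw [mul_assoc]
    refine mul_le_mul_of_nonneg_left ?_ hC.le
    rw [hx, py_norm hp0, two_mul]
    refine add_le_add ?_ ?_
    · rw [← Real.rpow_natCast, ← Real.rpow_mul (by positivity)]
      exact Real.rpow_le_rpow_of_exponent_le hp1 (by push_cast; linarith)
    · rw [← Real.rpow_natCast, ← Real.rpow_mul (by positivity), ← Real.rpow_add (by positivity)]
      refine Real.rpow_le_rpow_of_exponent_le hp1 ?_
      simp at q3
      push_cast; linarith

lemma primes_summable {η : ℝ} (hη : 0 < η) (C : ℝ) : Summable fun p : Nat.Primes => C * (p:ℝ)^(-1-η) :=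
  ((Real.summable_nat_rpow.2 (by linarith)).comp_injective Subtype.val_injective).mul_left C

noncomputable def Mst (J : ℕ) {N : ℕ} [NeZero N] (χ : DirichletCharacter ℂ N) (q : ℂ × ℂ) : ℂ :=
  (∏ j ∈ Finset.range (J+1), Lk χ (q.1 - 1/2 + 2 * j * q.2)) * ∏' p : Nat.Primes, (1 + RAp J χ q p)

lemma cpow_one_sub_ne {p : ℕ} (hp : 2 ≤ p) {u : ℂ} (hu : 0 < u.re) : 1 - (p:ℂ)^(-2*u) ≠ 0 := by
  intro h
  have h1 := py_le hp hu le_rfl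
  rw [← sub_eq_zero.1 h, norm_one] at h1
  linarith [two_rho hu]

lemma RAp_good (J : ℕ) {η : ℝ} (hη : 0 < η) {N : ℕ} (χ : DirichletCharacter ℂ N) (p : Nat.Primes) :
    Good (Wr J η) (fun q => RAp J χ q p) := by
  have hp0 : ((p:ℕ):ℂ) ≠ 0 := by exact_mod_cast p.2.ne_zero
  have gx : Good (Wr J η) (fun q => ((p:ℕ):ℂ)^(1/2 - q.1)) := Good.of_diff (by
    refine DifferentiableOn.const_cpow ?_ (Or.inl hp0); fun_prop)
  have gy : Good (Wr J η) (fun q => ((p:ℕ):ℂ)^(-2 * q.2)) := Good.of_diff (by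
    refine DifferentiableOn.const_cpow ?_ (Or.inl hp0); fun_prop)
  have gyj : ∀ j : ℕ, Good (Wr J η) (fun q => (((p:ℕ):ℂ)^(-2 * q.2))^j) := fun j => by
    induction j with
    | zero => simpa using good_const _ 1
    | succ j ih => simp only [pow_succ]; exact ih.mul gy
  unfold RAp RA
  refine Good.sub (Good.mul ((good_const _ 1).add (Good.div ((good_const _ _).mul gx) ((good_const _ 1).sub gy) ?_)) ?_) (good_const _ 1)
  · intro q hq
    exact cpow_one_sub_ne p.2.two_le (hη.trans hq.2.1)
  · exact Good.prod _ fun j _ => (good_const _ 1).sub (((good_const _ _).mul gx).mul (gyj j))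

lemma Mst_good (J : ℕ) {η : ℝ} (hη : 0 < η) {N : ℕ} [NeZero N] (χ : DirichletCharacter ℂ N) :
    Good (Wr J η) (Mst J χ) := by
  refine Good.mul (Good.prod _ fun j _ => Good.of_diff ?_) (Good.tprod (isOpen_Wr J η) (RAp_good J hη χ) ?_)
  · exact (Differentiable.comp (g := Lk χ) (f := fun q : ℂ × ℂ => q.1 - 1/2 + 2 * j * q.2) (differentiable_Lk χ) (by fun_prop)).differentiableOn
  · obtain ⟨C, hC, h⟩ := RAp_bound J η hη
    exact fun q hq => ⟨Wr J η, isOpen_Wr J η, hq, _, primes_summable hη C, fun p q hq => h N χ q hq.1 p p.2.two_le⟩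

lemma Mst_bound (hG : GLH) (J : ℕ) (η T ε : ℝ) (hη : 0 < η) (hε : 0 < ε) : ∃ C : ℝ, 0 < C ∧
    ∀ (N : ℕ) [NeZero N] (χ : DirichletCharacter ℂ N), ∀ q ∈ Wr J η, ‖q‖ ≤ T → ‖Mst J χ q‖ ≤ C * (N:ℝ)^ε := by
  obtain ⟨C, hC, h⟩ := RAp_bound J η hη
  set R : ℝ := |T| + 1 + 2 * (J+1) * |T|
  have hK : IsCompact {z : ℂ | 1/2 + η ≤ z.re ∧ ‖z‖ ≤ R} := by
    have hc : IsClosed {z : ℂ | 1/2 + η ≤ z.re ∧ ‖z‖ ≤ R} := by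
      refine IsClosed.and ?_ ?_ <;> exact isClosed_le (by fun_prop) (by fun_prop)
    refine (isCompact_closedBall (0:ℂ) R).of_isClosed_subset hc ?_
    intro z hz
    simpa using hz.2
  obtain ⟨C2, hC2, h2⟩ := glh_all hG hK (fun z hz => by have := hz.1; linarith) (ε / (J+1)) (by positivity)
  set S := ∑' p : Nat.Primes, C * (p:ℝ)^(-1-η)
  refine ⟨C2^(J+1) * Real.exp S, by positivity, fun N _ χ q hq hqT => ?_⟩
  have hTT : ‖q‖ ≤ |T| := hqT.trans (le_abs_self T)
  rw [Mst, norm_mul, norm_prod]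
  have hsum := primes_summable hη C
  have hb : ∀ p : Nat.Primes, ‖RAp J χ q p‖ ≤ C * (p:ℝ)^(-1-η) := fun p => h N χ q hq p p.2.two_le
  have b1 : ∏ j ∈ Finset.range (J+1), ‖Lk χ (q.1 - 1/2 + 2 * j * q.2)‖ ≤ (C2 * (N:ℝ)^(ε/(J+1)))^(J+1) := by
    refine (Finset.prod_le_prod (fun _ _ => norm_nonneg _) fun j hj => h2 N χ _ ⟨?_, ?_⟩).trans (by simp)
    · obtain ⟨q1, q2, -⟩ := hq
      have : 0 ≤ (j:ℝ) * q.2.re := by have := hη.trans q2; positivity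
      simp
      linarith
    · have hj' : (j:ℝ) ≤ J + 1 := by exact_mod_cast (Finset.mem_range.1 hj).le
      have n1 : ‖q.1‖ ≤ |T| := (norm_fst_le q).trans hTT
      have n2 : ‖q.2‖ ≤ |T| := (norm_snd_le q).trans hTT
      refine (norm_add_le _ _).trans (add_le_add ((norm_sub_le _ _).trans (add_le_add n1 (by norm_num))) ?_)
      rw [norm_mul, norm_mul]
      simp only [norm_ofNat, norm_natCast]
      gcongr
  have b2 : ‖∏' p : Nat.Primes, (1 + RAp J χ q p)‖ ≤ Real.exp S := by
    have hm : Multipliable fun p : Nat.Primes => 1 + RAp J χ q p :=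
      multipliable_one_add_of_summable (hsum.of_nonneg_of_le (fun _ => norm_nonneg _) hb)
    refine le_of_tendsto ((continuous_norm.tendsto _).comp hm.hasProd) (Eventually.of_forall fun s => ?_)
    simp only [Function.comp, norm_prod]
    have : ∀ p ∈ s, ‖1 + RAp J χ q p‖ ≤ Real.exp (C * (p:ℝ)^(-1-η)) := fun p _ => by
      have h1 := norm_add_le (1:ℂ) (RAp J χ q p)
      rw [norm_one] at h1
      have h3 := Real.add_one_le_exp (C * (p:ℝ)^(-1-η))
      linarith [hb p]
    refine (Finset.prod_le_prod (fun _ _ => norm_nonneg _) this).trans ?_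
    rw [← Real.exp_sum]
    exact Real.exp_le_exp.2 (hsum.sum_le_tsum s (fun p _ => by positivity))
  refine (mul_le_mul b1 b2 (norm_nonneg _) (by positivity)).trans (le_of_eq ?_)
  rw [mul_pow, ← Real.rpow_mul_natCast (by positivity)]
  have : ε / (J+1) * ((J+1:ℕ):ℝ) = ε := by push_cast; field_simp
  rw [this]; ring

noncomputable def Mter {N : ℕ} (χ : DirichletCharacter ℂ N) (q : ℂ × ℂ) (n : ℕ) : ℂ := by
  classical exact if Squarefree n then χ n * (n:ℂ)^(1/2 - q.1) * gu q.2 n else 0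

lemma Mter_eq {N : ℕ} (χ : DirichletCharacter ℂ N) (q : ℂ × ℂ) (n : ℕ) :
    Mter χ q n = sqf (fun p => χ p * (p:ℂ)^(1/2 - q.1) / (1 - (p:ℂ)^(-2*q.2))) n := by
  by_cases hn : Squarefree n
  · simp only [Mter, hn, if_true]
    rw [sqf_of hn]
    simp only [div_eq_mul_inv, Finset.prod_mul_distrib]
    rw [prod_pf_char χ hn, ← div_eq_mul_inv, prod_pf_cpow _ hn]; rfl
  · simp [Mter, hn, sqf_not hn]

lemma Mter_bound {N : ℕ} (χ : DirichletCharacter ℂ N) (q : ℂ × ℂ) {C ε : ℝ} (hC : 0 ≤ C) (n : ℕ)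
    (h : n ≠ 0 → ‖gu q.2 n‖ ≤ C * (n:ℝ)^ε) :
    ‖Mter χ q n‖ ≤ C * (n:ℝ)^(1/2 - q.1.re + ε) := by
  by_cases hn : Squarefree n
  · simp only [Mter, hn, if_true]
    have hn0 : n ≠ 0 := hn.ne_zero
    have hpos : 0 < n := by omega
    rw [norm_mul, norm_mul, norm_natCast_cpow_of_pos hpos, Real.rpow_add (by positivity)]
    have := DirichletCharacter.norm_le_one χ (n : ZMod N)
    have e : (1/2 - q.1 : ℂ).re = 1/2 - q.1.re := by simp
    rw [e]
    calc _ ≤ 1 * (n:ℝ)^(1/2 - q.1.re) * (C * (n:ℝ)^ε) := by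
          gcongr
          exact h hn0
      _ = _ := by ring
  · simp only [Mter, hn, if_false, norm_zero]
    positivity

lemma Mter_summable {N : ℕ} (χ : DirichletCharacter ℂ N) (q : ℂ × ℂ) (h1 : 3/2 < q.1.re) (h2 : 0 < q.2.re) :
    Summable fun n => ‖Mter χ q n‖ := by
  obtain ⟨C, hC, h⟩ := gu_bound q.2.re ((q.1.re - 3/2)/2) h2 (by linarith)
  refine Summable.of_nonneg_of_le (fun _ => norm_nonneg _) (fun n => Mter_bound χ q (by linarith) n (h q.2 le_rfl n)) ?_
  exact (Real.summable_nat_rpow.2 (by linarith)).mul_left C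

lemma Mst_eq (J : ℕ) {η : ℝ} (hη : 0 < η) {N : ℕ} [NeZero N] (χ : DirichletCharacter ℂ N) (q : ℂ × ℂ)
    (hq : q ∈ Wr J η) (h1 : 3/2 < q.1.re) :
    Mst J χ q = (∏ j ∈ Finset.range (J+1), (q.1 + 2 * j * q.2 - 3/2)) * ∑' n, Mter χ q n := by
  have hu : 0 < q.2.re := hη.trans hq.2.1
  have hre : ∀ j : ℕ, 1 < (q.1 - 1/2 + 2 * j * q.2).re := fun j => by
    have : 0 ≤ (j:ℝ) * q.2.re := by positivity
    simp
    linarith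
  have hprod := sqf_EP (fun p => χ p * (p:ℂ)^(1/2 - q.1) / (1 - (p:ℂ)^(-2*q.2)))
    (by simpa only [← Mter_eq] using Mter_summable χ q h1 hu)
  simp only [← Mter_eq] at hprod
  obtain ⟨C, hC, hb⟩ := RAp_bound J η hη
  have hm : Multipliable fun p : Nat.Primes => 1 + RAp J χ q p :=
    multipliable_one_add_of_summable ((primes_summable hη C).of_nonneg_of_le (fun _ => norm_nonneg _)
      (fun p => hb N χ q hq p p.2.two_le))
  have hL := hasProd_prod (s := Finset.range (J+1)) (fun j _ => DirichletCharacter.LSeries_eulerProduct_hasProd χ (hre j))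
  have hLR := hL.mul hm.hasProd
  have heq : ∀ p : Nat.Primes, (∏ j ∈ Finset.range (J+1), (1 - χ p * (p:ℂ)^(-(q.1 - 1/2 + 2 * j * q.2)))⁻¹) * (1 + RAp J χ q p)
      = 1 + χ p * (p:ℂ)^(1/2 - q.1) / (1 - (p:ℂ)^(-2*q.2)) := by
    intro p
    have hp0 : ((p:ℕ):ℂ) ≠ 0 := by exact_mod_cast p.2.ne_zero
    have hx : ∀ j : ℕ, ((p:ℕ):ℂ)^(-(q.1 - 1/2 + 2 * j * q.2)) = (p:ℂ)^(1/2 - q.1) * ((p:ℂ)^(-2*q.2))^j := by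
      intro j
      rw [← Complex.cpow_nat_mul, ← Complex.cpow_add _ _ hp0]
      congr 1; ring
    have hne : ∀ j : ℕ, 1 - χ p * (p:ℂ)^(1/2 - q.1) * ((p:ℂ)^(-2*q.2))^j ≠ 0 := by
      intro j h0
      have h3 : ‖χ p * ((p:ℕ):ℂ)^(-(q.1 - 1/2 + 2 * j * q.2))‖ = 1 := by
        rw [hx j, ← mul_assoc, ← sub_eq_zero.1 h0, norm_one]
      rw [norm_mul, norm_natCast_cpow_of_pos p.2.pos] at h3
      have h4 := DirichletCharacter.norm_le_one χ ((p:ℕ) : ZMod N)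
      have h5 : ((p:ℕ):ℝ)^((-(q.1 - 1/2 + 2 * j * q.2)).re) < 1 :=
        Real.rpow_lt_one_of_one_lt_of_neg (by exact_mod_cast p.2.one_lt) (by rw [neg_re]; linarith [hre j])
      have h6 : (0:ℝ) ≤ ((p:ℕ):ℝ)^((-(q.1 - 1/2 + 2 * j * q.2)).re) := by positivity
      have h7 : ‖χ ((p:ℕ) : ZMod N)‖ * ((p:ℕ):ℝ)^((-(q.1 - 1/2 + 2 * j * q.2)).re) ≤ 1 * ((p:ℕ):ℝ)^((-(q.1 - 1/2 + 2 * j * q.2)).re) :=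
        mul_le_mul_of_nonneg_right h4 h6
      linarith
    simp only [RAp, RA, hx, Finset.prod_inv_distrib]
    rw [add_sub_cancel]
    simp only [← mul_assoc]
    have hne2 := Finset.prod_ne_zero_iff.2 (fun j (_ : j ∈ Finset.range (J+1)) => hne j)
    exact (mul_right_inj' hne2).1 (by rw [mul_comm (_⁻¹), mul_assoc, ← mul_assoc, ← mul_assoc]; field_simp)
  rw [funext heq] at hLR
  have := hLR.unique hprod
  rw [← this, Mst, ← mul_assoc]
  congr 1
  rw [← Finset.prod_mul_distrib]
  refine Finset.prod_congr rfl fun j _ => ?_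
  rw [Lk_ne χ (fun h => by have := hre j; rw [h] at this; simp at this), DirichletCharacter.LFunction_eq_LSeries χ (hre j)]
  congr 1; ring
end EPsec

section Radsec
open Complex Filter Topology Metric MeasureTheory

noncomputable def ra (η : ℝ) (a : ℕ) : ℝ := (a:ℝ)^(-η) * ∏ p ∈ a.primeFactors, ((p:ℝ)^2)⁻¹

lemma ra_nonneg (η : ℝ) (a : ℕ) : 0 ≤ ra η a := by unfold ra; positivity

lemma ra_summable {η : ℝ} (hη : 0 < η) : Summable (ra η) := by
  have h1 : ra η 1 = 1 := by simp [ra]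
  have hmul : ∀ {m n : ℕ}, Nat.Coprime m n → ra η (m * n) = ra η m * ra η n := by
    intro m n hmn
    unfold ra
    rw [hmn.primeFactors_mul, Finset.prod_union hmn.disjoint_primeFactors, Nat.cast_mul,
      Real.mul_rpow (by positivity) (by positivity)]
    ring
  set ρ : ℝ := (2:ℝ)^(-η)
  have hρ0 : 0 < ρ := by positivity
  have hρ1 : ρ < 1 := Real.rpow_lt_one_of_one_lt_of_neg (by norm_num) (by linarith)
  have hpe : ∀ p : ℕ, p.Prime → ∀ e : ℕ, ra η (p^(e+1)) ≤ ((p:ℝ)^2)⁻¹ * ρ^e := by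
    intro p hp e
    unfold ra
    rw [Nat.primeFactors_prime_pow (by omega) hp, Finset.prod_singleton, mul_comm]
    refine mul_le_mul_of_nonneg_left ?_ (by positivity)
    have hp1 : (2:ℝ) ≤ p := by exact_mod_cast hp.two_le
    rw [Nat.cast_pow, ← Real.rpow_natCast, ← Real.rpow_mul (by positivity), mul_comm, Real.rpow_mul (by positivity),
      Real.rpow_natCast]
    have hx : (p:ℝ)^(-η) ≤ ρ := Real.rpow_le_rpow_of_nonpos (by norm_num) hp1 (by linarith)
    refine (pow_le_pow_left₀ (by positivity) hx _).trans (pow_le_pow_of_le_one hρ0.le hρ1.le (by omega))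
  have hgeo := summable_geometric_of_lt_one hρ0.le hρ1
  have hsum : ∀ {p : ℕ}, p.Prime → Summable (fun e : ℕ => ‖ra η (p^e)‖) := by
    intro p hp
    rw [← summable_nat_add_iff 1]
    refine Summable.of_nonneg_of_le (fun _ => norm_nonneg _) (fun e => ?_) (hgeo.mul_left ((p:ℝ)^2)⁻¹)
    rw [Real.norm_of_nonneg (ra_nonneg _ _)]
    exact hpe p hp e
  set K := (1 - ρ)⁻¹
  have hK : 0 < K := inv_pos.2 (by linarith)
  have hloc : ∀ p : ℕ, p.Prime → ∑' e : ℕ, ra η (p^e) ≤ Real.exp (K * ((p:ℝ)^2)⁻¹) := by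
    intro p hp
    have hs : Summable (fun e : ℕ => ra η (p^e)) := (hsum hp).of_norm
    rw [hs.tsum_eq_zero_add, pow_zero, h1]
    have h2 : ∑' e : ℕ, ra η (p^(e+1)) ≤ ∑' e : ℕ, ((p:ℝ)^2)⁻¹ * ρ^e :=
      ((summable_nat_add_iff 1).2 hs).tsum_le_tsum (hpe p hp) (hgeo.mul_left _)
    rw [tsum_mul_left, tsum_geometric_of_lt_one hρ0.le hρ1] at h2
    have := Real.add_one_le_exp (K * ((p:ℝ)^2)⁻¹)
    linarith
  have hsq : Summable fun n : ℕ => K * ((n:ℝ)^2)⁻¹ := (Real.summable_nat_pow_inv.2 (by norm_num)).mul_left K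
  refine summable_of_sum_range_le (c := Real.exp (∑' n : ℕ, K * ((n:ℝ)^2)⁻¹)) (ra_nonneg η) fun N => ?_
  obtain ⟨s1, s2⟩ := EulerProduct.summable_and_hasSum_smoothNumbers_prod_primesBelow_tsum h1 hmul hsum N
  have hind : HasSum (Set.indicator N.smoothNumbers (ra η)) (∏ p ∈ N.primesBelow, ∑' e : ℕ, ra η (p^e)) :=
    hasSum_subtype_iff_indicator.1 s2
  calc ∑ n ∈ Finset.range N, ra η n ≤ ∑ n ∈ Finset.range N, Set.indicator N.smoothNumbers (ra η) n := by
        refine Finset.sum_le_sum fun n hn => ?_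
        rcases Nat.eq_zero_or_pos n with rfl | h0
        · have : ra η 0 = 0 := by simp [ra, hη.ne']
          rw [this]
          exact Set.indicator_nonneg (fun n _ => ra_nonneg η n) _
        · rw [Set.indicator_of_mem (Nat.mem_smoothNumbers_of_lt h0 (Finset.mem_range.1 hn))]
    _ ≤ ∏ p ∈ N.primesBelow, ∑' e : ℕ, ra η (p^e) :=
        sum_le_hasSum _ (fun n _ => Set.indicator_nonneg (fun n _ => ra_nonneg η n) _) hind
    _ ≤ ∏ p ∈ N.primesBelow, Real.exp (K * ((p:ℝ)^2)⁻¹) :=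
        Finset.prod_le_prod (fun p _ => tsum_nonneg fun e => ra_nonneg _ _)
          fun p hp => hloc p (Nat.prime_of_mem_primesBelow hp)
    _ ≤ _ := by
        rw [← Real.exp_sum]
        exact Real.exp_le_exp.2 (hsq.sum_le_tsum _ fun n _ => by positivity)

/-- Liouville function -/
noncomputable def lam (a : ℕ) : ℂ := (-1)^(ArithmeticFunction.cardFactors a)
noncomputable def radp (s : ℂ) (a : ℕ) : ℂ := ∏ p ∈ a.primeFactors, (p:ℂ)^(-(2*s))
noncomputable def gs (s : ℂ) (a : ℕ) : ℂ := ∏ p ∈ a.primeFactors, (1 - (p:ℂ)^(-(2*s)))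
noncomputable def muS (n : ℕ) : ℂ := by classical exact if Squarefree n then 1 else 0
noncomputable def cf (s u : ℂ) (a : ℕ) : ℂ := if Odd a then lam a * (a:ℂ)^(-u) * radp s a else 0

lemma norm_lam (a : ℕ) : ‖lam a‖ = 1 := by simp [lam]
lemma norm_muS (a : ℕ) : ‖muS a‖ ≤ 1 := by unfold muS; split_ifs <;> simp
lemma muS_zero : muS 0 = 0 := by simp [muS]

lemma radp_le (s : ℂ) (hs : 1 ≤ s.re) (a : ℕ) : ‖radp s a‖ ≤ ∏ p ∈ a.primeFactors, ((p:ℝ)^2)⁻¹ := by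
  rw [radp, norm_prod]
  refine Finset.prod_le_prod (fun _ _ => norm_nonneg _) fun p hp => ?_
  have hp := Nat.prime_of_mem_primeFactors hp
  rw [norm_natCast_cpow_of_pos hp.pos, ← Real.rpow_natCast, ← Real.rpow_neg (by positivity)]
  refine Real.rpow_le_rpow_of_exponent_le (by exact_mod_cast hp.one_le) ?_
  simp; linarith

lemma cf_bound {η : ℝ} (hη : 0 < η) {s u : ℂ} (hs : 1 ≤ s.re) (hu : η ≤ u.re) (a : ℕ) : ‖cf s u a‖ ≤ ra η a := by
  unfold cf
  split_ifs with h
  · have ha : 0 < a := h.pos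
    have ha1 : (1:ℝ) ≤ a := by exact_mod_cast ha
    rw [norm_mul, norm_mul, norm_lam, one_mul, norm_natCast_cpow_of_pos ha, ra, neg_re]
    refine mul_le_mul ?_ (radp_le s hs a) (norm_nonneg _) (by positivity)
    exact Real.rpow_le_rpow_of_exponent_le ha1 (by linarith)
  · simpa using ra_nonneg η a
end Radsec

section Idsec
open Complex Filter Topology Metric MeasureTheory

lemma muS_sqf (φ : ℕ → ℂ) (h : ℕ → ℂ) (hh : ∀ n, Squarefree n → φ n = ∏ p ∈ n.primeFactors, h p) (n : ℕ) :
    muS n * φ n = sqf h n := by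
  by_cases hn : Squarefree n
  · simp [muS, hn, sqf_of hn, hh n hn]
  · simp [muS, hn, sqf_not hn]

lemma xnorm {N : ℕ} (χ : DirichletCharacter ℂ N) {p : ℕ} (hp : p.Prime) {s : ℂ} (hs : 0 < s.re) :
    ‖χ p * (p:ℂ)^(-s)‖ < 1 := by
  rw [norm_mul, norm_natCast_cpow_of_pos hp.pos]
  have h4 := DirichletCharacter.norm_le_one χ (p : ZMod N)
  have h5 : (p:ℝ)^((-s).re) < 1 := Real.rpow_lt_one_of_one_lt_of_neg (by exact_mod_cast hp.one_lt) (by rw [neg_re]; linarith)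
  have h6 : (0:ℝ) ≤ (p:ℝ)^((-s).re) := by positivity
  nlinarith [norm_nonneg (χ (p : ZMod N))]

lemma one_sub_ne {x : ℂ} (hx : ‖x‖ < 1) : 1 - x ≠ 0 := fun h => by
  rw [← sub_eq_zero.1 h, norm_one] at hx; linarith
lemma one_add_ne {x : ℂ} (hx : ‖x‖ < 1) : 1 + x ≠ 0 := by
  have := one_sub_ne (x := -x) (by simpa using hx)
  simpa using this

lemma char_sq {N : ℕ} {χ : DirichletCharacter ℂ N} (hq : χ^2 = 1) (a : ZMod N) :
    (1 : DirichletCharacter ℂ N) a = χ a * χ a := by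
  rw [← hq, pow_two, MulChar.mul_apply]

lemma cpow_two_mul {p : ℕ} (hp : p ≠ 0) (s : ℂ) : (p:ℂ)^(-(2*s)) = (p:ℂ)^(-s) * (p:ℂ)^(-s) := by
  rw [← Complex.cpow_add _ _ (by exact_mod_cast hp)]; congr 1; ring

lemma term_le {N : ℕ} (χ : DirichletCharacter ℂ N) (s : ℂ) (hs : 0 < s.re) (n : ℕ) : ‖χ n * (n:ℂ)^(-s)‖ ≤ (n:ℝ)^(-s.re) := by
  rcases Nat.eq_zero_or_pos n with rfl | h0
  · have : s ≠ 0 := fun h => by simp [h] at hs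
    simp [this]
    positivity
  rw [norm_mul, norm_natCast_cpow_of_pos h0, neg_re]
  have h4 := DirichletCharacter.norm_le_one χ (n : ZMod N)
  nlinarith [Real.rpow_nonneg (Nat.cast_nonneg (α := ℝ) n) (-s.re)]

lemma triv_L {N : ℕ} [NeZero N] {s : ℂ} (hs : 1 < s.re) :
    LSeries (fun n => (1 : DirichletCharacter ℂ N) n) s = (∏ p ∈ N.primeFactors, (1 - (p:ℂ)^(-s))) * riemannZeta s := by
  rw [← DirichletCharacter.LFunction_eq_LSeries _ hs]
  exact DirichletCharacter.LFunctionTrivChar_eq_mul_riemannZeta (fun h => by rw [h] at hs; simp at hs)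

lemma quad_L {N : ℕ} [NeZero N] {χ : DirichletCharacter ℂ N} (hq : χ^2 = 1) {s : ℂ} (hs : 1 < s.re) :
    χ.LFunction s = gs s N * riemannZeta (2*s) * ∑' n : ℕ, muS n * (χ n * (n:ℂ)^(-s)) := by
  have hs2 : 1 < (2*s).re := by simp; linarith
  have hterm := muS_sqf (fun n => χ n * (n:ℂ)^(-s)) (fun p => χ p * (p:ℂ)^(-s)) (fun n hn => by
    rw [Finset.prod_mul_distrib, prod_pf_char χ hn, prod_pf_cpow _ hn])
  have hsm : Summable fun n : ℕ => ‖muS n * (χ n * (n:ℂ)^(-s))‖ := by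
    refine Summable.of_nonneg_of_le (fun _ => norm_nonneg _) (fun n => ?_) (Real.summable_nat_rpow.2 (by linarith : -s.re < -1))
    rw [norm_mul]
    have := term_le χ s (by linarith) n
    nlinarith [norm_muS n, norm_nonneg (χ n * (n:ℂ)^(-s))]
  have h1 := sqf_EP (fun p => χ p * (p:ℂ)^(-s)) (by simpa only [← hterm] using hsm)
  simp only [← hterm] at h1
  have h2 := (DirichletCharacter.LSeries_eulerProduct_hasProd (1 : DirichletCharacter ℂ N) hs2).mul h1
  have h3 := DirichletCharacter.LSeries_eulerProduct_hasProd χ hs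
  rw [DirichletCharacter.LFunction_eq_LSeries _ hs]
  have heq : ∀ p : Nat.Primes, (1 - (1 : DirichletCharacter ℂ N) p * (p:ℂ)^(-(2*s)))⁻¹ * (1 + χ p * (p:ℂ)^(-s)) =
      (1 - χ p * (p:ℂ)^(-s))⁻¹ := by
    intro p
    have hx := xnorm χ p.2 (s := s) (by linarith)
    rw [char_sq hq, cpow_two_mul p.2.ne_zero]
    have e : 1 - χ p * χ p * ((p:ℂ)^(-s) * (p:ℂ)^(-s)) = (1 - χ p * (p:ℂ)^(-s)) * (1 + χ p * (p:ℂ)^(-s)) := by ring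
    rw [e, mul_inv, mul_assoc, inv_mul_cancel₀ (one_add_ne hx), mul_one]
  rw [funext heq] at h2
  rw [h3.unique h2, triv_L hs2, gs]

lemma gs_bound (ε : ℝ) (hε : 0 < ε) : ∃ C : ℝ, 1 ≤ C ∧ ∀ s : ℂ, 0 ≤ s.re → ∀ n : ℕ, n ≠ 0 → ‖gs s n‖ ≤ C * (n:ℝ)^ε := by
  obtain ⟨C, hC, h⟩ := omega_bound 2 ε (by norm_num) hε
  refine ⟨C, hC, fun s hs n hn => le_trans ?_ (h n hn)⟩
  rw [gs, norm_prod]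
  refine Finset.prod_le_prod (fun _ _ => norm_nonneg _) fun p hp => ?_
  have hp := Nat.prime_of_mem_primeFactors hp
  refine (norm_sub_le _ _).trans ?_
  rw [norm_one, norm_natCast_cpow_of_pos hp.pos]
  have : (p:ℝ)^((-(2*s)).re) ≤ 1 := Real.rpow_le_one_of_one_le_of_nonpos (by exact_mod_cast hp.one_le) (by simp; linarith)
  linarith

lemma dter_bound {ε C : ℝ} (hC : 0 ≤ C) (s : ℂ) (hb : ∀ n : ℕ, n ≠ 0 → ‖gs s n‖ ≤ C * (n:ℝ)^ε) {w : ℂ}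
    {N : ℕ} (ψ : DirichletCharacter ℂ N) (d : ℕ) : ‖muS d * (ψ d * (d:ℂ)^(-w) * gs s d)‖ ≤ C * (d:ℝ)^(-w.re+ε) := by
  rcases Nat.eq_zero_or_pos d with rfl | h0
  · rw [muS_zero, zero_mul, norm_zero]; positivity
  rw [norm_mul, norm_mul, norm_mul, norm_natCast_cpow_of_pos h0, neg_re, Real.rpow_add (by positivity)]
  have h4 := DirichletCharacter.norm_le_one ψ (d : ZMod N)
  calc _ ≤ 1 * (1 * (d:ℝ)^(-w.re) * (C * (d:ℝ)^ε)) := by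
        gcongr
        · exact norm_muS d
        · exact hb d (by omega)
    _ = _ := by ring

lemma dter_summable (s : ℂ) (hs : 0 ≤ s.re) {w : ℂ} (hw : 1 < w.re) {N : ℕ} (ψ : DirichletCharacter ℂ N) :
    Summable fun d : ℕ => ‖muS d * (ψ d * (d:ℂ)^(-w) * gs s d)‖ := by
  obtain ⟨C, hC, h⟩ := gs_bound ((w.re-1)/2) (by linarith)
  refine Summable.of_nonneg_of_le (fun _ => norm_nonneg _) (fun d => dter_bound (by linarith) s (h s hs) ψ d) ?_
  exact (Real.summable_nat_rpow.2 (by linarith)).mul_left C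

lemma DT_id {N : ℕ} [NeZero N] {ψ : DirichletCharacter ℂ N} (hq : ψ^2 = 1) {s w : ℂ} (hs : 1 ≤ s.re) (hw : 1 < w.re) :
    (gs w N * riemannZeta (2*w)) * (∑' d : ℕ, muS d * (ψ d * (d:ℂ)^(-w) * gs s d)) =
      (∑' a : ℕ, ψ a * (lam a * (a:ℂ)^(-w) * radp s a)) * ψ.LFunction w := by
  have hw2 : 1 < (2*w).re := by simp; linarith
  have hterm := muS_sqf (fun n => ψ n * (n:ℂ)^(-w) * gs s n) (fun p => ψ p * (p:ℂ)^(-w) * (1 - (p:ℂ)^(-(2*s)))) (fun n hn => by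
    rw [Finset.prod_mul_distrib, Finset.prod_mul_distrib, prod_pf_char ψ hn, prod_pf_cpow _ hn, gs])
  have h1 := sqf_EP (fun p => ψ p * (p:ℂ)^(-w) * (1 - (p:ℂ)^(-(2*s)))) (by simpa only [← hterm] using dter_summable s (by linarith) hw ψ)
  simp only [← hterm] at h1
  have h2 := (DirichletCharacter.LSeries_eulerProduct_hasProd (1 : DirichletCharacter ℂ N) hw2).mul h1
  have hw0 : -w ≠ 0 := fun h => by rw [neg_eq_zero] at h; rw [h] at hw; simp at hw; linarith
  have hTs : Summable fun a : ℕ => ‖ψ a * (lam a * (a:ℂ)^(-w) * radp s a)‖ := by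
    refine Summable.of_nonneg_of_le (fun _ => norm_nonneg _) (fun a => ?_) (ra_summable (η := w.re) (by linarith))
    rcases Nat.eq_zero_or_pos a with rfl | h0
    · simp [zero_cpow hw0, ra_nonneg]
    rw [norm_mul, norm_mul, norm_mul, norm_lam, one_mul, norm_natCast_cpow_of_pos h0, ra, neg_re]
    have h4 := DirichletCharacter.norm_le_one ψ (a : ZMod N)
    have h5 := radp_le s hs a
    refine (mul_le_of_le_one_left (by positivity) h4).trans ?_
    gcongr
  have h3 := EulerProduct.eulerProduct_hasProd (f := fun a : ℕ => ψ a * (lam a * (a:ℂ)^(-w) * radp s a)) (by simp [lam, radp])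
    (by
      intro m n hmn
      by_cases hm : m = 0
      · simp [hm, zero_cpow hw0]
      by_cases hn : n = 0
      · simp [hn, zero_cpow hw0]
      simp only [lam, radp]
      rw [ArithmeticFunction.cardFactors_mul hm hn, hmn.primeFactors_mul, Finset.prod_union hmn.disjoint_primeFactors, Nat.cast_mul, Nat.cast_mul, map_mul, pow_add,
        Complex.natCast_mul_natCast_cpow]
      ring) hTs (by simp [zero_cpow hw0])
  have h4 := h3.mul (DirichletCharacter.LSeries_eulerProduct_hasProd ψ hw)
  rw [DirichletCharacter.LFunction_eq_LSeries _ hw]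
  have heq : ∀ p : Nat.Primes, (1 - (1 : DirichletCharacter ℂ N) p * (p:ℂ)^(-(2*w)))⁻¹ * (1 + ψ p * (p:ℂ)^(-w) * (1 - (p:ℂ)^(-(2*s)))) =
      (∑' e : ℕ, ψ ((p^e : ℕ) : ZMod N) * (lam (p^e) * ((p^e : ℕ):ℂ)^(-w) * radp s (p^e))) * (1 - ψ p * (p:ℂ)^(-w))⁻¹ := by
    intro p
    have hx := xnorm ψ p.2 (s := w) (by linarith)
    have hx' : ‖-(ψ p * (p:ℂ)^(-w))‖ < 1 := by rwa [norm_neg]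
    have hsum : ∑' e : ℕ, ψ ((p^e : ℕ) : ZMod N) * (lam (p^e) * ((p^e : ℕ):ℂ)^(-w) * radp s (p^e)) =
        1 - (p:ℂ)^(-(2*s)) * (ψ p * (p:ℂ)^(-w)) * (1 + ψ p * (p:ℂ)^(-w))⁻¹ := by
      have hcomp : Summable fun e : ℕ => ψ ((p^e : ℕ) : ZMod N) * (lam (p^e) * ((p^e : ℕ):ℂ)^(-w) * radp s (p^e)) :=
        hTs.of_norm.comp_injective (i := fun e : ℕ => (p:ℕ)^e) (Nat.pow_right_injective p.2.two_le)
      rw [hcomp.tsum_eq_zero_add]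
      have he : ∀ e : ℕ, ψ ((p^(e+1) : ℕ) : ZMod N) * (lam (p^(e+1)) * ((p^(e+1) : ℕ):ℂ)^(-w) * radp s (p^(e+1)))
          = -((p:ℂ)^(-(2*s)) * (ψ p * (p:ℂ)^(-w))) * (-(ψ p * (p:ℂ)^(-w)))^e := by
        intro e
        rw [radp, lam, Nat.primeFactors_prime_pow (by omega) p.2, Finset.prod_singleton,
          ArithmeticFunction.cardFactors_apply_prime_pow p.2]
        push_cast
        rw [map_pow, ← Complex.natCast_cpow_natCast_mul, mul_comm ((e+1:ℕ):ℂ), mul_comm (-w), Complex.cpow_nat_mul]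
        ring
      rw [tsum_congr he, tsum_mul_left, tsum_geometric_of_norm_lt_one hx']
      simp [lam, radp]
      ring
    rw [hsum, char_sq hq, cpow_two_mul p.2.ne_zero]
    have e : 1 - ψ p * ψ p * ((p:ℂ)^(-w) * (p:ℂ)^(-w)) = (1 - ψ p * (p:ℂ)^(-w)) * (1 + ψ p * (p:ℂ)^(-w)) := by ring
    rw [e]
    have n1 := one_add_ne hx
    have n2 := one_sub_ne hx
    field_simp
    ring
  rw [funext heq] at h2
  rw [h4.unique h2, triv_L hw2, gs]
end Idsec

section Hksec
open Complex Filter Topology Metric MeasureTheory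

noncomputable def Lj (n : ℕ) (z : ℂ) : ℂ := if h : n = 0 then 0 else haveI : NeZero n := ⟨h⟩; Lk (jac n) z
noncomputable def jo (c : ℤ) (n : ℕ) : ℂ := if Odd n then ((jacobiSym c n : ℤ):ℂ) else 0
noncomputable def hter (m : ℤ) (s z u : ℂ) (p : ℕ × ℕ) : ℂ :=
  muS p.1 * jo (m * p.2) p.1 * (p.1:ℂ)^(-s) * gu u p.1 * Lj p.1 z * cf s u p.2

lemma Lj_eq (n : ℕ) [h : NeZero n] (z : ℂ) : Lj n z = Lk (jac n) z := by
  simp [Lj, h.ne]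
lemma Lj_diff (n : ℕ) : Differentiable ℂ (Lj n) := by
  by_cases h : n = 0
  · have : Lj n = fun _ => 0 := by ext z; simp [Lj, h]
    rw [this]; fun_prop
  · haveI : NeZero n := ⟨h⟩
    have : Lj n = Lk (jac n) := by ext z; exact Lj_eq n z
    rw [this]; exact differentiable_Lk _

lemma jac_ne_one (n : ℕ) [NeZero n] (hn : Odd n) (hs : Squarefree n) (h1 : n ≠ 1) : jac n ≠ 1 :=
  ne_one_of_prim h1 (jac_isPrimitive n hn hs)

lemma norm_js (c : ℤ) (n : ℕ) : ‖((jacobiSym c n : ℤ):ℂ)‖ ≤ 1 := by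
  rcases jacobiSym.trichotomy c n with h | h | h <;> simp [h]
lemma norm_jo (c : ℤ) (n : ℕ) : ‖jo c n‖ ≤ 1 := by
  unfold jo; split_ifs
  · exact norm_js c n
  · simp
lemma jo_mul (c d : ℤ) (n : ℕ) : jo (c * d) n = jo c n * jo d n := by
  unfold jo; split_ifs
  · rw [jacobiSym.mul_left]; push_cast; ring
  · simp
lemma jo_one {n : ℕ} (h : Odd n) : jo 1 n = 1 := by simp [jo, h]
lemma jo_two_sq {n : ℕ} (h : Odd n) : jo 2 n * jo 2 n = 1 := by
  have : jacobiSym 2 n = 1 ∨ jacobiSym 2 n = -1 :=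
    jacobiSym.eq_one_or_neg_one (Nat.coprime_two_left.2 h)
  rcases this with h' | h' <;> simp [jo, h, h']

lemma hter_bound {η : ℝ} (hη : 0 < η) {C C0 b : ℝ} {s z u : ℂ} (hs : 1 ≤ s.re) (hsb : 1 + η + b ≤ s.re) (hu : η ≤ u.re)
    (hC0 : 0 ≤ C0) (hC1 : 0 ≤ C) (hC : ∀ n : ℕ, n ≠ 0 → ‖gu u n‖ ≤ C * (n:ℝ)^(η/2))
    (hL : ∀ n : ℕ, Odd n → Squarefree n → ‖Lj n z‖ ≤ C0 * (n:ℝ)^b) (m : ℤ) (p : ℕ × ℕ) :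
    ‖hter m s z u p‖ ≤ C0 * C * ((p.1:ℝ)^(-(1+η/2)) * ra η p.2) := by
  obtain ⟨n, a⟩ := p
  have hra := ra_nonneg η a
  by_cases hn : Odd n ∧ Squarefree n
  · have h0 : 0 < n := hn.1.pos
    have h1 : (1:ℝ) ≤ n := by exact_mod_cast h0
    simp only [hter]
    rw [norm_mul, norm_mul, norm_mul, norm_mul, norm_mul, norm_natCast_cpow_of_pos h0]
    calc _ ≤ 1 * 1 * (n:ℝ)^((-s).re) * (C * (n:ℝ)^(η/2)) * (C0 * (n:ℝ)^b) * ra η a := by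
          gcongr
          · exact norm_muS n
          · exact norm_jo _ _
          · exact hC n (by omega)
          · exact hL n hn.1 hn.2
          · exact cf_bound hη hs hu a
      _ = C0 * C * ((n:ℝ)^((-s).re + η/2 + b) * ra η a) := by
          rw [Real.rpow_add (by positivity), Real.rpow_add (by positivity)]; ring
      _ ≤ _ := by
          gcongr
          rw [neg_re]; linarith
  · have : hter m s z u (n, a) = 0 := by
      rw [not_and_or] at hn
      rcases hn with hn | hn
      · simp [hter, jo, hn]
      · simp [hter, muS, hn]
    rw [this, norm_zero]; positivity

lemma hb_summable {η : ℝ} (hη : 0 < η) (K : ℝ) : Summable fun p : ℕ × ℕ => K * ((p.1:ℝ)^(-(1+η/2)) * ra η p.2) :=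
  ((Real.summable_nat_rpow.2 (by linarith)).mul_of_nonneg (ra_summable hη) (fun _ => by simp; positivity) (fun _ => ra_nonneg _ _)).mul_left K

lemma Lj_S1 (η T : ℝ) (hη : 0 < η) (hT : 0 ≤ T) : ∃ C : ℝ, 0 ≤ C ∧ ∀ z : ℂ, 1 + η ≤ z.re → ‖z‖ ≤ T → ∀ n : ℕ, ‖Lj n z‖ ≤ C * (n:ℝ)^(0:ℝ) := by
  refine ⟨(T + 1) * ∑' k : ℕ, (k:ℝ)^(-(1+η)), by positivity, fun z hz hzT n => ?_⟩
  rw [Real.rpow_zero, mul_one]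
  by_cases h : n = 0
  · simp only [Lj, h, dite_true, norm_zero]; positivity
  haveI : NeZero n := ⟨h⟩
  have hz1 : z ≠ 1 := fun h => by rw [h, one_re] at hz; linarith
  rw [Lj_eq, Lk_ne _ hz1, norm_mul, DirichletCharacter.LFunction_eq_LSeries _ (by linarith)]
  gcongr
  · exact (norm_sub_le _ _).trans (by simpa using hzT)
  · refine tsum_of_norm_bounded (Real.summable_nat_rpow.2 (by linarith)).hasSum fun k => ?_
    rcases Nat.eq_zero_or_pos k with rfl | hk
    · simp only [LSeries.term_zero, norm_zero]; positivity
    rw [LSeries.term_of_ne_zero hk.ne', norm_div, norm_natCast_cpow_of_pos hk, Real.rpow_neg (by positivity), ← one_div]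
    have : (1:ℝ) ≤ k := by exact_mod_cast hk
    gcongr
    exact DirichletCharacter.norm_le_one _ _

lemma Lj_S2 (T : ℝ) (hT : 0 ≤ T) : ∃ C : ℝ, 0 ≤ C ∧ ∀ z : ℂ, -1/2 ≤ z.re → ‖z‖ ≤ T → ∀ n : ℕ, Odd n → Squarefree n →
    ‖Lj n z‖ ≤ C * (n:ℝ)^(2:ℝ) := by
  obtain ⟨C1, hC1, h1⟩ := crude_FE (R := T) Xp (fun s => diffAt_Xp)
  obtain ⟨C2, hC2, h2⟩ := crude_FE (R := T) Xm (fun s => diffAt_Xm)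
  obtain ⟨C3, h3⟩ := (isCompact_closedBall (0:ℂ) T).exists_bound_of_continuousOn (Lj_diff 1).continuous.continuousOn
  refine ⟨(T+1) * C1 + (T+1) * C2 + |C3|, by positivity, fun z hz hzT n hn hs => ?_⟩
  have h0 : 0 < n := hn.pos
  haveI : NeZero n := ⟨h0.ne'⟩
  by_cases hn1 : n = 1
  · subst hn1
    have := h3 z (by simpa using hzT)
    simp only [Nat.cast_one, Real.one_rpow, mul_one]
    have := le_abs_self C3
    have : 0 ≤ (T+1) * C1 + (T+1)*C2 := by positivity
    linarith
  have hne := jac_ne_one n hn hs hn1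
  rw [Lj_eq, Lk_ne_one hne, norm_mul]
  have hz1 : ‖z - 1‖ ≤ T + 1 := (norm_sub_le _ _).trans (by simpa using hzT)
  have hL : ‖(jac n).LFunction z‖ ≤ (C1 + C2) * (n:ℝ)^2 := by
    have hp : (0:ℝ) ≤ (n:ℝ)^2 := by positivity
    by_cases h4 : n % 4 = 1
    · have := h1 n (jac n) hne (fun s hs' => by rw [FE_jac n hn hs hs' (Or.inr hn1), if_pos h4]) z hz hzT
      nlinarith
    · have := h2 n (jac n) hne (fun s hs' => by rw [FE_jac n hn hs hs' (Or.inr hn1), if_neg h4]) z hz hzT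
      nlinarith
  rw [show (n:ℝ)^(2:ℝ) = (n:ℝ)^2 by norm_cast]
  calc _ ≤ (T+1) * ((C1 + C2) * (n:ℝ)^2) := by gcongr
    _ ≤ _ := by nlinarith [abs_nonneg C3, sq_nonneg (n:ℝ), mul_nonneg (abs_nonneg C3) (sq_nonneg (n:ℝ))]

noncomputable def psi (n : ℕ) [NeZero n] : DirichletCharacter ℂ (2*n) := DirichletCharacter.changeLevel (Dvd.intro_left 2 rfl : n ∣ 2*n) (jac n)

lemma psi_nat (n : ℕ) [NeZero n] (d : ℕ) : psi n d = if Odd d then ((jacobiSym d n : ℤ):ℂ) else 0 := by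
  by_cases h : IsUnit (d : ZMod (2*n))
  · have h2 := (ZMod.isUnit_iff_coprime d (2*n)).1 h
    have hd : Odd d := Nat.coprime_two_right.1 (Nat.Coprime.coprime_mul_right_right h2)
    rw [if_pos hd, psi, ← Int.cast_natCast, DirichletCharacter.changeLevel_eq_cast_of_dvd' _ _ (Nat.isCoprime_iff_coprime.2 h2), Int.cast_natCast, jac_natCast]
  · rw [MulChar.map_nonunit _ h]
    split_ifs with hd
    · have h2 : ¬ Nat.Coprime d n := fun hc => h ((ZMod.isUnit_iff_coprime d (2*n)).2 (Nat.Coprime.mul_right (Nat.coprime_two_right.2 hd) hc))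
      rw [← jac_natCast, MulChar.map_nonunit]
      rwa [ZMod.isUnit_iff_coprime]
    · rfl
end Hksec

section Fid
open Complex Filter Topology Metric MeasureTheory

lemma psi_jo {n : ℕ} [NeZero n] (hn : Odd n) (a : ℕ) (x : ℂ) : psi n a * x = jo a n * (if Odd a then x else 0) := by
  rw [psi_nat, jo, if_pos hn]; split_ifs <;> simp

lemma gs_two (w : ℂ) {n : ℕ} (hn : Odd n) (k : ℕ) : gs w (2^(k+1)*n) = (1 - (2:ℂ)^(-(2*w))) * gs w n := by
  have hc : Nat.Coprime (2^(k+1)) n := Nat.Coprime.pow_left _ (Nat.coprime_two_left.2 hn)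
  rw [gs, gs, hc.primeFactors_mul, Finset.prod_union hc.disjoint_primeFactors, Nat.primeFactors_prime_pow (by omega) Nat.prime_two]
  simp

lemma gs_gu {w : ℂ} (hw : 0 < w.re) (n : ℕ) : gu w n * gs w n = 1 := by
  rw [gs, gu, ← Finset.prod_mul_distrib]
  refine Finset.prod_eq_one fun p hp => ?_
  rw [← neg_mul]
  exact inv_mul_cancel₀ (cpow_one_sub_ne (Nat.prime_of_mem_primeFactors hp).two_le hw)

lemma n_ident {n : ℕ} [NeZero n] (hn : Odd n) {s w : ℂ} (hs : 1 ≤ s.re) (hw : 1 < w.re) :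
    (w - 1) * ((1 - (2:ℂ)^(-(2*w))) * riemannZeta (2*w) * ∑' d : ℕ, muS d * (psi n d * (d:ℂ)^(-w) * gs s d)) =
      gu w n * (1 - jo 2 n * (2:ℂ)^(-w)) * Lj n w * ∑' a : ℕ, jo a n * cf s w a := by
  have hw1 : w ≠ 1 := fun h => by simp [h] at hw
  have hq : (psi n)^2 = 1 := by
    rw [psi, ← map_pow, pow_two]
    nth_rewrite 1 [← jac_sq_real n]
    rw [inv_mul_cancel, map_one]
  have h := DT_id hq hs hw
  have h2 := gs_two w hn 0
  rw [zero_add, pow_one] at h2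
  have hL : (psi n).LFunction w = (jac n).LFunction w * (1 - jo 2 n * (2:ℂ)^(-w)) := by
    rw [psi, DirichletCharacter.LFunction_changeLevel _ _ (Or.inr hw1)]
    congr 1
    have hc : Nat.Coprime 2 n := Nat.coprime_two_left.2 hn
    rw [hc.primeFactors_mul, Finset.prod_union hc.disjoint_primeFactors, Nat.Prime.primeFactors Nat.prime_two, Finset.prod_singleton,
      Finset.prod_eq_one, mul_one, jac_natCast, jo, if_pos hn]
    · simp
    · intro p hp
      have : jac n (p : ZMod n) = 0 := by
        apply MulChar.map_nonunit
        rw [ZMod.isUnit_iff_coprime]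
        have hpp := Nat.prime_of_mem_primeFactors hp
        intro h
        exact (hpp.coprime_iff_not_dvd.1 h) (Nat.dvd_of_mem_primeFactors hp)
      rw [this]; simp
  have ht : ∑' a : ℕ, psi n a * (lam a * (a:ℂ)^(-w) * radp s a) = ∑' a : ℕ, jo a n * cf s w a :=
    tsum_congr fun a => psi_jo hn a _
  have hg := gs_gu (w := w) (by linarith) n
  rw [ht, h2, hL] at h
  rw [Lj_eq, Lk_ne _ hw1]
  linear_combination (w - 1) * gu w n * h - (w-1) * ((1 - (2:ℂ)^(-(2*w))) * riemannZeta (2*w) * ∑' d : ℕ, muS d * (psi n d * (d:ℂ)^(-w) * gs s d)) * hg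

lemma nz8 {d : ℕ} (h : Odd d ∧ Squarefree d) : NeZero (8 * d) := ⟨by rcases h.1 with ⟨k, rfl⟩; omega⟩

noncomputable def Lc (χ : (d : ℕ) → DirichletCharacter ℂ (8 * d)) (s : ℂ) (d : ℕ) : ℂ :=
  if h : Odd d ∧ Squarefree d then
            haveI : NeZero (8 * d) := nz8 h
            (χ d).LFunction s else 0

noncomputable def Tdn (s w : ℂ) (p : ℕ × ℕ) : ℂ := 
  (if Odd p.1 then muS p.1 * (p.1:ℂ)^(-w) * gs s p.1 else 0) * (muS p.2 * jo (2 * p.1) p.2 * (p.2:ℂ)^(-s))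

lemma Tdn_summable {s w : ℂ} (hs : 1 < s.re) (hw : 1 < w.re) : Summable fun p => ‖Tdn s w p‖ := by
  obtain ⟨C, hC, h⟩ := gs_bound ((w.re-1)/2) (by linarith)
  refine Summable.of_nonneg_of_le (fun _ => norm_nonneg _) (g := fun p : ℕ × ℕ => ‖Tdn s w p‖) (f := fun p : ℕ × ℕ => (C * (p.1:ℝ)^(-w.re + (w.re-1)/2)) * (p.2:ℝ)^(-s.re)) (fun p => ?_) ?_
  · obtain ⟨d, n⟩ := p
    simp only [Tdn]
    rw [norm_mul]
    gcongr
    · split_ifs with hd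
      · have := dter_bound (C := C) (ε := (w.re-1)/2) (by linarith) s (h s (by linarith)) (w := w) (1 : DirichletCharacter ℂ 1) d
        have e1 : (1 : DirichletCharacter ℂ 1) (d : ZMod 1) = 1 := MulChar.one_apply (isUnit_of_subsingleton _)
        simpa [mul_assoc, e1] using this
      · rw [norm_zero]; positivity
    · rcases Nat.eq_zero_or_pos n with rfl | h0
      · rw [muS_zero]; simp; positivity
      rw [norm_mul, norm_mul, norm_natCast_cpow_of_pos h0, neg_re]
      have := norm_muS n
      have := norm_jo (2*d) n
      calc _ ≤ 1 * 1 * (n:ℝ)^(-s.re) := by gcongr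
        _ = _ := by ring
  · exact ((Real.summable_nat_rpow.2 (by linarith)).mul_left C).mul_of_nonneg (Real.summable_nat_rpow.2 (by linarith))
      (fun _ => by simp; positivity) (fun _ => by simp; positivity)

lemma Lc_eq {χ : (d : ℕ) → DirichletCharacter ℂ (8 * d)} (hχ : ∀ d, Odd d → Squarefree d → IsChi8 d (χ d)) {s : ℂ} (hs : 1 < s.re) (w : ℂ) (d : ℕ) :
    Lc χ s d * (d:ℂ)^(-w) = riemannZeta (2*s) * (1 - (2:ℂ)^(-(2*s))) * ∑' n : ℕ, Tdn s w (d, n) := by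
  by_cases h : Odd d ∧ Squarefree d
  · haveI : NeZero (8 * d) := ⟨by rcases h.1 with ⟨k, rfl⟩; omega⟩
    have hc := hχ d h.1 h.2
    have hq : (χ d)^2 = 1 := by
      rw [pow_two]
      nth_rewrite 1 [← chi8_inv hc]
      rw [inv_mul_cancel]
    simp only [Lc, h, and_self, dite_true, Tdn, if_true]
    have h8 := gs_two s h.1 2
    rw [show 2^(2+1)*d = 8 * d by norm_num] at h8
    rw [quad_L hq hs, h8, tsum_mul_left]
    have : ∀ n : ℕ, muS n * (χ d n * (n:ℂ)^(-s)) = muS n * jo (2*d) n * (n:ℂ)^(-s) := by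
      intro n
      rcases Nat.even_or_odd n with hn | hn
      · rw [hc.2 n hn, jo, if_neg (by simpa using hn)]; ring
      · rw [hc.1 n hn, jo, if_pos hn, jacobi8 d n hn]; ring
    rw [tsum_congr this]
    simp only [muS, h.2, if_true]
    ring
  · rw [not_and_or] at h
    have : ∀ n, Tdn s w (d, n) = 0 := by
      intro n
      rcases h with h | h
      · simp [Tdn, h]
      · simp [Tdn, muS, h]
    rw [tsum_congr this, Lc, dif_neg (by tauto)]; simp

lemma F_ident {χ : (d : ℕ) → DirichletCharacter ℂ (8 * d)} (hχ : ∀ d, Odd d → Squarefree d → IsChi8 d (χ d)) {s w : ℂ} (hs : 1 < s.re) (hw : 1 < w.re) :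
    (Summable fun d : ℕ => ‖Lc χ s d * (d:ℂ)^(-w)‖) ∧
    (w - 1) * (1 - (2:ℂ)^(-(2*w))) * riemannZeta (2*w) * ∑' d : ℕ, Lc χ s d * (d:ℂ)^(-w) =
      riemannZeta (2*s) * (1 - (2:ℂ)^(-(2*s))) * ((∑' p, hter 2 s w w p) - (2:ℂ)^(-w) * ∑' p, hter 1 s w w p) := by
  have hT := Tdn_summable hs hw
  constructor
  · simp only [Lc_eq hχ hs]
    simp only [norm_mul]
    refine Summable.mul_left _ (Summable.of_nonneg_of_le (fun _ => norm_nonneg _) (fun d => norm_tsum_le_tsum_norm ?_) hT.prod)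
    exact hT.prod_factor d
  have hη : 0 < min (s.re - 1) (w.re - 1) := by simp [hs, hw]
  set η := min (s.re - 1) (w.re - 1)
  have hη1 : η ≤ s.re - 1 := min_le_left _ _
  have hη2 : η ≤ w.re - 1 := min_le_right _ _
  obtain ⟨C, hC, hg⟩ := gu_bound η (η/2) hη (by linarith)
  obtain ⟨C0, hC0, hL⟩ := Lj_S1 η ‖w‖ hη (norm_nonneg _)
  have hsum : ∀ m, Summable fun p => hter m s w w p := fun m =>
    Summable.of_norm_bounded (hb_summable hη (C0*C)) (hter_bound hη (b := 0) (by linarith) (by linarith) (by linarith) hC0 (by linarith) (hg w (by linarith))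
      (fun n _ _ => hL w (by linarith) le_rfl n) m)
  rw [tsum_congr (Lc_eq hχ hs w), tsum_mul_left, ← hT.of_norm.tsum_prod, (hsum 2).tsum_prod, (hsum 1).tsum_prod, ← tsum_mul_left (a := (2:ℂ)^(-w)),
    ← (hsum 2).prod.tsum_sub ((hsum 1).prod.mul_left _), ← (Equiv.prodComm ℕ ℕ).tsum_eq]
  have hT' := hT.of_norm.prod_symm
  rw [show (∑' c, Tdn s w ((Equiv.prodComm ℕ ℕ) c)) = ∑' c : ℕ × ℕ, Tdn s w c.swap from rfl, hT'.tsum_prod]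
  have key : ∀ n : ℕ, (w - 1) * (1 - (2:ℂ)^(-(2*w))) * riemannZeta (2*w) * ∑' d : ℕ, Tdn s w (d, n) =
      (∑' a : ℕ, hter 2 s w w (n, a)) - (2:ℂ)^(-w) * ∑' a : ℕ, hter 1 s w w (n, a) := by
    intro n
    by_cases hn : Odd n
    · haveI : NeZero n := ⟨hn.pos.ne'⟩
      have e1 : ∑' d : ℕ, Tdn s w (d, n) = (muS n * jo 2 n * (n:ℂ)^(-s)) * ∑' d : ℕ, muS d * (psi n d * (d:ℂ)^(-w) * gs s d) := by
        rw [← tsum_mul_left]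
        refine tsum_congr fun d => ?_
        simp only [Tdn]
        rw [jo_mul, mul_assoc (psi n d), psi_jo hn]
        split_ifs <;> ring
      have e2 : ∀ m : ℤ, ∑' a : ℕ, hter m s w w (n, a) = (muS n * jo m n * (n:ℂ)^(-s) * gu w n * Lj n w) * ∑' a : ℕ, jo a n * cf s w a := by
        intro m
        rw [← tsum_mul_left]
        refine tsum_congr fun a => ?_
        simp only [hter]
        rw [jo_mul]; ring
      rw [e1, e2, e2, jo_one hn]
      have := n_ident hn hs.le hw
      linear_combination (muS n * jo 2 n * (n:ℂ)^(-s)) * this - muS n * (n:ℂ)^(-s) * gu w n * (2:ℂ)^(-w) * Lj n w * (∑' a : ℕ, jo a n * cf s w a) * jo_two_sq hn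
    · have e1 : ∀ d, Tdn s w (d, n) = 0 := fun d => by simp [Tdn, jo, hn]
      have e2 : ∀ m a, hter m s w w (n, a) = 0 := fun m a => by simp [hter, jo, hn]
      simp [e1, e2]
  rw [← tsum_congr key, tsum_mul_left]
  simp only [Prod.swap_prod_mk]
  ring
end Fid

section SL
open Complex Filter Topology Metric MeasureTheory

def Sset (η : ℝ) : Set (ℂ × ℂ × ℂ) :=
  {q | 1 + η < q.1.re ∧ 1 + η < q.2.1.re ∧ η < q.2.2.re} ∪ {q | 5 < q.1.re ∧ -1/2 < q.2.1.re ∧ η < q.2.2.re}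
def Lset (J : ℕ) (η : ℝ) : Set (ℂ × ℂ × ℂ) :=
  {q | -1/2 < q.2.1.re ∧ q.2.1.re < -η ∧ (q.1 + q.2.1, q.2.2) ∈ Wr J η}

lemma isOpen_Sset (η : ℝ) : IsOpen (Sset η) := by
  refine IsOpen.union ?_ ?_ <;> refine IsOpen.and ?_ (IsOpen.and ?_ ?_) <;> exact isOpen_lt (by fun_prop) (by fun_prop)
lemma isOpen_Lset (J : ℕ) (η : ℝ) : IsOpen (Lset J η) := by
  refine IsOpen.and ?_ (IsOpen.and ?_ ?_)
  · exact isOpen_lt (by fun_prop) (by fun_prop)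
  · exact isOpen_lt (by fun_prop) (by fun_prop)
  · exact (isOpen_Wr J η).preimage (f := fun q : ℂ × ℂ × ℂ => (q.1 + q.2.1, q.2.2)) (by fun_prop)

lemma gu_good {E : Type*} [NormedAddCommGroup E] [NormedSpace ℂ E] {U : Set E} {f : E → ℂ} (hf : Differentiable ℂ f) (h : ∀ q ∈ U, 0 < (f q).re) (n : ℕ) :
    Good U (fun q => gu (f q) n) := by
  unfold gu
  refine Good.prod _ fun p hp => ?_
  have hp := Nat.prime_of_mem_primeFactors hp
  have g := Good.div (good_const U 1) (g := fun q => 1 - (p:ℂ)^(-2 * f q)) (Good.of_diff (Differentiable.differentiableOn (by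
    refine (differentiable_const _).sub (Differentiable.const_cpow (by fun_prop) (Or.inl (by exact_mod_cast hp.ne_zero))))))
    (fun q hq => cpow_one_sub_ne hp.two_le (h q hq))
  exact g.congr fun q _ => by simp

lemma natpow_diff {E : Type*} [NormedAddCommGroup E] [NormedSpace ℂ E] {f : E → ℂ} (hf : Differentiable ℂ f) {n : ℕ} (h0 : n ≠ 0) :
    Differentiable ℂ (fun q => (n:ℂ)^(f q)) := Differentiable.const_cpow hf (Or.inl (by exact_mod_cast h0))

lemma cf_good {E : Type*} [NormedAddCommGroup E] [NormedSpace ℂ E] {U : Set E} {f g : E → ℂ} (hf : Differentiable ℂ f) (hg : Differentiable ℂ g) (a : ℕ) :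
    Good U (fun q => cf (f q) (g q) a) := by
  unfold cf
  split_ifs with h
  · refine ((good_const _ _).mul (Good.of_diff (natpow_diff (by fun_prop) h.pos.ne').differentiableOn)).mul ?_
    unfold radp
    exact Good.prod _ fun p hp => Good.of_diff (natpow_diff (by fun_prop) (Nat.prime_of_mem_primeFactors hp).ne_zero).differentiableOn
  · exact good_const _ _

lemma hter_good {U : Set (ℂ × ℂ × ℂ)} (h : ∀ q ∈ U, 0 < q.2.2.re) (m : ℤ) (p : ℕ × ℕ) : Good U (fun q => hter m q.1 q.2.1 q.2.2 p) := by
  obtain ⟨n, a⟩ := p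
  by_cases hn : n = 0
  · exact (good_const U 0).congr fun q _ => by simp [hter, hn, muS_zero]
  unfold hter
  refine ((((good_const _ _).mul (Good.of_diff (natpow_diff (by fun_prop) hn).differentiableOn)).mul (gu_good (by fun_prop) h n)).mul
    (Good.of_diff ((Lj_diff n).comp (f := fun q : ℂ × ℂ × ℂ => q.2.1) (by fun_prop)).differentiableOn)).mul
    (cf_good (by fun_prop) (by fun_prop) a)

lemma norm3 {x : ℂ × ℂ × ℂ} {T : ℝ} (h : ‖x‖ < T) : ‖x.1‖ < T ∧ ‖x.2.1‖ < T ∧ ‖x.2.2‖ < T :=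
  ⟨(norm_fst_le x).trans_lt h, ((norm_fst_le x.2).trans (norm_snd_le x)).trans_lt h, ((norm_snd_le x.2).trans (norm_snd_le x)).trans_lt h⟩

lemma fS_good {η : ℝ} (hη : 0 < η) (hη1 : η ≤ 2) (m : ℤ) : Good (Sset η) (fun q => ∑' p, hter m q.1 q.2.1 q.2.2 p) := by
  have hu : ∀ q ∈ Sset η, η < q.2.2.re := by
    rintro q (h | h)
    · exact h.2.2
    · exact h.2.2
  refine Good.tsum (isOpen_Sset η) (fun p => hter_good (fun q hq => hη.trans (hu q hq)) m p) fun x hx => ?_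
  obtain ⟨C, hC, hg⟩ := gu_bound η (η/2) hη (by linarith)
  obtain ⟨C1, hC1, h1⟩ := Lj_S1 η (‖x‖+1) hη (by positivity)
  obtain ⟨C2, hC2, h2⟩ := Lj_S2 (‖x‖+1) (by positivity)
  refine ⟨ball 0 (‖x‖+1), isOpen_ball, by simp, _, hb_summable hη ((C1 + C2) * C), fun p y hy => ?_⟩
  obtain ⟨hy1, hy2⟩ := hy
  have hy3 := norm3 (by simpa using hy1 : ‖y‖ < ‖x‖ + 1)
  have hra := ra_nonneg η p.2
  have hnn : 0 ≤ (p.1:ℝ)^(-(1+η/2)) := by positivity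
  rcases hy2 with h | h
  · refine (hter_bound hη (b := 0) (by linarith [h.1]) (by linarith [h.1]) h.2.2.le hC1 (by linarith) (hg _ h.2.2.le)
      (fun n _ _ => h1 _ h.2.1.le hy3.2.1.le n) m p).trans ?_
    gcongr; linarith
  · refine (hter_bound hη (b := 2) (by linarith [h.1]) (by linarith [h.1]) h.2.2.le hC2 (by linarith) (hg _ h.2.2.le)
      (fun n hn hs => h2 _ h.2.1.le hy3.2.1.le n hn hs) m p).trans ?_
    gcongr; linarith

noncomputable def Mc (J : ℕ) (c : ℤ) (q : ℂ × ℂ) : ℂ :=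
  if h : c = 0 then 0 else haveI : NeZero (8 * c.natAbs) := ⟨by simpa using h⟩; Mst J (chc c) q
noncomputable def Ya (z : ℂ) : ℂ := (z - 1) * ((Xp z + Xm z) / 2)
noncomputable def Yb (z : ℂ) : ℂ := (z - 1) * ((Xp z - Xm z) / 2)
noncomputable def kp (k : ℕ) (z : ℂ) : ℂ := if k = 0 then 0 else (k:ℂ)^(z-1)
noncomputable def gter (J : ℕ) (m : ℤ) (q : ℂ × ℂ × ℂ) (p : ℕ × ℕ) : ℂ :=
  cf q.1 q.2.2 p.1 * kp p.2 q.2.1 * (Ya q.2.1 * Mc J (m * p.1 * p.2) (q.1 + q.2.1, q.2.2) + Yb q.2.1 * Mc J (-(m * p.1 * p.2)) (q.1 + q.2.1, q.2.2))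

lemma Mc_good (J : ℕ) {η : ℝ} (hη : 0 < η) (c : ℤ) : Good (Wr J η) (Mc J c) := by
  by_cases h : c = 0
  · exact (good_const _ 0).congr fun q _ => by simp [Mc, h]
  · haveI : NeZero (8 * c.natAbs) := ⟨by simpa using h⟩
    exact (Mst_good J hη (chc c)).congr fun q _ => by simp [Mc, h]

lemma diff_Ya : DifferentiableOn ℂ Ya {z | z.re < 1} := fun z hz => by
  have h1 := diffAt_Xp hz
  have h2 := diffAt_Xm hz
  unfold Ya
  exact DifferentiableAt.differentiableWithinAt (by fun_prop)
lemma diff_Yb : DifferentiableOn ℂ Yb {z | z.re < 1} := fun z hz => by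
  have h1 := diffAt_Xp hz
  have h2 := diffAt_Xm hz
  unfold Yb
  exact DifferentiableAt.differentiableWithinAt (by fun_prop)

lemma gter_good (J : ℕ) {η : ℝ} (hη : 0 < η) (m : ℤ) (p : ℕ × ℕ) : Good (Lset J η) (fun q => gter J m q p) := by
  obtain ⟨a, k⟩ := p
  by_cases hk : k = 0
  · exact (good_const _ 0).congr fun q _ => by simp [gter, hk, kp]
  have hM : ∀ c, Good (Lset J η) (fun q => Mc J c (q.1 + q.2.1, q.2.2)) := fun c =>
    (Mc_good J hη c).comp (ψ := fun q : ℂ × ℂ × ℂ => (q.1 + q.2.1, q.2.2)) (by fun_prop) (fun q hq => hq.2.2)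
  have hmap : Set.MapsTo (fun q : ℂ × ℂ × ℂ => q.2.1) (Lset J η) {z | z.re < 1} := fun q hq => by
    have := hq.2.1
    simp only [Set.mem_setOf_eq]; linarith
  have hY : Good (Lset J η) (fun q => Ya q.2.1) := (Good.of_diff diff_Ya).comp (ψ := fun q : ℂ × ℂ × ℂ => q.2.1) (by fun_prop) hmap
  have hY' : Good (Lset J η) (fun q => Yb q.2.1) := (Good.of_diff diff_Yb).comp (ψ := fun q : ℂ × ℂ × ℂ => q.2.1) (by fun_prop) hmap
  unfold gter
  refine ((cf_good (by fun_prop) (by fun_prop) a).mul ?_).mul ((hY.mul (hM _)).add (hY'.mul (hM _)))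
  simp only [kp, hk, if_false]
  exact Good.of_diff (natpow_diff (by fun_prop) hk).differentiableOn

lemma ra_shift {η : ℝ} (a : ℕ) (ε : ℝ) (ha : a ≠ 0) : ra η a * (a:ℝ)^ε = ra (η - ε) a := by
  have : 0 < (a:ℝ) := by positivity
  rw [ra, ra, show -(η - ε) = -η + ε by ring, Real.rpow_add this]; ring

lemma Mc_bd {J : ℕ} {C ε : ℝ} {q : ℂ × ℂ} (hC : 0 ≤ C)
    (h : ∀ (N : ℕ) [NeZero N] (χ : DirichletCharacter ℂ N), ‖Mst J χ q‖ ≤ C * (N:ℝ)^ε) (c : ℤ) : ‖Mc J c q‖ ≤ C * ((8 * c.natAbs : ℕ):ℝ)^ε := by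
  by_cases h' : c = 0
  · simp only [Mc, h', dite_true, norm_zero]; positivity
  · haveI : NeZero (8 * c.natAbs) := ⟨by simpa using h'⟩
    simp only [Mc, h', dite_false]
    exact h _ _

lemma gL_good (hG : GLH) (J : ℕ) {η : ℝ} (hη : 0 < η) (m : ℤ) : Good (Lset J η) (fun q => ∑' p, gter J m q p) := by
  refine Good.tsum (isOpen_Lset J η) (fun p => gter_good J hη m p) fun x hx => ?_
  set T := ‖x‖ + 1
  obtain ⟨C, hC, hM⟩ := Mst_bound hG J η (2*T) (η/2) hη (by linarith)
  have hK : IsCompact ({z : ℂ | z.re ≤ 0} ∩ Metric.closedBall 0 T) :=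
    (isCompact_closedBall 0 T).inter_left (isClosed_le continuous_re continuous_const)
  have hsub : ({z : ℂ | z.re ≤ 0} ∩ Metric.closedBall 0 T) ⊆ {z | z.re < 1} := fun z hz => show z.re < 1 from lt_of_le_of_lt hz.1 one_pos
  obtain ⟨A, hA⟩ := hK.exists_bound_of_continuousOn (diff_Ya.continuousOn.mono hsub)
  obtain ⟨B, hB⟩ := hK.exists_bound_of_continuousOn (diff_Yb.continuousOn.mono hsub)
  refine ⟨ball 0 T, isOpen_ball, by simp [T], fun p => ((|A| + |B|) * C * (8 * m.natAbs : ℕ)^(η/2)) * (ra (η/2) p.1 * (p.2:ℝ)^(-(1+η/2))), ?_, fun p y hy => ?_⟩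
  · exact ((ra_summable (half_pos hη)).mul_of_nonneg (Real.summable_nat_rpow.2 (by linarith)) (fun _ => ra_nonneg _ _) (fun _ => by simp; positivity)).mul_left _
  obtain ⟨hy1, hy2⟩ := hy
  have hy3 := norm3 (by simpa using hy1 : ‖y‖ < T)
  obtain ⟨a, k⟩ := p
  have hra := ra_nonneg (η/2) a
  by_cases hk : k = 0
  · simp only [gter, kp, hk, if_true, mul_zero, zero_mul, norm_zero]; positivity
  by_cases ha : a = 0
  · have : cf y.1 y.2.2 a = 0 := by simp [ha, cf]
    simp only [gter, this, zero_mul, norm_zero]; positivity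
  have hvn : ‖((y.1 + y.2.1, y.2.2) : ℂ × ℂ)‖ ≤ 2 * T := by
    rw [Prod.norm_def, max_le_iff]
    have := norm_nonneg y.2.2
    exact ⟨(norm_add_le _ _).trans (by linarith [hy3.1, hy3.2.1]), by linarith [hy3.2.2]⟩
  have hb := fun c => Mc_bd (c := c) hC.le (fun N _ χ => hM N χ _ hy2.2.2 hvn)
  have hz : y.2.1.re < -η := hy2.2.1
  have hs : 1 ≤ y.1.re := by
    have := hy2.2.2.1
    simp at this; linarith
  have hzK : y.2.1 ∈ ({z : ℂ | z.re ≤ 0} ∩ Metric.closedBall 0 T) := ⟨by simp only [Set.mem_setOf_eq]; linarith, by simpa using hy3.2.1.le⟩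
  have hcast : ((8 * (m * a * k).natAbs : ℕ):ℝ)^(η/2) = ((8 * m.natAbs : ℕ):ℝ)^(η/2) * (a:ℝ)^(η/2) * (k:ℝ)^(η/2) := by
    rw [← Real.mul_rpow (by positivity) (by positivity), ← Real.mul_rpow (by positivity) (by positivity)]
    congr 1
    rw [Int.natAbs_mul, Int.natAbs_mul]; push_cast; simp; ring
  have h1 := hb (m * a * k)
  have h2 := hb (-(m * a * k))
  rw [Int.natAbs_neg] at h2
  rw [hcast] at h1 h2
  have hk0 : 0 < (k:ℝ) := by positivity
  have hk1 : (1:ℝ) ≤ k := by exact_mod_cast Nat.one_le_iff_ne_zero.2 hk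
  simp only [gter]
  rw [norm_mul, norm_mul, kp, if_neg hk, norm_natCast_cpow_of_pos (by omega)]
  calc _ ≤ ra η a * (k:ℝ)^(-(1+η)) * (|A| * (C * (((8 * m.natAbs : ℕ):ℝ)^(η/2) * (a:ℝ)^(η/2) * (k:ℝ)^(η/2))) +
        |B| * (C * (((8 * m.natAbs : ℕ):ℝ)^(η/2) * (a:ℝ)^(η/2) * (k:ℝ)^(η/2)))) := by
        gcongr
        · exact mul_nonneg (ra_nonneg _ _) (by positivity)
        · exact ra_nonneg _ _
        · exact cf_bound hη hs hy2.2.2.2.1.le a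
        · simp; linarith
        · refine (norm_add_le _ _).trans ?_
          rw [norm_mul, norm_mul]
          gcongr
          · exact (hA _ hzK).trans (le_abs_self _)
          · exact (hB _ hzK).trans (le_abs_self _)
    _ = _ := by
        have e1 := ra_shift (η := η) a (η/2) ha
        rw [show η - η/2 = η/2 by ring] at e1
        rw [← e1, show -(1+η/2) = -(1+η) + η/2 by ring, Real.rpow_add hk0]
        ring
end SL

section SLeq
open Complex Filter Topology Metric MeasureTheory

noncomputable def tau (m : ℤ) (s z u : ℂ) (n a k : ℕ) : ℂ :=
  cf s u a * kp k z * (muS n * (Ya z * jo (m * a * k) n + Yb z * jo (-(m * a * k)) n) * ((n:ℂ)^(1/2-(s+z)) * gu u n))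

lemma X_split {n : ℕ} (hn : Odd n) (z : ℂ) : (z - 1) * (if n % 4 = 1 then Xp z else Xm z) = Ya z + jo (-1) n * Yb z := by
  have h4 : n % 4 = 1 ∨ n % 4 = 3 := by rcases hn with ⟨k, rfl⟩; omega
  rw [jo, if_pos hn, jacobiSym.at_neg_one hn]
  rcases h4 with h | h
  · rw [if_pos h, ZMod.χ₄_nat_one_mod_four h, Ya, Yb]; push_cast; ring
  · rw [if_neg (by omega), ZMod.χ₄_nat_three_mod_four h, Ya, Yb]; push_cast; ring

lemma tau_k (m : ℤ) {s z u : ℂ} (hz : z.re < 0) (n a : ℕ) : ∑' k, tau m s z u n a k = hter m s z u (n, a) := by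
  by_cases hn : Odd n ∧ Squarefree n
  · have h0 : 0 < n := hn.1.pos
    haveI : NeZero n := ⟨h0.ne'⟩
    have hz1 : z ≠ 1 := fun h => by rw [h, one_re] at hz; linarith
    have hz0 : z ≠ 0 := fun h => by rw [h, zero_re] at hz; linarith
    have hre : 1 < (1 - z).re := by simp; linarith
    have hL : (jac n).LFunction (1 - z) = ∑' k : ℕ, kp k z * jo k n := by
      rw [DirichletCharacter.LFunction_eq_LSeries _ hre, LSeries]
      refine tsum_congr fun k => ?_
      rcases Nat.eq_zero_or_pos k with rfl | hk
      · simp [kp]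
      rw [LSeries.term_of_ne_zero hk.ne', kp, if_neg hk.ne', jac_natCast, jo, if_pos hn.1, div_eq_mul_inv, ← Complex.cpow_neg, neg_sub, mul_comm]
    have e : ∀ k, tau m s z u n a k = (cf s u a * muS n * jo (m * a) n * (Ya z + jo (-1) n * Yb z) * ((n:ℂ)^(1/2-(s+z)) * gu u n)) * (kp k z * jo k n) := by
      intro k
      rw [tau, show (-(m * a * k) : ℤ) = (-1) * (m * a) * k by ring, jo_mul (m * a) k, jo_mul _ k, jo_mul (-1)]
      ring
    rw [tsum_congr e, tsum_mul_left, ← hL, ← X_split hn.1]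
    simp only [hter]
    rw [Lj_eq, Lk_ne _ hz1, FE_jac n hn.1 hn.2 (by linarith) (Or.inl hz0), show (1/2 - (s + z)) = -s + (1/2 - z) by ring,
      Complex.cpow_add _ _ (by exact_mod_cast h0.ne')]
    ring
  · rw [not_and_or] at hn
    have : ∀ k, tau m s z u n a k = 0 := by
      intro k
      rcases hn with hn | hn
      · simp [tau, jo, hn]
      · simp [tau, muS, hn]
    rw [tsum_congr this]
    rcases hn with hn | hn
    · simp [hter, jo, hn]
    · simp [hter, muS, hn]

lemma Mter_jo {c : ℤ} [NeZero (8 * c.natAbs)] (q : ℂ × ℂ) (n : ℕ) : Mter (chc c) q n = muS n * jo c n * ((n:ℂ)^(1/2 - q.1) * gu q.2 n) := by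
  rw [Mter, chc_natCast, jo, muS]
  split_ifs <;> ring

lemma tau_n (J : ℕ) {η : ℝ} (hη : 0 < η) {m : ℤ} (hm : m ≠ 0) {q : ℂ × ℂ × ℂ} (hq : q ∈ Lset J η) (h5 : 5 < q.1.re) (a k : ℕ) :
    (∏ j ∈ Finset.range (J+1), (q.1 + q.2.1 + 2 * j * q.2.2 - 3/2)) * ∑' n, tau m q.1 q.2.1 q.2.2 n a k = gter J m q (a, k) := by
  by_cases ha : a = 0
  · have : cf q.1 q.2.2 a = 0 := by simp [ha, cf]
    simp [tau, gter, this]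
  by_cases hk : k = 0
  · simp [tau, gter, kp, hk]
  have hc : m * a * k ≠ 0 := by positivity
  have hc' : -(m * a * k) ≠ 0 := neg_ne_zero.2 hc
  haveI i1 : NeZero (8 * (m * a * k).natAbs) := ⟨by simpa using hc⟩
  haveI i2 : NeZero (8 * (-(m * a * k)).natAbs) := ⟨by simpa using hc⟩
  have h32 : 3/2 < (q.1 + q.2.1).re := by
    have := hq.1
    rw [add_re]; linarith
  have hu : 0 < q.2.2.re := hη.trans hq.2.2.2.1
  have e : ∀ n, tau m q.1 q.2.1 q.2.2 n a k = cf q.1 q.2.2 a * kp k q.2.1 * (Ya q.2.1 * Mter (chc (m * a * k)) (q.1 + q.2.1, q.2.2) n +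
      Yb q.2.1 * Mter (chc (-(m * a * k))) (q.1 + q.2.1, q.2.2) n) := by
    intro n
    rw [Mter_jo, Mter_jo, tau]; ring
  have s1 := (Mter_summable (chc (m * a * k)) (q.1 + q.2.1, q.2.2) h32 hu).of_norm
  have s2 := (Mter_summable (chc (-(m * a * k))) (q.1 + q.2.1, q.2.2) h32 hu).of_norm
  rw [tsum_congr e, tsum_mul_left, (s1.mul_left _).tsum_add (s2.mul_left _), tsum_mul_left, tsum_mul_left, gter, Mc, Mc, dif_neg hc, dif_neg hc',
    Mst_eq J hη _ _ hq.2.2 h32, Mst_eq J hη _ _ hq.2.2 h32]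
  ring

lemma tau_summable {m : ℤ} {s z u : ℂ} (hz : z.re < 0) (hs : 1 ≤ s.re) (h32 : 3/2 < (s+z).re) (hu : 0 < u.re) :
    Summable fun p : (ℕ × ℕ) × ℕ => tau m s z u p.1.1 p.1.2 p.2 := by
  obtain ⟨ε, hε, hε2⟩ : ∃ ε : ℝ, 0 < ε ∧ 1/2-(s+z).re+ε < -1 := ⟨((s+z).re - 3/2)/2, by linarith, by linarith⟩
  obtain ⟨C, hC, hg⟩ := gu_bound u.re ε hu hε
  refine Summable.of_norm_bounded (g := fun p : (ℕ × ℕ) × ℕ => ((C * (‖Ya z‖ + ‖Yb z‖)) * (((p.1.1:ℝ)^(1/2-(s+z).re+ε)) * ra u.re p.1.2)) * (p.2:ℝ)^(z.re - 1)) ?_ ?_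
  · have hA : Summable fun p : ℕ × ℕ => ((p.1:ℝ)^(1/2-(s+z).re+ε)) * ra u.re p.2 :=
      (Real.summable_nat_rpow.2 hε2).mul_of_nonneg (ra_summable hu) (fun x => by simp only [Pi.zero_apply]; positivity) (fun x => ra_nonneg _ _)
    have hB : Summable fun k : ℕ => (k:ℝ)^(z.re - 1) := Real.summable_nat_rpow.2 (by linarith)
    have hA2 := hA.mul_left (C * (‖Ya z‖ + ‖Yb z‖))
    exact hA2.mul_of_nonneg hB (fun x => by have := ra_nonneg u.re x.2; simp only [Pi.zero_apply]; positivity) (fun x => by simp only [Pi.zero_apply]; positivity)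
  · rintro ⟨⟨n, a⟩, k⟩
    have hra := ra_nonneg u.re a
    simp only
    rw [tau]
    rcases Nat.eq_zero_or_pos n with rfl | hn
    · rw [muS_zero]; simp; positivity
    rw [norm_mul, norm_mul, norm_mul, norm_mul, norm_mul]
    have hk : ‖kp k z‖ ≤ (k:ℝ)^(z.re-1) := by
      unfold kp
      split_ifs with hk
      · rw [norm_zero]; positivity
      · rw [norm_natCast_cpow_of_pos (by omega)]; simp
    calc _ ≤ ra u.re a * (k:ℝ)^(z.re-1) * (1 * (‖Ya z‖ * 1 + ‖Yb z‖ * 1) * ((n:ℝ)^(1/2-(s+z).re) * (C * (n:ℝ)^ε))) := by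
          gcongr
          · exact cf_bound hu hs le_rfl a
          · exact norm_muS n
          · refine (norm_add_le _ _).trans ?_
            rw [norm_mul, norm_mul]
            gcongr
            · exact norm_jo _ _
            · exact norm_jo _ _
          · rw [norm_natCast_cpow_of_pos hn]
            apply le_of_eq; congr 1; simp
          · exact hg u le_rfl n (by omega)
      _ = _ := by rw [Real.rpow_add (by positivity)]; ring

lemma SL_eq (J : ℕ) {η : ℝ} (hη : 0 < η) {m : ℤ} (hm : m ≠ 0) {q : ℂ × ℂ × ℂ} (hq : q ∈ Lset J η) (h5 : 5 < q.1.re) :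
    (∏ j ∈ Finset.range (J+1), (q.1 + q.2.1 + 2 * j * q.2.2 - 3/2)) * ∑' p, hter m q.1 q.2.1 q.2.2 p = ∑' p, gter J m q p := by
  have hz : q.2.1.re < 0 := by linarith [hq.2.1]
  have hS := tau_summable (m := m) hz (by linarith) (s := q.1) (u := q.2.2) (by rw [add_re]; linarith [hq.1]) (hη.trans hq.2.2.2.1)
  have e1 : ∑' p : (ℕ × ℕ) × ℕ, tau m q.1 q.2.1 q.2.2 p.1.1 p.1.2 p.2 = ∑' p, hter m q.1 q.2.1 q.2.2 p := by
    rw [hS.tsum_prod]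
    exact tsum_congr fun p => tau_k m hz p.1 p.2
  let e : (ℕ × ℕ) × ℕ ≃ (ℕ × ℕ) × ℕ := (Equiv.prodComm _ _).trans (Equiv.prodAssoc ℕ ℕ ℕ).symm
  have hS' : Summable fun x => (∏ j ∈ Finset.range (J+1), (q.1 + q.2.1 + 2 * j * q.2.2 - 3/2)) * tau m q.1 q.2.1 q.2.2 (e x).1.1 (e x).1.2 (e x).2 :=
    (e.summable_iff.2 hS).mul_left _
  rw [← e1, ← e.tsum_eq, ← tsum_mul_left]
  rw [hS'.tsum_prod]
  refine tsum_congr fun p => ?_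
  rw [tsum_mul_left]
  exact tau_n J hη hm hq h5 p.1 p.2
end SLeq

section StepI
open Complex Filter Topology Metric MeasureTheory

def D1 (h B : ℝ) : Set (ℂ × ℂ) := {x | 1 + h < x.1.re ∧ h < x.2.re ∧ x.2.re < B ∧ |x.2.im| < B}

lemma isOpen_D1 (h B : ℝ) : IsOpen (D1 h B) := by
  unfold D1
  refine IsOpen.and ?_ (IsOpen.and ?_ (IsOpen.and ?_ ?_)) <;> exact isOpen_lt (by fun_prop) (by fun_prop)

lemma hter_cont (hG : GLH) {h B : ℝ} (hh : 0 < h) (hh1 : h ≤ 1) (hB : 0 < B) {J : ℕ} (hJ : 1 ≤ J * h) {m : ℤ} (hm : m ≠ 0) :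
    ∃ F : ℂ × ℂ → ℂ, Good (D1 h B) F ∧ ∀ x ∈ D1 h B, 1 < x.2.re →
      F x = (∏ j ∈ Finset.range (J+1), (x.1 + x.2 + 2 * j * x.2 - 3/2)) * ∑' p, hter m x.1 x.2 x.2 p := by
  classical
  have hη : 0 < h/8 := by positivity
  have hkill : ∀ U : Set (ℂ × ℂ × ℂ), Good U (fun q => ∏ j ∈ Finset.range (J+1), (q.1 + q.2.1 + 2 * j * q.2.2 - 3/2)) := fun U =>
    Good.prod _ fun j _ => Good.of_diff (by fun_prop)
  have hS := fun (η : ℝ) (h0 : 0 < η) (h2 : η ≤ 2) => (hkill (Sset η)).mul (fS_good h0 h2 m)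
  have hU := Good.union (isOpen_Sset (h/8)) (isOpen_Lset J (h/8)) (hS _ hη (by linarith)) (gL_good hG J hη m) (by
    rintro q ⟨h1, h2⟩
    refine SL_eq J hη hm h2 ?_
    rcases h1 with h1 | h1
    · have := h1.2.1; have := h2.2.1; linarith
    · exact h1.1)
  set f : ℂ × ℂ × ℂ → ℂ := _ with hf
  change Good _ f at hU
  obtain ⟨κ, hκ, hκB⟩ : ∃ κ : ℝ, 0 < κ ∧ κ * (B+3)^2 = h/4 := ⟨h/4/(B+3)^2, by positivity, by field_simp⟩
  obtain ⟨V, hV, hκV⟩ : ∃ V : ℝ, 0 < V ∧ 5 ≤ κ * V^2 := ⟨1 + 5/κ, by positivity, by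
    have h1 : κ * (5/κ) = 5 := by field_simp
    have h2 : 0 < 5/κ := by positivity
    nlinarith⟩
  let ψ : ℂ × (ℂ × ℂ) → ℂ × ℂ × ℂ := fun y => (y.2.1 - κ * (y.1 - y.2.2)^2, y.1, y.2.2)
  have hψ : Differentiable ℂ ψ := by fun_prop
  have hre : ∀ (z : ℂ) (x : ℂ × ℂ), (x.1 - κ * (z - x.2)^2).re = x.1.re - κ * ((z.re - x.2.re)^2 - (z.im - x.2.im)^2) := by
    intro z x; simp [pow_two]
  have hlow : ∀ x ∈ D1 h B, ∀ z : ℂ, -(h/4) ≤ z.re → z.re ≤ B + 2 → x.1.re - h/4 + κ * (z.im - x.2.im)^2 ≤ (x.1 - κ * (z - x.2)^2).re := by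
    intro x hx z h1 h2
    rw [hre]
    have : (z.re - x.2.re)^2 ≤ (B+3)^2 := sq_le_sq' (by linarith [hx.2.2.1]) (by linarith [hx.2.1])
    nlinarith
  have hwD : ∀ x ∈ D1 h B, -(h/4) < x.2.re ∧ x.2.re < B + 2 ∧ |x.2.im| < B + V := fun x hx =>
    ⟨by linarith [hx.2.1], by linarith [hx.2.2.1], by linarith [hx.2.2.2]⟩
  have hgood : Good (D1 h B) (rectF (-(h/4)) (B+2) (B+V) f ψ (fun x => x.2)) := by
    refine rectF_good (by linarith) (by positivity) (isOpen_D1 _ _) hψ (by fun_prop) hU hwD ?_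
    intro x hx z h1 h2 h3 h4
    have hl := hlow x hx z h1 h2
    have h0 : 0 ≤ κ * (z.im - x.2.im)^2 := by positivity
    obtain ⟨a1, a2, a3, a4⟩ := hx
    rcases h4 with h4 | h4 | h4
    · right
      refine ⟨?_, ?_, ?_, ?_, ?_⟩
      · simp only [ψ]; linarith
      · simp only [ψ]; linarith
      · simp only [ψ, add_re] ; linarith
      · simp only [ψ]; linarith
      · have : ((2:ℂ) * (J+1) * x.2).re = 2 * (J+1) * x.2.re := by
          have : ((2:ℂ) * (J+1) * x.2) = ((2 * (J+1) : ℝ):ℂ) * x.2 := by push_cast; ring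
          rw [this, re_ofReal_mul]
        simp only [ψ, add_re _ (_ * _), this]
        rw [add_re]
        have : (J:ℝ) * h ≤ J * x.2.re := by gcongr
        nlinarith
    · left; left
      exact ⟨by simp only [ψ]; linarith, by simp only [ψ]; linarith, by simp only [ψ]; linarith⟩
    · left; right
      refine ⟨?_, by simp only [ψ]; linarith, by simp only [ψ]; linarith⟩
      have : V^2 ≤ (z.im - x.2.im)^2 := by
        rw [← sq_abs (z.im - x.2.im)]
        have := abs_sub_abs_le_abs_sub z.im x.2.im
        gcongr
        linarith
      have := mul_le_mul_of_nonneg_left this hκ.le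
      simp only [ψ]; linarith
  refine ⟨_, hgood, ?_⟩
  intro x hx hx1
  obtain ⟨s0, w0⟩ := x
  simp only at hx1 ⊢
  obtain ⟨η', h0', h1', h2', h3'⟩ : ∃ η' : ℝ, 0 < η' ∧ η' ≤ 2 ∧ η' ≤ h ∧ 1 + η' < w0.re :=
    ⟨min h ((w0.re - 1)/2), by rw [lt_min_iff]; constructor <;> linarith, by linarith [min_le_left h ((w0.re - 1)/2)], min_le_left _ _,
      by linarith [min_le_right h ((w0.re - 1)/2)]⟩
  have hopen : IsOpen {t : ℂ | 1 + h < t.re} := isOpen_lt (by fun_prop) (by fun_prop)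
  have hD : ∀ t : ℂ, 1 + h < t.re → (t, w0) ∈ D1 h B := fun t ht => ⟨ht, hx.2⟩
  have g1 := (hgood.2 (fun t => (t, w0)) (by fun_prop)).mono (s := {t : ℂ | 1 + h < t.re}) hD
  have g2 := ((hS η' h0' h1').2 (fun t => (t, w0, w0)) (by fun_prop)).mono (s := {t : ℂ | 1 + h < t.re})
    (fun t ht => Or.inl ⟨by simp only [Set.mem_setOf_eq] at ht ⊢; linarith, h3', by simp only; linarith⟩)
  have hmem : (6 + h : ℂ) ∈ {t : ℂ | 1 + h < t.re} := by simp
  have hev : (fun t => rectF (-(h/4)) (B+2) (B+V) f ψ (fun x => x.2) (t, w0)) =ᶠ[𝓝 (6 + h : ℂ)]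
      (fun t => (∏ j ∈ Finset.range (J+1), (t + w0 + 2 * j * w0 - 3/2)) * ∑' p, hter m t w0 w0 p) := by
    have : ∀ᶠ t : ℂ in 𝓝 (6 + h : ℂ), 5 + h < t.re := (isOpen_lt continuous_const continuous_re).mem_nhds (by simp; norm_num)
    filter_upwards [this] with t ht
    have hx' := hD t (by linarith)
    have hw := hwD _ hx'
    have hmS : ∀ z : ℂ, -(h/4) ≤ z.re → z.re ≤ B + 2 → ψ (z, (t, w0)) ∈ Sset (h/8) := by
      intro z h1 h2
      have hl := hlow _ hx' z h1 h2
      have h0 : 0 ≤ κ * (z.im - w0.im)^2 := by positivity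
      right
      refine ⟨?_, ?_, ?_⟩
      · simp only [ψ]; simp only at hl; linarith
      · simp only [ψ]; linarith
      · simp only [ψ]; linarith
    rw [rectF_eq (isOpen_Sset (h/8)) (hU.mono Set.subset_union_left) (hψ.comp (by fun_prop : Differentiable ℂ fun z : ℂ => (z, (t, w0)))) hw.1 hw.2.1 hw.2.2
      (fun z h1 h2 _ => hmS z h1 h2)]
    have hin := hmS w0 hw.1.le hw.2.1.le
    rw [hf]
    simp only
    rw [if_pos hin]
    simp [ψ]
  exact (g1.analyticOnNhd hopen).eqOn_of_preconnected_of_eventuallyEq (g2.analyticOnNhd hopen) (convex_halfSpace_re_gt _).isPreconnected hmem hev hx.1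

noncomputable def QJ (J : ℕ) (s w : ℂ) : ℂ :=
  ∏ j ∈ Finset.range (J+1), ((s + (2*j+1)*w - 3/2) * (2*j*s + (2*j+1)*w - j - 1))

lemma QJ_symm (J : ℕ) (s w : ℂ) : QJ J (1-s) (s+w-1/2) = QJ J s w := by
  unfold QJ
  refine Finset.prod_congr rfl fun j _ => ?_
  ring

lemma QJ_good {E : Type*} [NormedAddCommGroup E] [NormedSpace ℂ E] (U : Set E) (J : ℕ) {a b : E → ℂ} (ha : Differentiable ℂ a) (hb : Differentiable ℂ b) :
    Good U (fun x => QJ J (a x) (b x)) :=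
  Good.prod _ fun j _ => Good.of_diff (by fun_prop)

noncomputable def G0 (χ : (d : ℕ) → DirichletCharacter ℂ (8 * d)) (s w : ℂ) : ℂ :=
  riemannZeta (2*w) * riemannZeta (2*s+2*w-1) * ∑' d, Lc χ s d * (d:ℂ)^(-w)

lemma zeta_good {E : Type*} [NormedAddCommGroup E] [NormedSpace ℂ E] {U : Set E} {a : E → ℂ} (ha : Differentiable ℂ a) (h : ∀ x ∈ U, 1 < (a x).re) :
    Good U (fun x => riemannZeta (a x)) := by
  refine Good.of_diff fun x hx => (DifferentiableAt.comp x (differentiableAt_riemannZeta ?_) (ha x)).differentiableWithinAt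
  intro h1; have := h x hx; rw [h1] at this; simp at this

lemma stepI (hG : GLH) {χ : (d : ℕ) → DirichletCharacter ℂ (8 * d)} (hχ : ∀ d, Odd d → Squarefree d → IsChi8 d (χ d))
    {h B : ℝ} (hh : 0 < h) (hh1 : h ≤ 1) (hB : 0 < B) {J : ℕ} (hJ : 1 ≤ J * h) :
    ∃ F : ℂ × ℂ → ℂ, Good (D1 h B) F ∧ ∀ x ∈ D1 h B, 1 < x.2.re → F x = QJ J x.1 x.2 * G0 χ x.1 x.2 := by
  obtain ⟨F1, g1, e1⟩ := hter_cont hG hh hh1 hB hJ (m := 1) (by norm_num)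
  obtain ⟨F2, g2, e2⟩ := hter_cont hG hh hh1 hB hJ (m := 2) (by norm_num)
  have hne : ∀ w : ℂ, 0 < w.re → 1 - (2:ℂ)^(-(2*w)) ≠ 0 := by
    intro w hw
    have := cpow_one_sub_ne (p := 2) le_rfl hw
    simpa using this
  have hd2 : ∀ (U : Set (ℂ × ℂ)) (a : ℂ × ℂ → ℂ), Differentiable ℂ a → Good U (fun x => (2:ℂ)^(a x)) := fun U a ha =>
    Good.of_diff fun x _ => ((ha x).const_cpow (Or.inl two_ne_zero)).differentiableWithinAt
  have k1 : Good (D1 h B) (fun x => riemannZeta (2*x.2 + 2*x.1 - 1)) := zeta_good (by fun_prop) (fun x hx => by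
    have := hx.1; have := hx.2.1; simp; linarith)
  have k2 : Good (D1 h B) (fun x => riemannZeta (2*x.1)) := zeta_good (by fun_prop) (fun x hx => by
    have := hx.1; simp; linarith)
  have k3 : Good (D1 h B) (fun x => ∏ j ∈ Finset.range J, (2*((j+1:ℕ):ℂ)*x.1 + (2*((j+1:ℕ):ℂ)+1)*x.2 - ((j+1:ℕ):ℂ) - 1)) :=
    Good.prod _ fun j _ => Good.of_diff (by fun_prop)
  have k4 := (good_const (D1 h B) 1).sub (hd2 (D1 h B) (fun x => -(2*x.1)) (by fun_prop))
  have k5 := (good_const (D1 h B) 1).sub (hd2 (D1 h B) (fun x => -(2*x.2)) (by fun_prop))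
  refine ⟨_, (((k1.mul k3).mul (k2.mul k4)).mul (g2.sub ((hd2 _ (fun x => -x.2) (by fun_prop)).mul g1))).div k5 (fun x hx => hne _ (hh.trans hx.2.1)), ?_⟩
  intro x hx hx1
  have hI := (F_ident hχ (s := x.1) (w := x.2) (by linarith [hx.1]) hx1).2
  have hn := hne x.2 (by linarith)
  have hQ : QJ J x.1 x.2 = (∏ j ∈ Finset.range (J+1), (x.1 + x.2 + 2 * j * x.2 - 3/2)) *
      ((∏ j ∈ Finset.range J, (2*((j+1:ℕ):ℂ)*x.1 + (2*((j+1:ℕ):ℂ)+1)*x.2 - ((j+1:ℕ):ℂ) - 1)) * (x.2 - 1)) := by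
    unfold QJ
    rw [Finset.prod_mul_distrib, Finset.prod_range_succ' (fun j : ℕ => 2*(j:ℂ)*x.1 + (2*j+1)*x.2 - j - 1)]
    congr 1
    · refine Finset.prod_congr rfl fun j _ => ?_
      ring
    · simp
  rw [div_eq_iff hn, e1 x hx hx1, e2 x hx hx1, hQ, G0]
  have e : 2*x.2 + 2*x.1 - 1 = 2*x.1+2*x.2-1 := by ring
  rw [e]
  linear_combination (-riemannZeta (2*x.1+2*x.2-1) * (∏ j ∈ Finset.range J, (2*((j+1:ℕ):ℂ)*x.1 + (2*((j+1:ℕ):ℂ)+1)*x.2 - ((j+1:ℕ):ℂ) - 1)) * (∏ j ∈ Finset.range (J+1), (x.1 + x.2 + 2 * j * x.2 - 3/2))) * hI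
end StepI

section StepII
open Complex Filter Topology Metric MeasureTheory
variable {χ : (d : ℕ) → DirichletCharacter ℂ (8 * d)}

lemma Lc_zero (s : ℂ) : Lc χ s 0 = 0 := by simp [Lc]

lemma Lc_FE (hχ : ∀ d, Odd d → Squarefree d → IsChi8 d (χ d)) {s : ℂ} (hs : s.re < 1) (d : ℕ) : Lc χ s d = ((8 * d : ℕ):ℂ)^(1/2 - s) * Xp s * Lc χ (1-s) d := by
  unfold Lc
  split_ifs with h
  · haveI : NeZero (8 * d) := ⟨by rcases h.1 with ⟨k, rfl⟩; omega⟩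
    exact FE_chi8 h.1 h.2 (hχ d h.1 h.2) hs
  · simp

lemma Lc_diff (hχ : ∀ d, Odd d → Squarefree d → IsChi8 d (χ d)) (d : ℕ) : Differentiable ℂ (fun s => Lc χ s d) := by
  unfold Lc
  split_ifs with h
  · haveI : NeZero (8 * d) := ⟨by rcases h.1 with ⟨k, rfl⟩; omega⟩
    exact DirichletCharacter.differentiable_LFunction (ne_one_of_prim (by omega) (chi8_isPrimitive h.1 h.2 (hχ d h.1 h.2)))
  · exact differentiable_const _

lemma Lc_crude (hχ : ∀ d, Odd d → Squarefree d → IsChi8 d (χ d)) (R : ℝ) : ∃ C : ℝ, 0 < C ∧ ∀ (d : ℕ) (z : ℂ), -1/2 ≤ z.re → ‖z‖ ≤ R → ‖Lc χ z d‖ ≤ C * (d:ℝ)^2 := by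
  obtain ⟨C, hC, h1⟩ := crude_FE (R := R) Xp (fun s => diffAt_Xp)
  refine ⟨C * 64, by positivity, fun d z hz hR => ?_⟩
  unfold Lc
  split_ifs with h
  · haveI : NeZero (8 * d) := ⟨by rcases h.1 with ⟨k, rfl⟩; omega⟩
    have hc := hχ d h.1 h.2
    refine (h1 (8*d) (χ d) (ne_one_of_prim (by omega) (chi8_isPrimitive h.1 h.2 hc)) (fun s hs => FE_chi8 h.1 h.2 hc hs) z hz hR).trans (le_of_eq ?_)
    push_cast; ring
  · simp; positivity

lemma Lc_glh (hχ : ∀ d, Odd d → Squarefree d → IsChi8 d (χ d)) (hG : GLH) {s : ℂ} (hs : 1/2 ≤ s.re) {ε : ℝ} (hε : 0 < ε) : ∃ C : ℝ, 0 < C ∧ ∀ d : ℕ, ‖Lc χ s d‖ ≤ C * (d:ℝ)^ε := by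
  unfold GLH at hG
  obtain ⟨C, hC, h1⟩ := hG ε hε s.re hs s.im
  rw [re_add_im] at h1
  refine ⟨C * 8^ε, by positivity, fun d => ?_⟩
  unfold Lc
  split_ifs with h
  · haveI : NeZero (8 * d) := ⟨by rcases h.1 with ⟨k, rfl⟩; omega⟩
    refine (h1 (8*d) (χ d) (chi8_isPrimitive h.1 h.2 (hχ d h.1 h.2))).trans (le_of_eq ?_)
    push_cast
    rw [Real.mul_rpow (by norm_num) (by positivity)]; ring
  · simp; positivity

lemma Lc_glh' (hχ : ∀ d, Odd d → Squarefree d → IsChi8 d (χ d)) (hG : GLH) (s : ℂ) {ε : ℝ} (hε : 0 < ε) : ∃ C : ℝ, 0 < C ∧ ∀ d : ℕ, ‖Lc χ s d‖ ≤ C * (d:ℝ)^(max 0 (1/2 - s.re) + ε) := by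
  rcases le_or_gt (1/2) s.re with hs | hs
  · rw [max_eq_left (by linarith), zero_add]
    exact Lc_glh hχ hG hs hε
  · rw [max_eq_right (by linarith)]
    obtain ⟨C, hC, h1⟩ := Lc_glh hχ hG (s := 1 - s) (by simp; linarith) hε
    refine ⟨8^(1/2 - s.re) * (‖Xp s‖ + 1) * C, by positivity, fun d => ?_⟩
    rcases Nat.eq_zero_or_pos d with rfl | hd
    · rw [Lc_zero, norm_zero]; positivity
    rw [Lc_FE hχ (by linarith), norm_mul, norm_mul, norm_natCast_cpow_of_pos (by omega), Real.rpow_add (by positivity)]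
    have e : (1/2 - s : ℂ).re = 1/2 - s.re := by simp
    rw [e]
    push_cast
    rw [Real.mul_rpow (by norm_num) (by positivity)]
    calc _ ≤ 8^(1/2 - s.re) * (d:ℝ)^(1/2 - s.re) * (‖Xp s‖ + 1) * (C * (d:ℝ)^ε) := by
          gcongr
          · linarith
          · exact h1 d
      _ = _ := by ring

lemma G0_FE (hχ : ∀ d, Odd d → Squarefree d → IsChi8 d (χ d)) {s : ℂ} (hs : s.re < 1) (w : ℂ) : G0 χ s w = (8:ℂ)^(1/2 - s) * Xp s * G0 χ (1-s) (s+w-1/2) := by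
  have h : ∀ d : ℕ, Lc χ s d * (d:ℂ)^(-w) = (8:ℂ)^(1/2 - s) * Xp s * (Lc χ (1-s) d * (d:ℂ)^(-(s+w-1/2))) := by
    intro d
    rcases Nat.eq_zero_or_pos d with rfl | hd
    · simp [Lc_zero]
    rw [Lc_FE hχ hs, Nat.cast_mul, Complex.natCast_mul_natCast_cpow, show -(s+w-1/2) = (1/2 - s) + -w by ring, cpow_add _ _ (by exact_mod_cast hd.ne')]
    push_cast; ring
  unfold G0
  rw [tsum_congr h, tsum_mul_left, show 2 * (s+w-1/2) = 2*s+2*w-1 by ring, show 2*(1-s) + (2*s+2*w-1) - 1 = 2*w by ring]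
  ring

def Tset (R : ℝ) : Set (ℂ × ℂ) := {x | -1/2 < x.1.re ∧ ‖x.1‖ < R ∧ 4 < x.2.re}

lemma isOpen_Tset (R : ℝ) : IsOpen (Tset R) := by
  unfold Tset
  refine IsOpen.and ?_ (IsOpen.and ?_ ?_) <;> exact isOpen_lt (by fun_prop) (by fun_prop)

lemma T_good (hχ : ∀ d, Odd d → Squarefree d → IsChi8 d (χ d)) (R : ℝ) : Good (Tset R) (fun x => G0 χ x.1 x.2) := by
  have k1 : Good (Tset R) (fun x => riemannZeta (2*x.2)) := zeta_good (by fun_prop) (fun x hx => by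
    have := hx.2.2; simp; linarith)
  have k2 : Good (Tset R) (fun x => riemannZeta (2*x.1+2*x.2-1)) := zeta_good (by fun_prop) (fun x hx => by
    have := hx.1; have := hx.2.2; simp; linarith)
  refine (k1.mul k2).mul (Good.tsum (isOpen_Tset R) (fun d => ?_) fun x hx => ?_)
  · rcases Nat.eq_zero_or_pos d with rfl | hd
    · simpa [Lc_zero] using good_const (Tset R) 0
    · exact (Good.of_diff ((Lc_diff hχ d).comp differentiable_fst).differentiableOn).mul
        (Good.of_diff (natpow_diff (by fun_prop) hd.ne').differentiableOn)
  · obtain ⟨C, hC, h1⟩ := Lc_crude hχ R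
    refine ⟨Set.univ, isOpen_univ, trivial, _, (Real.summable_nat_rpow.2 (by norm_num : (-2:ℝ) < -1)).mul_left C, fun d y hy => ?_⟩
    rcases Nat.eq_zero_or_pos d with rfl | hd
    · simp [Lc_zero]
    obtain ⟨-, a1, a2, a3⟩ := hy
    rw [norm_mul, norm_natCast_cpow_of_pos hd, neg_re]
    calc _ ≤ C * (d:ℝ)^2 * (d:ℝ)^(-4:ℝ) := by
          gcongr
          · exact h1 d _ a1.le a2.le
          · exact_mod_cast hd
      _ = C * (d:ℝ)^(-2:ℝ) := by
          rw [mul_assoc, ← Real.rpow_natCast, ← Real.rpow_add (by exact_mod_cast hd)]; norm_num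

lemma stepII (hχ : ∀ d, Odd d → Squarefree d → IsChi8 d (χ d)) (hG : GLH) {s0 : ℂ} (hs1 : 1/2 ≤ s0.re) (hs2 : s0.re ≤ 1) {h T : ℝ} (hh : 0 < h) (hh1 : h ≤ 1/8) (hT : 0 < T)
    {J : ℕ} (hJ : 1 ≤ J * h) :
    ∃ F : ℂ → ℂ, DifferentiableOn ℂ F {w | (1 - s0.re)/2 + 3*h < w.re ∧ w.re < T ∧ |w.im| < T} ∧
      ∀ w : ℂ, (1 - s0.re)/2 + 3*h < w.re → w.re < T → |w.im| < T → 6 < w.re → F w = QJ J s0 w * G0 χ s0 w := by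
  classical
  set D : Set ℂ := {w | (1 - s0.re)/2 + 3*h < w.re ∧ w.re < T ∧ |w.im| < T} with hD
  have hDo : IsOpen D := by
    refine IsOpen.and ?_ (IsOpen.and ?_ ?_) <;> exact isOpen_lt (by fun_prop) (by fun_prop)
  obtain ⟨κ, hκ, hκ9⟩ : ∃ κ : ℝ, 0 < κ ∧ κ * 9 = h := ⟨h/9, by positivity, by ring⟩
  obtain ⟨Y, hY, hκY⟩ : ∃ Y : ℝ, 0 < Y ∧ 6 ≤ κ * Y^2 := ⟨1 + 6/κ, by positivity, by
    have h1 : κ * (6/κ) = 6 := by field_simp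
    have h2 : 0 < 6/κ := by positivity
    nlinarith⟩
  obtain ⟨B, hB⟩ : ∃ B : ℝ, B = T + 10 + κ * Y^2 + 3 * Y + ‖s0‖ := ⟨_, rfl⟩
  have hn0 : 0 ≤ ‖s0‖ := norm_nonneg _
  have hκY0 : 0 < κ * Y^2 := by positivity
  obtain ⟨F, gF, eF⟩ := stepI hG hχ hh (by linarith) (by linarith : 0 < B) hJ
  obtain ⟨R, hR⟩ : ∃ R : ℝ, R = ‖s0‖ + 4 + Y := ⟨_, rfl⟩
  let φ : ℂ × ℂ → ℂ × ℂ := fun x => (1 - x.1, x.1 + x.2 - 1/2)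
  have hφ : Differentiable ℂ φ := by fun_prop
  have gL : Good (φ ⁻¹' D1 h B) (fun x => (8:ℂ)^(1/2 - x.1) * Xp x.1 * F (φ x)) := by
    refine (Good.mul ?_ ?_).mul (gF.comp hφ (fun x hx => hx))
    · exact Good.of_diff (Differentiable.const_cpow (by fun_prop) (Or.inl (by norm_num))).differentiableOn
    · refine Good.of_diff fun x hx => ?_
      have := hx.1
      simp only [φ, sub_re, one_re] at this
      exact (DifferentiableAt.comp x (diffAt_Xp (by linarith)) differentiableAt_fst).differentiableWithinAt
  have gRL := Good.union (isOpen_D1 h B) ((isOpen_D1 h B).preimage hφ.continuous) gF gL (by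
    rintro x ⟨h1, h2⟩
    have h1 := h1.1
    have h2 := h2.1
    simp only [φ, sub_re, one_re] at h2
    linarith)
  have gT := (QJ_good (Tset R) J differentiable_fst differentiable_snd).mul (T_good hχ R)
  have gU := Good.union (isOpen_Tset R) ((isOpen_D1 h B).union ((isOpen_D1 h B).preimage hφ.continuous)) gT gRL (by
    rintro x ⟨h1, h2⟩
    obtain ⟨a1, a2, a3⟩ := h1
    by_cases hx : x ∈ D1 h B
    · rw [if_pos hx, eF x hx (by linarith)]
    · rw [if_neg hx]
      have h2 := h2.resolve_left hx
      have h3 := h2.1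
      simp only [φ, sub_re, one_re] at h3
      rw [eF _ h2 (by simp only [φ, sub_re, add_re]; norm_num; linarith), G0_FE hχ (by linarith), QJ_symm]
      ring)
  set f : ℂ × ℂ → ℂ := _ with hf
  change Good _ f at gU
  let ψ : ℂ × ℂ → ℂ × ℂ := fun y => (s0 + y.1, y.2 - y.1/2 - κ * y.1^2)
  have hψ : Differentiable ℂ ψ := by fun_prop
  have hre : ∀ z w : ℂ, (w - z/2 - κ * z^2).re = w.re - z.re/2 - κ * (z.re^2 - z.im^2) := by
    intro z w; simp [pow_two]
  have him : ∀ z w : ℂ, (w - z/2 - κ * z^2).im = w.im - z.im/2 - 2 * κ * (z.re * z.im) := by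
    intro z w; simp [pow_two]; ring
  have hx3 : ∀ z : ℂ, -(s0.re + 2*h) ≤ z.re → z.re ≤ 1 + 2*h - s0.re → κ * z.re^2 ≤ h := by
    intro z h1 h2
    have : z.re^2 ≤ 3^2 := sq_le_sq' (by linarith) (by linarith)
    nlinarith
  have hbox : ∀ z w : ℂ, w ∈ D → -(s0.re + 2*h) ≤ z.re → z.re ≤ 1 + 2*h - s0.re → |z.im| ≤ Y →
      (w - z/2 - κ * z^2).re < B - 4 - Y - ‖s0‖ ∧ |(w - z/2 - κ * z^2).im| < B - 4 - Y - ‖s0‖ := by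
    rintro z w ⟨b1, b2, b3⟩ h1 h2 h3
    have i1 := hx3 z h1 h2
    have i2 : z.im^2 ≤ Y^2 := by rw [← sq_abs z.im]; gcongr
    have i3 : κ * z.im^2 ≤ κ * Y^2 := by gcongr
    have i4 : 0 ≤ κ * z.re^2 := by positivity
    refine ⟨by rw [hre]; nlinarith, ?_⟩
    rw [him]
    have i5 : |z.re * z.im| ≤ 3 * Y := by
      rw [abs_mul]; gcongr
      rw [abs_le]; constructor <;> linarith
    have i6 : |2 * κ * (z.re * z.im)| ≤ Y := by
      rw [abs_mul, abs_of_pos (by positivity)]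
      have := mul_le_mul_of_nonneg_left i5 (by positivity : 0 ≤ 2 * κ)
      nlinarith
    have j1 := abs_lt.1 b3
    have j2 := abs_le.1 h3
    have j3 := abs_le.1 i6
    rw [abs_lt]; constructor <;> linarith
  have hTs : ∀ z w : ℂ, -(s0.re + 2*h) ≤ z.re → z.re ≤ 1 + 2*h - s0.re → |z.im| ≤ Y → 4 < (w - z/2 - κ * z^2).re → ψ (z, w) ∈ Tset R := by
    intro z w h1 h2 h3 h4
    refine ⟨by simp only [ψ, add_re]; linarith, ?_, h4⟩
    have : ‖z‖ ≤ |z.re| + |z.im| := norm_le_abs_re_add_abs_im z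
    have : |z.re| ≤ 3 := by rw [abs_le]; constructor <;> linarith
    have := norm_add_le s0 z
    simp only [ψ]; linarith
  refine ⟨rectF (-(s0.re + 2*h)) (1 + 2*h - s0.re) Y f ψ (fun _ => 0), ?_, ?_⟩
  · refine Good.diff (rectF_good (by linarith) hY hDo hψ (by fun_prop) gU (fun x hx => ⟨by simp; linarith, by simp; linarith, by simpa using hY⟩) ?_)
    intro w hw z h1 h2 h3 h4
    have hb := hbox z w hw h1 h2 h3
    have i1 := hx3 z h1 h2
    have i2 : 0 ≤ κ * z.im^2 := by positivity
    obtain ⟨b1, b2, b3⟩ := hw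
    have hr := hre z w
    rcases h4 with h4 | h4 | h4
    · right; right
      refine ⟨?_, ?_, ?_, ?_⟩
      · simp only [ψ, φ, sub_re, add_re, one_re]; linarith
      · have : (s0 + z + (w - z / 2 - κ * z^2) - 1/2).re = s0.re + z.re + (w - z / 2 - κ * z^2).re - 1/2 := by
          simp only [add_re, sub_re]; norm_num
        simp only [ψ, φ, this]; linarith
      · have : (s0 + z + (w - z / 2 - κ * z^2) - 1/2).re = s0.re + z.re + (w - z / 2 - κ * z^2).re - 1/2 := by
          simp only [add_re, sub_re]; norm_num
        simp only [ψ, φ, this]; linarith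
      · have : (s0 + z + (w - z / 2 - κ * z^2) - 1/2).im = s0.im + z.im + (w - z / 2 - κ * z^2).im := by
          simp only [add_im, sub_im]; norm_num
        simp only [ψ, φ, this]
        have j1 := abs_lt.1 hb.2
        have j2 := abs_le.1 h3
        have j3 := abs_le.1 (abs_im_le_norm s0)
        rw [abs_lt]; constructor <;> linarith
    · right; left
      refine ⟨?_, ?_, ?_, ?_⟩
      · simp only [ψ, add_re]; linarith
      · simp only [ψ]; linarith
      · simp only [ψ]; linarith
      · simp only [ψ]; linarith
    · left
      refine hTs z w h1 h2 h3 ?_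
      have : z.im^2 = Y^2 := by rw [← sq_abs, h4]
      rw [hr, this]; linarith
  · intro w h1 h2 h3 h6
    have hall : ∀ z : ℂ, -(s0.re + 2*h) ≤ z.re → z.re ≤ 1 + 2*h - s0.re → |z.im| ≤ Y → ψ (z, w) ∈ Tset R := by
      intro z a1 a2 a3
      refine hTs z w a1 a2 a3 ?_
      have i1 := hx3 z a1 a2
      have i2 : 0 ≤ κ * z.im^2 := by positivity
      rw [hre]; linarith
    have a0 : -(s0.re + 2*h) < (0:ℂ).re := by simp; linarith
    have a1 : (0:ℂ).re < 1 + 2*h - s0.re := by simp; linarith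
    have a2 : |(0:ℂ).im| < Y := by simpa using hY
    rw [rectF_eq (isOpen_Tset R) (gU.mono Set.subset_union_left) (hψ.comp (by fun_prop : Differentiable ℂ fun z : ℂ => (z, w))) a0 a1 a2 hall, hf]
    simp only
    rw [if_pos (hall 0 a0.le a1.le a2.le)]
    simp [ψ]
end StepII

section Fin
open Complex Filter Topology Metric MeasureTheory
variable {χ : (d : ℕ) → DirichletCharacter ℂ (8 * d)}

def bx (c T : ℝ) : Set ℂ := {w | c < w.re ∧ w.re < T ∧ |w.im| < T}

lemma isOpen_bx (c T : ℝ) : IsOpen (bx c T) := by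
  unfold bx
  refine IsOpen.and ?_ (IsOpen.and ?_ ?_) <;> exact isOpen_lt (by fun_prop) (by fun_prop)

lemma convex_bx (c T : ℝ) : Convex ℝ (bx c T) := by
  have : bx c T = {w | c < w.re} ∩ ({w | w.re < T} ∩ ({w | -T < w.im} ∩ {w | w.im < T})) := by
    ext w; simp [bx, abs_lt]
  rw [this]
  exact (convex_halfSpace_re_gt c).inter ((convex_halfSpace_re_lt T).inter ((convex_halfSpace_im_gt _).inter (convex_halfSpace_im_lt T)))

lemma exists_J {h : ℝ} (hh : 0 < h) : ∃ J0 : ℕ, ∀ J ≥ J0, 1 ≤ (J:ℝ) * h := by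
  obtain ⟨n, hn⟩ := exists_nat_ge (1/h)
  refine ⟨n, fun J hJ => ?_⟩
  have : (n:ℝ) ≤ J := by exact_mod_cast hJ
  rw [div_le_iff₀ hh] at hn
  nlinarith

lemma box1 (hχ : ∀ d, Odd d → Squarefree d → IsChi8 d (χ d)) (hG : GLH) {s : ℂ} (hs : 1/2 ≤ s.re) {c T : ℝ} (hc0 : 0 < c) (hc : (1 - s.re)/2 < c) (hT : 0 < T) :
    ∃ J0 : ℕ, ∀ J ≥ J0, ∃ F : ℂ → ℂ, DifferentiableOn ℂ F (bx c T) ∧ ∀ w ∈ bx c T, 6 < w.re → F w = QJ J s w * G0 χ s w := by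
  rcases le_or_gt s.re 1 with h1 | h1
  · have hp : 0 < min (1/8) ((c - (1 - s.re)/2)/3) := by rw [lt_min_iff]; constructor <;> linarith
    have hl := min_le_left (1/8) ((c - (1 - s.re)/2)/3)
    have hr := min_le_right (1/8) ((c - (1 - s.re)/2)/3)
    obtain ⟨J0, hJ0⟩ := exists_J hp
    refine ⟨J0, fun J hJ => ?_⟩
    obtain ⟨F, dF, eF⟩ := stepII hχ hG hs h1 hp hl hT (hJ0 J hJ)
    exact ⟨F, dF.mono fun w hw => ⟨by linarith [hw.1], hw.2⟩, fun w hw h6 => eF w (by linarith [hw.1]) hw.2.1 hw.2.2 h6⟩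
  · have hp : 0 < min (min 1 c) ((s.re - 1)/2) := by rw [lt_min_iff, lt_min_iff]; refine ⟨⟨?_, ?_⟩, ?_⟩ <;> linarith
    have hl := min_le_left (min 1 c) ((s.re - 1)/2)
    have hr := min_le_right (min 1 c) ((s.re - 1)/2)
    have hl1 := min_le_left 1 c
    have hl2 := min_le_right 1 c
    obtain ⟨J0, hJ0⟩ := exists_J hp
    refine ⟨J0, fun J hJ => ?_⟩
    obtain ⟨F, gF, eF⟩ := stepI hG hχ hp (by linarith) hT (hJ0 J hJ)
    have hm : ∀ w ∈ bx c T, (s, w) ∈ D1 (min (min 1 c) ((s.re - 1)/2)) T := fun w hw => ⟨by simp only; linarith, by simp only; linarith [hw.1], hw.2⟩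
    exact ⟨fun w => F (s, w), (gF.2 (fun w => (s, w)) (by fun_prop)).mono hm, fun w hw h6 => eF (s, w) (hm w hw) (by simp only; linarith)⟩

lemma box2 (hχ : ∀ d, Odd d → Squarefree d → IsChi8 d (χ d)) (hG : GLH) (s : ℂ) {c T : ℝ} (h0 : 0 < c) (h1 : 1/2 < s.re + c) (h2 : 1 < s.re + 2 * c) (hT : 0 < T) :
    ∃ J0 : ℕ, ∀ J ≥ J0, ∃ F : ℂ → ℂ, DifferentiableOn ℂ F (bx c T) ∧ ∀ w ∈ bx c T, 7 + ‖s‖ < w.re → F w = QJ J s w * G0 χ s w := by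
  have hn := norm_nonneg s
  rcases le_or_gt (1/2) s.re with hs | hs
  · obtain ⟨J0, hJ⟩ := box1 hχ hG hs h0 (by linarith) hT
    refine ⟨J0, fun J hJJ => ?_⟩
    obtain ⟨F, dF, eF⟩ := hJ J hJJ
    exact ⟨F, dF, fun w hw h7 => eF w hw (by linarith)⟩
  · obtain ⟨J0, hJ⟩ := box1 hχ hG (s := 1 - s) (c := s.re + c - 1/2) (T := T + ‖s‖ + 1) (by simp; linarith) (by linarith) (by simp; linarith) (by linarith)
    refine ⟨J0, fun J hJJ => ?_⟩
    obtain ⟨F, dF, eF⟩ := hJ J hJJ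
    have hre : ∀ w : ℂ, (s + w - 1/2).re = s.re + w.re - 1/2 := fun w => by simp
    have him : ∀ w : ℂ, (s + w - 1/2).im = s.im + w.im := fun w => by simp
    have j3 := abs_le.1 (abs_im_le_norm s)
    have j4 := abs_le.1 (abs_re_le_norm s)
    have hm : ∀ w ∈ bx c T, s + w - 1/2 ∈ bx (s.re + c - 1/2) (T + ‖s‖ + 1) := by
      rintro w ⟨a1, a2, a3⟩
      have j1 := abs_lt.1 a3
      refine ⟨by rw [hre]; linarith, by rw [hre]; linarith, ?_⟩
      rw [him, abs_lt]; constructor <;> linarith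
    refine ⟨fun w => (8:ℂ)^(1/2 - s) * Xp s * F (s + w - 1/2), (dF.comp (by fun_prop) hm).const_mul _, fun w hw h7 => ?_⟩
    simp only
    rw [eF _ (hm w hw) (by rw [hre]; linarith), G0_FE hχ (s := s) (by linarith), QJ_symm]
    ring

lemma A_abs (hχ : ∀ d, Odd d → Squarefree d → IsChi8 d (χ d)) (hG : GLH) (s : ℂ) :
    (∀ w : ℂ, max 1 (3/2 - s.re) < w.re → Summable fun d : ℕ => ‖Lc χ s d * (d:ℂ)^(-w)‖) ∧
    DifferentiableOn ℂ (G0 χ s) {w | max 1 (3/2 - s.re) < w.re} := by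
  have key : ∀ w : ℂ, max 1 (3/2 - s.re) < w.re → ∃ V, IsOpen V ∧ w ∈ V ∧ ∃ b : ℕ → ℝ, Summable b ∧ ∀ d, ∀ y ∈ V, ‖Lc χ s d * (d:ℂ)^(-y)‖ ≤ b d := by
    intro w hw
    obtain ⟨ε, hε⟩ : ∃ ε : ℝ, ε = (w.re - max 1 (3/2 - s.re))/3 := ⟨_, rfl⟩
    have hmx : max 1 (3/2 - s.re) = 1 + max 0 (1/2 - s.re) := by
      rw [← max_add_add_left]; congr 1 <;> ring
    obtain ⟨C, hC, h1⟩ := Lc_glh' hχ hG s (ε := ε) (by linarith)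
    refine ⟨{y | w.re - ε < y.re}, isOpen_lt continuous_const continuous_re, by simp only [Set.mem_setOf_eq]; linarith, _,
      (Real.summable_nat_rpow.2 (by linarith : max 0 (1/2 - s.re) + ε + -(w.re - ε) < -1)).mul_left C, fun d y hy => ?_⟩
    rcases Nat.eq_zero_or_pos d with rfl | hd
    · rw [Lc_zero]; simp only [zero_mul, norm_zero]; positivity
    rw [norm_mul, norm_natCast_cpow_of_pos hd, neg_re, Real.rpow_add (by exact_mod_cast hd), ← mul_assoc]
    have : w.re - ε < y.re := hy
    gcongr
    · exact h1 d
    · exact_mod_cast hd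
  refine ⟨fun w hw => ?_, ?_⟩
  · obtain ⟨V, -, hV, b, hb, h⟩ := key w hw
    exact Summable.of_nonneg_of_le (fun _ => norm_nonneg _) (fun d => h d w hV) hb
  · have hop : IsOpen {w : ℂ | max 1 (3/2 - s.re) < w.re} := isOpen_lt continuous_const continuous_re
    have l1 := le_max_left 1 (3/2 - s.re)
    have l2 := le_max_right 1 (3/2 - s.re)
    have k1 : Good {w : ℂ | max 1 (3/2 - s.re) < w.re} (fun w => riemannZeta (2*w)) := zeta_good (by fun_prop) (fun w hw => by
      simp only [Set.mem_setOf_eq] at hw; simp; linarith)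
    have k2 : Good {w : ℂ | max 1 (3/2 - s.re) < w.re} (fun w => riemannZeta (2*s+2*w-1)) := zeta_good (by fun_prop) (fun w hw => by
      simp only [Set.mem_setOf_eq] at hw; simp; linarith)
    refine Good.diff ((k1.mul k2).mul (Good.tsum hop (fun d => ?_) fun w hw => ?_))
    · rcases Nat.eq_zero_or_pos d with rfl | hd
      · simpa [Lc_zero] using good_const _ 0
      · exact (good_const _ _).mul (Good.of_diff (natpow_diff (by fun_prop) hd.ne').differentiableOn)
    · obtain ⟨V, hVo, hV, b, hb, h⟩ := key w hw
      exact ⟨V, hVo, hV, b, hb, fun d y hy => h d y hy.1⟩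

lemma QJ_mono {J J' : ℕ} (h : J ≤ J') {s w : ℂ} (hq : QJ J' s w ≠ 0) : QJ J s w ≠ 0 := by
  rw [QJ, Finset.prod_ne_zero_iff] at hq ⊢
  exact fun j hj => hq j (Finset.range_subset_range.2 (by omega) hj)

lemma two_j (j : ℕ) : (2*(j:ℂ)+1) ≠ 0 := by exact_mod_cast (by omega : 2*j+1 ≠ 0)

lemma QJ_ne {J : ℕ} {s w : ℂ} (h : ∀ j : ℕ, w ≠ (3/2 - s)/(2*j+1) ∧ w ≠ (j + 1 - 2*j*s)/(2*j+1)) : QJ J s w ≠ 0 := by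
  rw [QJ, Finset.prod_ne_zero_iff]
  intro j _
  refine mul_ne_zero (fun h0 => (h j).1 ?_) (fun h0 => (h j).2 ?_) <;> rw [eq_div_iff (two_j j)] <;> linear_combination h0

lemma ne_ev (w a : ℂ) : ∀ᶠ y in 𝓝[≠] w, y ≠ a := by
  by_cases h : w = a
  · subst h; exact self_mem_nhdsWithin
  · exact mem_nhdsWithin_of_mem_nhds (isOpen_ne.mem_nhds h)

lemma QJ_ev (J : ℕ) (s w : ℂ) : ∀ᶠ y in 𝓝[≠] w, QJ J s y ≠ 0 := by
  have : ∀ᶠ y in 𝓝[≠] w, ∀ j ∈ Finset.range (J+1), y ≠ (3/2 - s)/(2*j+1) ∧ y ≠ (j + 1 - 2*j*s)/(2*j+1) := by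
    rw [Filter.eventually_all_finset]
    exact fun j _ => (ne_ev _ _).and (ne_ev _ _)
  filter_upwards [this] with y hy
  rw [QJ, Finset.prod_ne_zero_iff]
  intro j hj
  refine mul_ne_zero (fun h0 => (hy j hj).1 ?_) (fun h0 => (hy j hj).2 ?_) <;> rw [eq_div_iff (two_j j)] <;> linear_combination h0

lemma QJ_diff (J : ℕ) (s : ℂ) : Differentiable ℂ (QJ J s) :=
  differentiableOn_univ.1 (QJ_good Set.univ J (differentiable_const s) differentiable_id).diff

lemma ident {U : Set ℂ} (hU : IsOpen U) (hc : Convex ℝ U) {f g : ℂ → ℂ} (hf : DifferentiableOn ℂ f U) (hg : DifferentiableOn ℂ g U) {R : ℝ}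
    (h : ∀ w ∈ U, R < w.re → f w = g w) {w0 : ℂ} (h0 : w0 ∈ U) (h1 : R < w0.re) : ∀ w ∈ U, f w = g w := by
  refine (hf.analyticOnNhd hU).eqOn_of_preconnected_of_eventuallyEq (hg.analyticOnNhd hU) hc.isPreconnected h0 ?_
  filter_upwards [hU.mem_nhds h0, (isOpen_lt continuous_const continuous_re).mem_nhds h1] with w a b using h w a b

lemma final (hχ : ∀ d, Odd d → Squarefree d → IsChi8 d (χ d)) (hG : GLH) (s : ℂ) :
    ∃ G : ℂ → ℂ,
      MeromorphicOn G {w : ℂ | 1 / 2 < (s + w).re ∧ 1 < (s + 2 * w).re ∧ 0 < w.re} ∧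
      DifferentiableOn ℂ G
        ({w : ℂ | 1 / 2 < (s + w).re ∧ 1 < (s + 2 * w).re ∧ 0 < w.re} \
          {w : ℂ | w = 1 ∨ w = 3 / 2 - s ∨ ∃ j : ℕ, 1 ≤ j ∧
            (w = (3 / 2 - s) / (2 * (j : ℂ) + 1) ∨
             w = ((j : ℂ) + 1 - 2 * (j : ℂ) * s) / (2 * (j : ℂ) + 1))}) ∧
      ∀ w : ℂ, max 1 (3 / 2 - s.re) < w.re →
        (Summable fun d : ℕ => ‖Lc χ s d * (d:ℂ)^(-w)‖) ∧ G w = G0 χ s w := by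
  classical
  obtain ⟨cs, hcs0, hcs1, hcs2, hcs⟩ : ∃ cs : ℝ, 0 ≤ cs ∧ 1/2 ≤ s.re + cs ∧ 1 ≤ s.re + 2 * cs ∧ ∀ x : ℝ, 1/2 < s.re + x → 1 < s.re + 2*x → 0 < x → cs < x := by
    refine ⟨max 0 (max (1/2 - s.re) ((1 - s.re)/2)), le_max_left _ _, ?_, ?_, ?_⟩
    · have := (le_max_left (1/2 - s.re) ((1 - s.re)/2)).trans (le_max_right 0 _); linarith
    · have := (le_max_right (1/2 - s.re) ((1 - s.re)/2)).trans (le_max_right 0 _); linarith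
    · intro x a b c
      rw [max_lt_iff, max_lt_iff]
      refine ⟨?_, ?_, ?_⟩ <;> linarith
  set Ω : Set ℂ := {w : ℂ | 1 / 2 < (s + w).re ∧ 1 < (s + 2 * w).re ∧ 0 < w.re} with hΩ
  have hn := norm_nonneg s
  let c : ℕ → ℝ := fun n => cs + 1/((n:ℝ)+1)
  let T : ℕ → ℝ := fun n => cs + ‖s‖ + 10 + n
  have hc1 : ∀ n : ℕ, 0 < 1/((n:ℝ)+1) := fun n => by positivity
  have hc2 : ∀ n : ℕ, 1/((n:ℝ)+1) ≤ 1 := fun n => by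
    rw [div_le_one (by positivity)]; linarith [n.cast_nonneg (α := ℝ)]
  have hT : ∀ n : ℕ, cs + ‖s‖ + 10 ≤ T n := fun n => by simp only [T]; linarith [n.cast_nonneg (α := ℝ)]
  choose J0 hJ0 using fun n => box2 hχ hG s (c := c n) (T := T n) (by simp only [c]; linarith [hc1 n]) (by simp only [c]; linarith [hc1 n])
    (by simp only [c]; linarith [hc1 n]) (by linarith [hT n])
  let J : ℕ → ℕ := fun n => ∑ i ∈ Finset.range (n+1), J0 i
  have hJm : ∀ {m n : ℕ}, m ≤ n → J m ≤ J n := fun {m n} h => Finset.sum_le_sum_of_subset (Finset.range_subset_range.2 (by omega))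
  choose F dF eF using fun n => hJ0 n (J n) (Finset.single_le_sum (f := J0) (fun _ _ => Nat.zero_le _) (Finset.mem_range.2 (Nat.lt_succ_self n)))
  have hbm : ∀ {m n : ℕ}, m ≤ n → bx (c m) (T m) ⊆ bx (c n) (T n) := by
    intro m n h w hw
    have h' : (m:ℝ) ≤ n := by exact_mod_cast h
    have e1 : c n ≤ c m := by simp only [c]; gcongr
    have e2 : T m ≤ T n := by simp only [T]; gcongr
    exact ⟨e1.trans_lt hw.1, hw.2.1.trans_le e2, hw.2.2.trans_le e2⟩
  have hbase : ∀ n, ((cs + ‖s‖ + 8 : ℝ) : ℂ) ∈ bx (c n) (T n) := fun n => by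
    have := hc2 n; have := hT n
    refine ⟨?_, ?_, ?_⟩
    · simp only [c, ofReal_re]; linarith
    · simp only [ofReal_re]; linarith
    · simp only [ofReal_im, abs_zero]; linarith
  have hex : ∀ w ∈ Ω, ∃ n, w ∈ bx (c n) (T n) := by
    rintro w ⟨a1, a2, a3⟩
    simp only [add_re, mul_re, re_ofNat, im_ofNat, zero_mul, sub_zero] at a1 a2
    have := hcs w.re a1 a2 a3
    obtain ⟨n1, hn1⟩ := exists_nat_one_div_lt (by linarith : 0 < w.re - cs)
    obtain ⟨n2, hn2⟩ := exists_nat_gt (‖w‖)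
    have j1 := abs_re_le_norm w
    have j2 := abs_im_le_norm w
    have j3 := le_abs_self w.re
    have h1 : c (max n1 n2) ≤ c n1 := by simp only [c]; gcongr; exact le_max_left _ _
    have h2 : (n2:ℝ) ≤ (max n1 n2 : ℕ) := by exact_mod_cast le_max_right _ _
    refine ⟨max n1 n2, ?_, ?_, ?_⟩
    · refine h1.trans_lt ?_; simp only [c]; linarith
    · simp only [T]; linarith
    · simp only [T]; linarith
  have hagree : ∀ {m n : ℕ}, m ≤ n → ∀ w ∈ bx (c m) (T m), F m w * QJ (J n) s w = F n w * QJ (J m) s w := by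
    intro m n h
    refine ident (isOpen_bx _ _) (convex_bx _ _) ((dF m).mul (QJ_diff _ s).differentiableOn) (((dF n).mono (hbm h)).mul (QJ_diff _ s).differentiableOn)
      (R := 7 + ‖s‖) ?_ (hbase m) (by simp only [ofReal_re]; linarith)
    intro w hw h7
    rw [eF m w hw h7, eF n w (hbm h hw) h7]; ring
  let G : ℂ → ℂ := fun w => if h : ∃ n, w ∈ bx (c n) (T n) then F (Nat.find h) w / QJ (J (Nat.find h)) s w else 0
  have hGe : ∀ n, ∀ w ∈ bx (c n) (T n), QJ (J n) s w ≠ 0 → G w = F n w / QJ (J n) s w := by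
    intro n w hw hq
    have h : ∃ n, w ∈ bx (c n) (T n) := ⟨n, hw⟩
    have hle := Nat.find_min' h hw
    simp only [G, dif_pos h]
    rw [div_eq_div_iff (QJ_mono (hJm hle) hq) hq]
    exact hagree hle w (Nat.find_spec h)
  refine ⟨G, ?_, ?_, ?_⟩
  · intro w hw
    obtain ⟨n, hn⟩ := hex w hw
    have a1 : MeromorphicAt (F n) w := ((dF n).analyticOnNhd (isOpen_bx _ _) w hn).meromorphicAt
    have a2 : MeromorphicAt (QJ (J n) s) w := ((QJ_diff (J n) s).analyticAt w).meromorphicAt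
    refine (a1.div a2).congr ?_
    filter_upwards [QJ_ev (J n) s w, mem_nhdsWithin_of_mem_nhds ((isOpen_bx _ _).mem_nhds hn)] with y h1 h2
    exact (hGe n y h2 h1).symm
  · rintro w ⟨hw, hP⟩
    obtain ⟨n, hn⟩ := hex w hw
    have hq : QJ (J n) s w ≠ 0 := by
      refine QJ_ne fun j => ?_
      constructor <;> intro h <;> apply hP
      · rcases Nat.eq_zero_or_pos j with rfl | hj
        · right; left; simpa using h
        · right; right; exact ⟨j, hj, Or.inl h⟩
      · rcases Nat.eq_zero_or_pos j with rfl | hj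
        · left; simpa using h
        · right; right; exact ⟨j, hj, Or.inr h⟩
    have hd : DifferentiableAt ℂ (fun y => F n y / QJ (J n) s y) w :=
      ((dF n).differentiableAt ((isOpen_bx _ _).mem_nhds hn)).div (QJ_diff _ s w) hq
    refine (hd.congr_of_eventuallyEq ?_).differentiableWithinAt
    filter_upwards [(isOpen_bx _ _).mem_nhds hn, (QJ_diff (J n) s).continuous.continuousAt.eventually_ne hq] with y h1 h2
    exact hGe n y h1 h2
  · intro w hw
    refine ⟨(A_abs hχ hG s).1 w hw, ?_⟩
    have l1 := le_max_left 1 (3/2 - s.re)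
    have l2 := le_max_right 1 (3/2 - s.re)
    obtain ⟨n, hn⟩ := hex w ⟨by simp; linarith, by simp; linarith, by linarith⟩
    have hq : QJ (J n) s w ≠ 0 := by
      rw [QJ, Finset.prod_ne_zero_iff]
      intro j _
      have j0 : (0:ℝ) ≤ j := j.cast_nonneg
      refine mul_ne_zero (fun h0 => ?_) (fun h0 => ?_)
      · have := congrArg re h0
        simp at this
        nlinarith
      · have := congrArg re h0
        simp at this
        nlinarith
    rw [hGe n w hn hq, div_eq_iff hq, mul_comm (G0 χ s w)]
    have hop : IsOpen {w : ℂ | max 1 (3/2 - s.re) < w.re} := isOpen_lt continuous_const continuous_re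
    have hm8 : max 1 (3/2 - s.re) < cs + ‖s‖ + 8 := by
      rw [max_lt_iff]
      have := neg_abs_le s.re
      have := abs_re_le_norm s
      constructor <;> linarith
    exact ident ((isOpen_bx (c n) (T n)).inter hop) ((convex_bx _ _).inter (convex_halfSpace_re_gt _)) ((dF n).mono Set.inter_subset_left)
      ((QJ_diff (J n) s).differentiableOn.mul ((A_abs hχ hG s).2.mono Set.inter_subset_right)) (R := 7 + ‖s‖)
      (fun y hy h7 => eF n y hy.1 h7) (w0 := ((cs + ‖s‖ + 8 : ℝ) : ℂ)) ⟨hbase n, by simpa using hm8⟩ (by simp only [ofReal_re]; linarith) w ⟨hn, hw⟩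
end Fin

/-- meromorphic continuation of `ζ(2w)ζ(2s+2w-1)A(s,w)` (as a function of `w`,
with `s` fixed) to the region `Ω_s = {Re(s+w) > 1/2, Re(s+2w) > 1, Re w > 0}`, holomorphic away
from the possible poles `w = 1`, `w = 3/2-s`, `w = (3/2-s)/(2j+1)`, `w = (j+1-2js)/(2j+1)`. -/
theorem statement3
    (hGLH : GLH)
    (χ : (d : ℕ) → DirichletCharacter ℂ (8 * d))
    (hχ : ∀ d : ℕ, Odd d → Squarefree d →
      (∀ n : ℕ, Odd n → χ d (n : ZMod (8 * d)) = ((jacobiSym (8 * d) n : ℤ) : ℂ)) ∧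
      (∀ n : ℕ, Even n → χ d (n : ZMod (8 * d)) = 0))
    (s : ℂ) :
    ∃ G : ℂ → ℂ,
      MeromorphicOn G {w : ℂ | 1 / 2 < (s + w).re ∧ 1 < (s + 2 * w).re ∧ 0 < w.re} ∧
      DifferentiableOn ℂ G
        ({w : ℂ | 1 / 2 < (s + w).re ∧ 1 < (s + 2 * w).re ∧ 0 < w.re} \
          {w : ℂ | w = 1 ∨ w = 3 / 2 - s ∨ ∃ j : ℕ, 1 ≤ j ∧
            (w = (3 / 2 - s) / (2 * (j : ℂ) + 1) ∨
             w = ((j : ℂ) + 1 - 2 * (j : ℂ) * s) / (2 * (j : ℂ) + 1))}) ∧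
      ∀ w : ℂ, max 1 (3 / 2 - s.re) < w.re →
        Summable (fun d : ℕ => ‖(if h : Odd d ∧ Squarefree d then
            haveI : NeZero (8 * d) := ⟨by rcases h.1 with ⟨k, rfl⟩; omega⟩
            (χ d).LFunction s * (d : ℂ) ^ (-w) else 0)‖) ∧
        G w = riemannZeta (2 * w) * riemannZeta (2 * s + 2 * w - 1) *
          ∑' d : ℕ, if h : Odd d ∧ Squarefree d then
            haveI : NeZero (8 * d) := ⟨by rcases h.1 with ⟨k, rfl⟩; omega⟩
            (χ d).LFunction s * (d : ℂ) ^ (-w) else 0 := by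
  obtain ⟨G, h1, h2, h3⟩ := final (χ := χ) hχ hGLH s
  refine ⟨G, h1, h2, fun w hw => ?_⟩
  obtain ⟨a1, a2⟩ := h3 w hw
  have e : ∀ d : ℕ, (if h : Odd d ∧ Squarefree d then
            haveI : NeZero (8 * d) := ⟨by rcases h.1 with ⟨k, rfl⟩; omega⟩
            (χ d).LFunction s * (d : ℂ) ^ (-w) else 0) = Lc χ s d * (d:ℂ)^(-w) := by
    intro d
    unfold Lc
    split_ifs
    · rfl
    · rw [zero_mul]
  exact ⟨a1.congr fun d => congrArg norm (e d).symm, a2.trans (congrArg _ (tsum_congr fun d => (e d).symm))⟩
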